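/- Let G be a (possibly infinite) graph and let T ⊆ V(G) be countable such that there is no X ⊆ V(G)∖T for which d_G(X) is an odd natural number. Then there exists a system 𝒫 of pairwise edge-disjoint T-paths such that for every t ∈ T one can choose exactly one edge from each path P ∈ 𝒫 having t as an end-vertex in such a way that the resulting edge set C is a cut separating t and T−t. -/

import Mathlib

/-!
Common definitions: multigraphs (parallel edges allowed, no loops), walks,
paths, cuts, waves and related notions used in the statements below.
-/

universe u v

/-- A multigraph with vertex type `V` and edge type `E`: every edge is assigned
an unordered pair of *distinct* end-vertices (parallel edges allowed, no loops). -/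
structure Multigraph (V : Type u) (E : Type v) : Type (max u v) where
  inc : E → Sym2 V
  not_isDiag : ∀ e, ¬ (inc e).IsDiag

namespace Multigraph

variable {V : Type u} {E : Type v}

/-- Walks in a multigraph, recorded together with the edges they traverse. -/
inductive Walk (G : Multigraph V E) : V → V → Type (max u v)
  | nil (v : V) : Walk G v v
  | cons {u v w : V} (e : E) (he : G.inc e = s(u, v)) (p : Walk G v w) : Walk G u w

namespace Walk

variable {G : Multigraph V E}

/-- The list of vertices visited by a walk. -/
def support : ∀ {u w : V}, G.Walk u w → List V
  | _, _, .nil v => [v]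
  | u, _, .cons _ _ p => u :: p.support

/-- The list of edges traversed by a walk. -/
def edges : ∀ {u w : V}, G.Walk u w → List E
  | _, _, .nil _ => []
  | _, _, .cons e _ p => e :: p.edges

end Walk

/-- `δ_G(v)`: the set of edges incident with the vertex `v`. -/
def inci (G : Multigraph V E) (v : V) : Set E := {e | v ∈ G.inc e}

/-- `δ_G(X)`: the set of edges with exactly one end-vertex in `X`. -/
def cut (G : Multigraph V E) (X : Set V) : Set E :=
  {e | ∃ x y, G.inc e = s(x, y) ∧ x ∈ X ∧ y ∉ X}

/-- Connectedness of a multigraph. -/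
def Connected (G : Multigraph V E) : Prop := ∀ u v : V, Nonempty (G.Walk u v)

/-- A `T`-path: a path connecting two distinct vertices of `T`
with no internal vertex in `T`. -/
structure TPath (G : Multigraph V E) (T : Set V) : Type (max u v) where
  first : V
  last : V
  walk : G.Walk first last
  first_mem : first ∈ T
  last_mem : last ∈ T
  ne : first ≠ last
  support_nodup : walk.support.Nodup
  internal : ∀ x ∈ walk.support, x ∈ T → x = first ∨ x = last

/-- A system of pairwise edge-disjoint `T`-paths. -/
def TPathDisjoint (G : Multigraph V E) {T : Set V} (P : Set (G.TPath T)) : Prop :=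
  ∀ p ∈ P, ∀ q ∈ P, p ≠ q → ∀ e, e ∈ p.walk.edges → e ∉ q.walk.edges

/-- An `st`-path: a path from `s` to `t` (no internal vertex is `s` or `t`,
which is automatic as the vertices of a path are distinct). -/
structure STPath (G : Multigraph V E) (s t : V) : Type (max u v) where
  walk : G.Walk s t
  support_nodup : walk.support.Nodup

/-- A system of pairwise edge-disjoint `st`-paths. -/
def STPathDisjoint (G : Multigraph V E) {s t : V} (P : Set (G.STPath s t)) : Prop :=
  ∀ p ∈ P, ∀ q ∈ P, p ≠ q → ∀ e, e ∈ p.walk.edges → e ∉ q.walk.edges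

/-- A nontrivial path starting at `s`. -/
structure SPath (G : Multigraph V E) (s : V) : Type (max u v) where
  last : V
  walk : G.Walk s last
  support_nodup : walk.support.Nodup
  edges_ne_nil : walk.edges ≠ []

/-- A system of pairwise edge-disjoint paths starting at `s`. -/
def SPathDisjoint (G : Multigraph V E) {s : V} (W : Set (G.SPath s)) : Prop :=
  ∀ p ∈ W, ∀ q ∈ W, p ≠ q → ∀ e, e ∈ p.walk.edges → e ∉ q.walk.edges

/-- The set of last edges of a system of paths starting at `s`. -/
def lastEdges (G : Multigraph V E) {s : V} (W : Set (G.SPath s)) : Set E :=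
  {e | ∃ p ∈ W, p.walk.edges.getLast? = some e}

/-- `C` is a cut separating `A` from `B`. -/
def SepCut (G : Multigraph V E) (A B : Set V) (C : Set E) : Prop :=
  ∃ X : Set V, A ⊆ X ∧ (∀ b ∈ B, b ∉ X) ∧ C = G.cut X

/-- `C` is a `⊆`-minimal cut separating `A` from `B`. -/
def IsMinSepCut (G : Multigraph V E) (A B : Set V) (C : Set E) : Prop :=
  G.SepCut A B C ∧ ∀ D : Set E, G.SepCut A B D → D ⊆ C → D = C

/-- An `s`-`B`-wave: a system of pairwise edge-disjoint paths starting at `s`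
whose set of last edges is a `⊆`-minimal cut separating `s` from `B`. -/
def IsWave (G : Multigraph V E) (s : V) (B : Set V) (W : Set (G.SPath s)) : Prop :=
  G.SPathDisjoint W ∧ G.IsMinSepCut {s} B (G.lastEdges W)

/-- An Erdős–Menger `st`-cut: an `st`-cut which is orthogonal to some system of
pairwise edge-disjoint `st`-paths, i.e. it consists of exactly one edge chosen
from each path of the system. -/
def IsEMCut (G : Multigraph V E) (s t : V) (C : Set E) : Prop :=
  (∃ X : Set V, s ∈ X ∧ t ∉ X ∧ C = G.cut X) ∧
  ∃ P : Set (G.STPath s t), G.STPathDisjoint P ∧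
    (∀ p ∈ P, ∃! e, e ∈ C ∧ e ∈ p.walk.edges) ∧
    (∀ e ∈ C, ∃ p ∈ P, e ∈ p.walk.edges)

/-- The order `≼` on `st`-cuts: the `s`-side of `C` is contained in the
`s`-side of `D` (in a connected graph the `s`-side is unique). -/
def CutLE (G : Multigraph V E) (s t : V) (C D : Set E) : Prop :=
  ∃ X Y : Set V, s ∈ X ∧ t ∉ X ∧ C = G.cut X ∧ s ∈ Y ∧ t ∉ Y ∧ D = G.cut Y ∧ X ⊆ Y

/-- A cut of the form `C_W` for some `st`-wave `W`. -/
def IsWaveCut (G : Multigraph V E) (s t : V) (C : Set E) : Prop :=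
  ∃ W : Set (G.SPath s), G.IsWave s {t} W ∧ G.lastEdges W = C

/-- Deletion of a set of edges. -/
def deleteEdges (G : Multigraph V E) (F : Set E) : Multigraph V {e : E // e ∉ F} where
  inc e := G.inc e.1
  not_isDiag e := G.not_isDiag e.1

open Classical in
/-- Contraction of the vertex set `X` to the vertex `s` (edges inside `X` are
deleted, edges leaving `X` are redirected to `s`). -/
noncomputable def contract (G : Multigraph V E) (X : Set V) (s : V) :
    Multigraph V {e : E // ¬ (Sym2.map (fun v => if v ∈ X then s else v) (G.inc e)).IsDiag} where
  inc e := Sym2.map (fun v => if v ∈ X then s else v) (G.inc e.1)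
  not_isDiag e := e.2

/-- Reachability inside a set `S` of vertices. -/
def ReachableIn (G : Multigraph V E) (S : Set V) (x y : V) : Prop :=
  ∃ p : G.Walk x y, ∀ z ∈ p.support, z ∈ S

/-- `Y` is (the vertex set of) a connected component of the subgraph of `G`
induced by `S`. -/
def IsComponentOf (G : Multigraph V E) (Y S : Set V) : Prop :=
  Y.Nonempty ∧ Y ⊆ S ∧ ∀ x ∈ Y, ∀ y ∈ S, (G.ReachableIn S x y ↔ y ∈ Y)

/-- A cycle in a multigraph (a closed walk with distinct edges whose
vertices are distinct except that the first one equals the last one). -/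
structure Cycle (G : Multigraph V E) : Type (max u v) where
  base : V
  walk : G.Walk base base
  edges_ne_nil : walk.edges ≠ []
  edges_nodup : walk.edges.Nodup
  support_tail_nodup : walk.support.tail.Nodup

/-- A graph is Eulerian if its edge set can be partitioned into
edge sets of cycles. -/
def IsEulerian (G : Multigraph V E) : Prop :=
  ∃ C : Set G.Cycle,
    (∀ c ∈ C, ∀ d ∈ C, c ≠ d → ∀ e, e ∈ c.walk.edges → e ∉ d.walk.edges) ∧
    ∀ e : E, ∃ c ∈ C, e ∈ c.walk.edges

/-- A `T`-partition: a family `{A t : t ∈ T}` of pairwise disjoint vertex sets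
with `A t ∩ T = {t}`. -/
def IsTPartition (T : Set V) (A : V → Set V) : Prop :=
  (∀ t ∈ T, A t ∩ T = {t}) ∧
  ∀ t₁ ∈ T, ∀ t₂ ∈ T, t₁ ≠ t₂ → Disjoint (A t₁) (A t₂)

end Multigraph

universe w
namespace LC

/-- An auxiliary graph: every edge has two ends. -/
structure Gr (V : Type u) (E : Type v) where
  s : E → V
  t : E → V

variable {V : Type u} {E : Type v}

namespace Gr

/-- `e` joins `a` and `b`. -/
def Jn (G : Gr V E) (e : E) (a b : V) : Prop :=
  (G.s e = a ∧ G.t e = b) ∨ (G.s e = b ∧ G.t e = a)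

/-- the edges of `S` with exactly one end in `X` -/
def cut (G : Gr V E) (S : Set E) (X : Set V) : Set E :=
  {e | e ∈ S ∧ ((G.s e ∈ X ∧ G.t e ∉ X) ∨ (G.t e ∈ X ∧ G.s e ∉ X))}

/-- the edges of `S` with both ends in `X` -/
def ins (G : Gr V E) (S : Set E) (X : Set V) : Set E :=
  {e | e ∈ S ∧ G.s e ∈ X ∧ G.t e ∈ X}

/-- `e` avoids `Y` -/
def Av (G : Gr V E) (Y : Set V) (e : E) : Prop := G.s e ∉ Y ∧ G.t e ∉ Y

/-- walks as lists of edges -/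
def Wlk (G : Gr V E) : V → List E → V → Prop
  | a, [], b => a = b
  | a, e :: l, b => ∃ c, G.Jn e a c ∧ Wlk G c l b

variable {G : Gr V E} {S S' P P' : Set E} {X Y A : Set V}

theorem Jn.symm {e : E} {a b : V} (h : G.Jn e a b) : G.Jn e b a := by
  rcases h with h | h
  · exact Or.inr h
  · exact Or.inl h

theorem Jn.det {e : E} {a b c : V} (h : G.Jn e a b) (h' : G.Jn e a c) : b = c := by
  rcases h with ⟨h1, h2⟩ | ⟨h1, h2⟩ <;> rcases h' with ⟨h3, h4⟩ | ⟨h3, h4⟩ <;> simp_all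

theorem Jn.self (G : Gr V E) (e : E) : G.Jn e (G.s e) (G.t e) := Or.inl ⟨rfl, rfl⟩

theorem Jn.pair {e : E} {a b c d : V} (h : G.Jn e a b) (h' : G.Jn e c d) :
    (c = a ∧ d = b) ∨ (c = b ∧ d = a) := by
  rcases h with ⟨h1, h2⟩ | ⟨h1, h2⟩ <;> rcases h' with ⟨h3, h4⟩ | ⟨h3, h4⟩ <;> simp_all

theorem Jn.mem_cut {e : E} {a b : V} (h : G.Jn e a b) :
    e ∈ G.cut S X ↔ e ∈ S ∧ ((a ∈ X ∧ b ∉ X) ∨ (b ∈ X ∧ a ∉ X)) := by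
  rcases h with ⟨h1, h2⟩ | ⟨h1, h2⟩
  · subst h1 h2; rfl
  · subst h1 h2; simp only [cut, Set.mem_ofPred_eq]; tauto

theorem Jn.mem_ins {e : E} {a b : V} (h : G.Jn e a b) :
    e ∈ G.ins S X ↔ e ∈ S ∧ a ∈ X ∧ b ∈ X := by
  rcases h with ⟨h1, h2⟩ | ⟨h1, h2⟩
  · subst h1 h2; rfl
  · subst h1 h2; simp only [ins, Set.mem_ofPred_eq]; tauto

theorem Jn.av {e : E} {a b : V} (h : G.Jn e a b) :
    G.Av Y e ↔ a ∉ Y ∧ b ∉ Y := by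
  rcases h with ⟨h1, h2⟩ | ⟨h1, h2⟩
  · subst h1 h2; rfl
  · subst h1 h2; simp only [Av]; tauto

theorem mem_cut_iff {e : E} :
    e ∈ G.cut S X ↔ e ∈ S ∧ ∃ x ∈ X, ∃ y, y ∉ X ∧ G.Jn e x y := by
  constructor
  · rintro ⟨h, (⟨h1, h2⟩ | ⟨h1, h2⟩)⟩
    · exact ⟨h, _, h1, _, h2, Jn.self G e⟩
    · exact ⟨h, _, h1, _, h2, (Jn.self G e).symm⟩
  · rintro ⟨h, x, hx, y, hy, hj⟩
    exact hj.mem_cut.2 ⟨h, Or.inl ⟨hx, hy⟩⟩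

theorem cut_sub : G.cut S X ⊆ S := fun _ h => h.1
theorem ins_sub : G.ins S X ⊆ S := fun _ h => h.1
theorem cut_mono (h : S ⊆ S') : G.cut S X ⊆ G.cut S' X := fun _ h' => ⟨h h'.1, h'.2⟩
theorem ins_mono (h : S ⊆ S') (h2 : X ⊆ Y) : G.ins S X ⊆ G.ins S' Y :=
  fun _ h' => ⟨h h'.1, h2 h'.2.1, h2 h'.2.2⟩

theorem ins_not_cut {e : E} (h : e ∈ G.ins S X) : e ∉ G.cut S' X := by
  rintro ⟨_, (⟨h1, h2⟩ | ⟨h1, h2⟩)⟩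
  · exact h2 h.2.2
  · exact h2 h.2.1

theorem Av.not_cut {e : E} (h : G.Av X e) : e ∉ G.cut S' X := by
  rintro ⟨_, (⟨h1, h2⟩ | ⟨h1, h2⟩)⟩
  · exact h.1 h1
  · exact h.2 h1

theorem Av.not_ins {e : E} (h : G.Av X e) : e ∉ G.ins S' X := fun h' => h.1 h'.2.1

theorem Wlk.append {a b c : V} {l l' : List E} (h : G.Wlk a l b) (h' : G.Wlk b l' c) :
    G.Wlk a (l ++ l') c := by
  induction l generalizing a with
  | nil => cases h; exact h'
  | cons e l ih =>
    obtain ⟨d, hd, h⟩ := h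
    exact ⟨d, hd, ih h⟩

theorem Wlk.split {a c : V} {l l' : List E} (h : G.Wlk a (l ++ l') c) :
    ∃ b, G.Wlk a l b ∧ G.Wlk b l' c := by
  induction l generalizing a with
  | nil => exact ⟨a, rfl, h⟩
  | cons e l ih =>
    obtain ⟨d, hd, h⟩ := h
    obtain ⟨b, h1, h2⟩ := ih h
    exact ⟨b, ⟨d, hd, h1⟩, h2⟩

theorem Wlk.det {a b c : V} {l : List E} (h : G.Wlk a l b) (h' : G.Wlk a l c) : b = c := by
  induction l generalizing a with
  | nil => cases h; cases h'; rfl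
  | cons e l ih =>
    obtain ⟨d, hd, h⟩ := h
    obtain ⟨d', hd', h'⟩ := h'
    obtain rfl := hd.det hd'
    exact ih h h'

theorem Wlk.split_at {a b c : V} {l l' : List E} (h : G.Wlk a (l ++ l') c) (h1 : G.Wlk a l b) :
    G.Wlk b l' c := by
  obtain ⟨b', h2, h3⟩ := h.split
  obtain rfl := h1.det h2
  exact h3

theorem Wlk.single {a b : V} {e : E} (h : G.Jn e a b) : G.Wlk a [e] b := ⟨b, h, rfl⟩

theorem Wlk.reverse {a b : V} {l : List E} (h : G.Wlk a l b) : G.Wlk b l.reverse a := by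
  induction l generalizing a with
  | nil => exact h.symm
  | cons e l ih =>
    obtain ⟨d, hd, h⟩ := h
    rw [List.reverse_cons]
    exact (ih h).append (Wlk.single hd.symm)

/-- the walk from `a` along `l` visits `Y` -/
def Vis (G : Gr V E) (Y : Set V) (a : V) (l : List E) : Prop :=
  ∃ l1 l2 w, l = l1 ++ l2 ∧ G.Wlk a l1 w ∧ w ∈ Y

theorem not_vis_av {a b : V} {l : List E} (h : G.Wlk a l b) (hn : ¬ G.Vis Y a l) :
    (∀ e ∈ l, G.Av Y e) ∧ a ∉ Y ∧ b ∉ Y := by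
  induction l generalizing a with
  | nil =>
    cases h
    have hb : b ∉ Y := fun hb => hn ⟨[], [], b, rfl, rfl, hb⟩
    simp [hb]
  | cons e l ih =>
    obtain ⟨d, hd, h⟩ := h
    have ha : a ∉ Y := fun ha => hn ⟨[], _, a, rfl, rfl, ha⟩
    have := ih h (by
      rintro ⟨l1, l2, w, rfl, h1, h2⟩
      exact hn ⟨e :: l1, l2, w, rfl, ⟨d, hd, h1⟩, h2⟩)
    refine ⟨?_, ha, this.2.2⟩
    intro e' he'
    rcases List.mem_cons.1 he' with rfl | he'
    · exact hd.av.2 ⟨ha, this.2.1⟩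
    · exact this.1 _ he'

theorem vis_of_end {a b : V} {l : List E} (h : G.Wlk a l b) (hb : b ∈ Y) : G.Vis Y a l :=
  ⟨l, [], b, by simp, h, hb⟩

theorem vis_of_mem {a b : V} {l : List E} (h : G.Wlk a l b) {e : E} (he : e ∈ l)
    (hy : ¬ G.Av Y e) : G.Vis Y a l := by
  by_contra hn
  exact hy ((not_vis_av h hn).1 e he)

/-- after its start `w` the walk `l` does not meet `Y` -/
def Clean (G : Gr V E) (Y : Set V) (w : V) (l : List E) : Prop :=
  ∀ e l', l = e :: l' → (∃ c, G.Jn e w c ∧ c ∉ Y) ∧ ∀ e' ∈ l', G.Av Y e'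

theorem last_vis {a b : V} {l : List E} (h : G.Wlk a l b) (hv : G.Vis Y a l) :
    ∃ l1 l2 w, l = l1 ++ l2 ∧ G.Wlk a l1 w ∧ w ∈ Y ∧ G.Wlk w l2 b ∧ G.Clean Y w l2 := by
  induction l generalizing a with
  | nil =>
    obtain ⟨l1, l2, w, h1, h2, h3⟩ := hv
    obtain ⟨rfl, rfl⟩ : l1 = [] ∧ l2 = [] := by simpa using h1.symm
    exact ⟨[], [], w, rfl, h2, h3, by cases h2; exact h, by intro e l' h; cases h⟩
  | cons e l ih =>
    obtain ⟨d, hd, h⟩ := h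
    by_cases hv' : G.Vis Y d l
    · obtain ⟨l1, l2, w, rfl, h1, h2, h3, h4⟩ := ih h hv'
      exact ⟨e :: l1, l2, w, rfl, ⟨d, hd, h1⟩, h2, h3, h4⟩
    · have hav := not_vis_av h hv'
      have ha : a ∈ Y := by
        obtain ⟨l1, l2, w, h1, h2, h3⟩ := hv
        cases l1 with
        | nil => cases h2; exact h3
        | cons e' l1 =>
          simp only [List.cons_append, List.cons.injEq] at h1
          obtain ⟨rfl, rfl⟩ := h1
          obtain ⟨d', hd', h2⟩ := h2
          obtain rfl := hd.det hd'
          exact (hv' ⟨l1, l2, w, rfl, h2, h3⟩).elim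
      refine ⟨[], e :: l, a, rfl, rfl, ha, ⟨d, hd, h⟩, ?_⟩
      intro e' l' hl
      simp only [List.cons.injEq] at hl
      obtain ⟨rfl, rfl⟩ := hl
      exact ⟨⟨d, hd, hav.2.1⟩, hav.1⟩

/-- last exit from `X` -/
theorem last_exit {a b : V} {l : List E} (h : G.Wlk a l b) (ha : G.Vis X a l) (hb : b ∉ X) :
    ∃ l1 f l2 x y, l = l1 ++ f :: l2 ∧ G.Wlk a l1 x ∧ x ∈ X ∧ G.Jn f x y ∧ y ∉ X ∧
      G.Wlk y l2 b ∧ ∀ e ∈ l2, G.Av X e := by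
  obtain ⟨l1, l2, w, h1, h2, h3, h4, h5⟩ := last_vis h ha
  cases l2 with
  | nil => cases h4; exact (hb h3).elim
  | cons f l2 =>
    obtain ⟨⟨c, hc, hcX⟩, hav⟩ := h5 f l2 rfl
    obtain ⟨c', hc', h4⟩ := h4
    obtain rfl := hc.det hc'
    exact ⟨l1, f, l2, w, c, h1, h2, h3, hc, hcX, h4, hav⟩

theorem vis_start {a : V} {l : List E} (ha : a ∈ X) : G.Vis X a l := ⟨[], l, a, rfl, rfl, ha⟩

/-- reachability -/
def Reach (G : Gr V E) (P : Set E) (a b : V) : Prop := ∃ l, G.Wlk a l b ∧ ∀ e ∈ l, e ∈ P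

theorem Reach.refl (a : V) : G.Reach P a a := ⟨[], rfl, by simp⟩
theorem Reach.symm {a b : V} (h : G.Reach P a b) : G.Reach P b a := by
  obtain ⟨l, h1, h2⟩ := h
  exact ⟨l.reverse, h1.reverse, by simpa using h2⟩
theorem Reach.trans {a b c : V} (h : G.Reach P a b) (h' : G.Reach P b c) : G.Reach P a c := by
  obtain ⟨l, h1, h2⟩ := h
  obtain ⟨l', h1', h2'⟩ := h'
  exact ⟨l ++ l', h1.append h1', by
    intro e he
    rcases List.mem_append.1 he with he | he
    · exact h2 e he
    · exact h2' e he⟩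
theorem Reach.mono {a b : V} (h : G.Reach P a b) (hP : P ⊆ P') : G.Reach P' a b := by
  obtain ⟨l, h1, h2⟩ := h
  exact ⟨l, h1, fun e he => hP (h2 e he)⟩
theorem Reach.single {a b : V} {e : E} (h : G.Jn e a b) (he : e ∈ P) : G.Reach P a b :=
  ⟨[e], Wlk.single h, by simpa using he⟩

theorem Reach.mem_of_closed {a b : V} (h : G.Reach P a b) (ha : a ∈ X)
    (hX : ∀ e ∈ P, e ∉ G.cut P X) : b ∈ X := by
  by_contra hb
  obtain ⟨l, h1, h2⟩ := h
  obtain ⟨l1, f, l2, x, y, rfl, _, hx, hj, hy, _⟩ := last_exit h1 (vis_start ha) hb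
  have hf : f ∈ P := h2 f (by simp)
  exact hX f hf (hj.mem_cut.2 ⟨hf, Or.inl ⟨hx, hy⟩⟩)

/-- simple walks with their vertex lists -/
def SP (G : Gr V E) : V → List E → V → List V → Prop
  | a, [], b, vs => a = b ∧ vs = [a]
  | a, e :: l, b, vs => ∃ c vs', G.Jn e a c ∧ SP G c l b vs' ∧ vs = a :: vs'

theorem SP.wlk {a b : V} {l : List E} {vs : List V} (h : G.SP a l b vs) : G.Wlk a l b := by
  induction l generalizing a vs with
  | nil => exact h.1
  | cons e l ih =>
    obtain ⟨c, vs', h1, h2, _⟩ := h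
    exact ⟨c, h1, ih h2⟩

theorem SP.suffix {a b x : V} {l : List E} {vs : List V} (h : G.SP a l b vs) (hx : x ∈ vs) :
    ∃ l2 vs2, G.SP x l2 b vs2 ∧ l2 <:+ l ∧ vs2 <:+ vs := by
  induction l generalizing a vs with
  | nil =>
    obtain ⟨rfl, rfl⟩ := h
    obtain rfl : x = a := by simpa using hx
    exact ⟨[], [x], ⟨rfl, rfl⟩, List.suffix_refl _, List.suffix_refl _⟩
  | cons e l ih =>
    obtain ⟨c, vs', h1, h2, rfl⟩ := h
    rcases List.mem_cons.1 hx with rfl | hx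
    · exact ⟨e :: l, x :: vs', ⟨c, vs', h1, h2, rfl⟩, List.suffix_refl _, List.suffix_refl _⟩
    · obtain ⟨l2, vs2, h3, h4, h5⟩ := ih h2 hx
      exact ⟨l2, vs2, h3, h4.trans (List.suffix_cons _ _), h5.trans (List.suffix_cons _ _)⟩

theorem SP.ends {a b : V} {l : List E} {vs : List V} (h : G.SP a l b vs) {e : E} (he : e ∈ l) :
    G.s e ∈ vs ∧ G.t e ∈ vs := by
  induction l generalizing a vs with
  | nil => cases he
  | cons e' l ih =>
    obtain ⟨c, vs', h1, h2, rfl⟩ := h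
    have hc : c ∈ vs' := by
      cases l with
      | nil => simp [h2.2]
      | cons e2 l2 => obtain ⟨c', vs'', _, _, rfl⟩ := h2; simp
    rcases List.mem_cons.1 he with rfl | he
    · rcases h1 with ⟨h1, h1'⟩ | ⟨h1, h1'⟩ <;> simp [h1, h1', hc]
    · have := ih h2 he
      simp [this.1, this.2]

theorem SP.nodup {a b : V} {l : List E} {vs : List V} (h : G.SP a l b vs) (hn : vs.Nodup) :
    l.Nodup := by
  induction l generalizing a vs with
  | nil => simp
  | cons e l ih =>
    obtain ⟨c, vs', h1, h2, rfl⟩ := h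
    rw [List.nodup_cons] at hn ⊢
    refine ⟨fun he => hn.1 ?_, ih h2 hn.2⟩
    have := h2.ends he
    rcases h1 with ⟨h1, h1'⟩ | ⟨h1, h1'⟩
    · rw [← h1]; exact this.1
    · rw [← h1']; exact this.2

theorem Wlk.simple {a b : V} {l : List E} (h : G.Wlk a l b) :
    ∃ l' vs, G.SP a l' b vs ∧ vs.Nodup ∧ ∀ e ∈ l', e ∈ l := by
  induction l generalizing a with
  | nil => exact ⟨[], [a], ⟨h, rfl⟩, by simp, by simp⟩
  | cons e l ih =>
    obtain ⟨c, h1, h2⟩ := h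
    obtain ⟨l', vs, h3, h4, h5⟩ := ih h2
    by_cases ha : a ∈ vs
    · obtain ⟨l2, vs2, h6, h7, h8⟩ := h3.suffix ha
      exact ⟨l2, vs2, h6, h4.sublist h8.sublist,
        fun e' he' => List.mem_cons_of_mem _ (h5 e' (h7.subset he'))⟩
    · refine ⟨e :: l', a :: vs, ⟨c, vs, h1, h3, rfl⟩, List.nodup_cons.2 ⟨ha, h4⟩, ?_⟩
      intro e' he'
      rcases List.mem_cons.1 he' with rfl | he'
      · simp
      · exact List.mem_cons_of_mem _ (h5 e' he')

theorem Reach.trail {a b : V} (h : G.Reach P a b) :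
    ∃ l, G.Wlk a l b ∧ l.Nodup ∧ ∀ e ∈ l, e ∈ P := by
  obtain ⟨l, h1, h2⟩ := h
  obtain ⟨l', vs, h3, h4, h5⟩ := h1.simple
  exact ⟨l', h3.wlk, h3.nodup h4, fun e he => h2 e (h5 e he)⟩

open Classical in
theorem Wlk.cross {a b : V} {l : List E} (h : G.Wlk a l b) (U : Set V) :
    Even ((l.filter (fun e => decide (e ∈ G.cut Set.univ U))).length) ↔ (a ∈ U ↔ b ∈ U) := by
  induction l generalizing a with
  | nil => cases h; simp
  | cons e l ih =>
    obtain ⟨c, h1, h2⟩ := h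
    have := ih h2
    have hc : e ∈ G.cut Set.univ U ↔ ¬ (a ∈ U ↔ c ∈ U) := by
      rw [h1.mem_cut]; simp; tauto
    by_cases he : e ∈ G.cut Set.univ U
    · rw [List.filter_cons_of_pos (by simpa using he), List.length_cons, Nat.even_add_one, this]
      have := hc.1 he
      tauto
    · rw [List.filter_cons_of_neg (by simpa using he), this]
      have := not_not.1 (mt hc.2 he)
      tauto

theorem Wlk.cross_even {a b : V} {l : List E} (h : G.Wlk a l b) (hl : l.Nodup) {U : Set V}
    (ha : a ∉ U) (hb : b ∉ U) : Even ({e | e ∈ l ∧ e ∈ G.cut Set.univ U}.ncard) := by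
  classical
  have := (h.cross U).2 (by tauto)
  have h2 : {e | e ∈ l ∧ e ∈ G.cut Set.univ U} =
      ((l.filter (fun e => decide (e ∈ G.cut Set.univ U))).toFinset : Set E) := by
    ext e; simp
  rw [h2, Set.ncard_coe_finset, List.toFinset_card_of_nodup (hl.filter _)]
  convert this

end Gr
end LC

namespace LC
namespace Gr
variable {V : Type u} {E : Type v} {G : Gr V E} {S S' S1 P P' : Set E} {X X0 Y A : Set V}

/-- `W` covers the cut edges `Φ` from `A` inside `X` -/
structure Cov (G : Gr V E) (S : Set E) (A X : Set V) (Φ : Set E) (W : E → List E) : Prop where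
  sub : Φ ⊆ G.cut S X
  st : ∀ f ∈ Φ, ∃ a ∈ A, ∃ x ∈ X, ∃ y, y ∉ X ∧ G.Jn f x y ∧ G.Wlk a (W f) x
  nd : ∀ f ∈ Φ, (W f).Nodup
  ins : ∀ f ∈ Φ, ∀ e ∈ W f, e ∈ G.ins S X
  dj : ∀ f ∈ Φ, ∀ g ∈ Φ, ∀ e ∈ W f, e ∈ W g → f = g

/-- trimmed covers -/
def Tr (G : Gr V E) (S : Set E) (A : Set V) (Φ : Set E) (W : E → List E) : Prop :=
  ∀ f ∈ Φ, (W f = [] ∧ f ∈ G.cut S A) ∨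
    (∃ e l, W f = e :: l ∧ e ∈ G.cut S A ∧ (∀ e' ∈ l, G.Av A e') ∧ G.Av A f)

theorem Cov.mono {Φ Ψ : Set E} {W : E → List E} (h : G.Cov S A X Φ W) (hs : Ψ ⊆ Φ) :
    G.Cov S A X Ψ W where
  sub := hs.trans h.sub
  st f hf := h.st f (hs hf)
  nd f hf := h.nd f (hs hf)
  ins f hf := h.ins f (hs hf)
  dj f hf g hg := h.dj f (hs hf) g (hs hg)

theorem Cov.congr {Φ : Set E} {W W' : E → List E} (h : G.Cov S A X Φ W)
    (hs : ∀ f ∈ Φ, W' f = W f) : G.Cov S A X Φ W' where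
  sub := h.sub
  st f hf := by rw [hs f hf]; exact h.st f hf
  nd f hf := by rw [hs f hf]; exact h.nd f hf
  ins f hf := by rw [hs f hf]; exact h.ins f hf
  dj f hf g hg := by rw [hs f hf, hs g hg]; exact h.dj f hf g hg

theorem Cov.not_mem {Φ : Set E} {W : E → List E} (h : G.Cov S A X Φ W) {f g : E} (hf : f ∈ Φ)
    (hg : g ∈ G.cut S' X) : g ∉ W f := fun h' => ins_not_cut (h.ins f hf g h') hg

theorem Cov.trim {Φ : Set E} {W : E → List E} (h : G.Cov S A X Φ W) (hA : A ⊆ X) :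
    ∃ W', G.Cov S A X Φ W' ∧ G.Tr S A Φ W' ∧ ∀ f ∈ Φ, W' f <:+ W f := by
  classical
  have key : ∀ f : Φ, ∃ l, l <:+ W f.1 ∧ ∃ a ∈ A, ∃ x ∈ X, ∃ y, y ∉ X ∧ G.Jn f.1 x y ∧
      G.Wlk a l x ∧ G.Clean A a l := by
    rintro ⟨f, hf⟩
    obtain ⟨a, ha, x, hx, y, hy, hj, hw⟩ := h.st f hf
    obtain ⟨l1, l2, w, h1, h2, h3, h4, h5⟩ := last_vis hw (vis_start ha)
    exact ⟨l2, ⟨l1, h1.symm⟩, w, h3, x, hx, y, hy, hj, h4, h5⟩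
  choose L hL1 hL2 using key
  let W' : E → List E := fun f => if hf : f ∈ Φ then L ⟨f, hf⟩ else []
  have hW' : ∀ f (hf : f ∈ Φ), W' f = L ⟨f, hf⟩ := fun f hf => dif_pos hf
  refine ⟨W', ⟨h.sub, ?_, ?_, ?_, ?_⟩, ?_, ?_⟩
  · intro f hf
    obtain ⟨a, ha, x, hx, y, hy, hj, hw, _⟩ := hL2 ⟨f, hf⟩
    exact ⟨a, ha, x, hx, y, hy, hj, by rw [hW' f hf]; exact hw⟩
  · intro f hf; rw [hW' f hf]; exact (h.nd f hf).sublist (hL1 ⟨f, hf⟩).sublist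
  · intro f hf e he; rw [hW' f hf] at he; exact h.ins f hf e ((hL1 ⟨f, hf⟩).subset he)
  · intro f hf g hg e he he'
    rw [hW' f hf] at he; rw [hW' g hg] at he'
    exact h.dj f hf g hg e ((hL1 ⟨f, hf⟩).subset he) ((hL1 ⟨g, hg⟩).subset he')
  · intro f hf
    obtain ⟨a, ha, x, hx, y, hy, hj, hw, hc⟩ := hL2 ⟨f, hf⟩
    rw [hW' f hf]
    have hsub := (hL1 ⟨f, hf⟩).subset
    cases hl : L ⟨f, hf⟩ with
    | nil =>
      left
      rw [hl] at hw
      cases hw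
      exact ⟨rfl, hj.mem_cut.2 ⟨(h.sub hf).1, Or.inl ⟨ha, fun h => hy (hA h)⟩⟩⟩
    | cons e l =>
      right
      obtain ⟨⟨c, hjc, hc1⟩, hc2⟩ := hc e l hl
      refine ⟨e, l, rfl, ?_, hc2, ?_⟩
      · exact hjc.mem_cut.2 ⟨(h.ins f hf e (hsub (by simp [hl]))).1, Or.inl ⟨ha, hc1⟩⟩
      · refine hj.av.2 ⟨?_, fun h => hy (hA h)⟩
        rw [hl] at hw
        obtain ⟨c', hjc', hw⟩ := hw
        obtain rfl := hjc.det hjc'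
        rcases List.eq_nil_or_concat l with rfl | ⟨l', e', rfl⟩
        · cases hw; exact hc1
        · rw [List.concat_eq_append] at hw hc2
          obtain ⟨b, _, hb⟩ := hw.split
          obtain ⟨b', hb', rfl⟩ := hb
          exact (hb'.av.1 (hc2 e' (by simp))).2
  · intro f hf; rw [hW' f hf]; exact hL1 ⟨f, hf⟩

theorem Cov.comp {Φ0 Φ : Set E} {W0 W1 : E → List E} (h0 : G.Cov S A X0 Φ0 W0)
    (h1 : G.Cov S1 X0 X Φ W1) (hS : S1 ⊆ S) (hX : X0 ⊆ X) (hΦ : G.cut S1 X0 ⊆ Φ0) :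
    ∃ W, G.Cov S A X Φ W ∧ (∀ f ∈ Φ, f ∈ G.cut S1 X0 → W f = W0 f) ∧
      ∀ f ∈ Φ, f ∉ G.cut S1 X0 → ∃ f' ∈ G.cut S1 X0, ∃ l0 l, W1 f = l0 ++ f' :: l ∧
        W f = W0 f' ++ f' :: l ∧ (∀ e ∈ l, G.Av X0 e) ∧ G.Av X0 f := by
  classical
  have key : ∀ f ∈ Φ, f ∉ G.cut S1 X0 → ∃ f' ∈ G.cut S1 X0, ∃ l0 l, W1 f = l0 ++ f' :: l ∧
      (∀ e ∈ l, G.Av X0 e) ∧ G.Av X0 f ∧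
      (∃ a ∈ A, ∃ x ∈ X, ∃ y, y ∉ X ∧ G.Jn f x y ∧ G.Wlk a (W0 f' ++ f' :: l) x) := by
    intro f hf hfn
    obtain ⟨a, ha, x, hx, y, hy, hj, hw⟩ := h1.st f hf
    have hx0 : x ∉ X0 := fun h => hfn (hj.mem_cut.2 ⟨(h1.sub hf).1, Or.inl ⟨h, fun h => hy (hX h)⟩⟩)
    obtain ⟨l1, f', l2, x', y', e1, e2, e3, e4, e5, e6, e7⟩ := last_exit hw (vis_start ha) hx0
    have hf' : f' ∈ G.cut S1 X0 :=
      e4.mem_cut.2 ⟨(h1.ins f hf f' (by simp [e1])).1, Or.inl ⟨e3, e5⟩⟩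
    obtain ⟨a', ha', x'', hx'', y'', hy'', hj'', hw''⟩ := h0.st f' (hΦ hf')
    have : x'' = x' ∧ y'' = y' := by
      rcases e4.pair hj'' with h | h
      · exact h
      · exact (e5 (h.1 ▸ hx'')).elim
    obtain ⟨rfl, rfl⟩ := this
    exact ⟨f', hf', l1, l2, e1, e7, hj.av.2 ⟨hx0, fun h => hy (hX h)⟩, a', ha', x, hx, y, hy, hj,
      hw''.append ⟨y'', e4, e6⟩⟩
  choose! F hF L0 L hL1 hL2 hL3 hL4 using key
  let W : E → List E := fun f => if f ∈ G.cut S1 X0 then W0 f else W0 (F f) ++ F f :: L f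
  have hWp : ∀ f, f ∈ G.cut S1 X0 → W f = W0 f := fun f hf => if_pos hf
  have hWn : ∀ f, f ∉ G.cut S1 X0 → W f = W0 (F f) ++ F f :: L f := fun f hf => if_neg hf
  -- edge classification
  have cls : ∀ f ∈ Φ, ∃ g ∈ G.cut S1 X0, (g = f ∨ g ∈ W1 f) ∧ ∀ e ∈ W f, e ∈ W0 g ∨
      ((e = g ∨ G.Av X0 e) ∧ e ∈ W1 f) := by
    intro f hf
    by_cases hc : f ∈ G.cut S1 X0
    · exact ⟨f, hc, Or.inl rfl, by intro e he; rw [hWp f hc] at he; exact Or.inl he⟩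
    · refine ⟨F f, hF f hf hc, Or.inr (by rw [hL1 f hf hc]; simp), ?_⟩
      intro e he
      rw [hWn f hc, List.mem_append, List.mem_cons] at he
      rcases he with he | he | he
      · exact Or.inl he
      · exact Or.inr ⟨Or.inl he, by rw [hL1 f hf hc, he]; simp⟩
      · exact Or.inr ⟨Or.inr (hL2 f hf hc e he), by rw [hL1 f hf hc]; simp [he]⟩
  refine ⟨W, ⟨fun f hf => cut_mono hS (h1.sub hf), ?_, ?_, ?_, ?_⟩, fun f _ hf => hWp f hf, ?_⟩
  · intro f hf
    by_cases hc : f ∈ G.cut S1 X0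
    · rw [hWp f hc]
      obtain ⟨a, ha, x, hx, y, hy, hj, hw⟩ := h0.st f (hΦ hc)
      refine ⟨a, ha, x, hX hx, y, fun hyX => ?_, hj, hw⟩
      have := (hj.mem_cut.1 (h1.sub hf)).2
      have := hX hx
      tauto
    · rw [hWn f hc]; exact hL4 f hf hc
  · intro f hf
    by_cases hc : f ∈ G.cut S1 X0
    · rw [hWp f hc]; exact h0.nd f (hΦ hc)
    · rw [hWn f hc, List.nodup_append]
      have hn := h1.nd f hf
      rw [hL1 f hf hc, List.nodup_append] at hn
      refine ⟨h0.nd _ (hΦ (hF f hf hc)), hn.2.1, ?_⟩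
      intro a ha b hb hab
      subst hab
      have := h0.ins _ (hΦ (hF f hf hc)) a ha
      rcases List.mem_cons.1 hb with rfl | hb
      · exact ins_not_cut this (hF f hf hc)
      · exact (hL2 f hf hc a hb).not_ins this
  · intro f hf e he
    obtain ⟨g, hg, _, h⟩ := cls f hf
    rcases h e he with h | h
    · exact ins_mono subset_rfl hX (h0.ins g (hΦ hg) e h)
    · exact ins_mono hS subset_rfl (h1.ins f hf e h.2)
  · intro f hf g hg e he he'
    obtain ⟨f', hf', hff, h⟩ := cls f hf
    obtain ⟨g', hg', hgg, h'⟩ := cls g hg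
    have same : f' = g' → f = g := by
      rintro rfl
      rcases hff with rfl | hff <;> rcases hgg with hgg | hgg
      · exact hgg
      · exact (h1.not_mem hg (h1.sub hf) hgg).elim
      · subst hgg; exact (h1.not_mem hf (h1.sub hg) hff).elim
      · exact h1.dj f hf g hg _ hff hgg
    rcases h e he with h | ⟨h, h2⟩ <;> rcases h' e he' with h' | ⟨h', h2'⟩
    · exact same (h0.dj f' (hΦ hf') g' (hΦ hg') e h h')
    · have := h0.ins _ (hΦ hf') e h
      rcases h' with rfl | h'
      · exact (ins_not_cut this hg').elim
      · exact (h'.not_ins this).elim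
    · have := h0.ins _ (hΦ hg') e h'
      rcases h with rfl | h
      · exact (ins_not_cut this hf').elim
      · exact (h.not_ins this).elim
    · exact h1.dj f hf g hg e h2 h2'
  · intro f hf hc
    exact ⟨F f, hF f hf hc, L0 f, L f, hL1 f hf hc, hWn f hc, hL2 f hf hc, hL3 f hf hc⟩

/-- trivial covers -/
theorem Cov.triv (G : Gr V E) (S : Set E) (A : Set V) : G.Cov S A A (G.cut S A) (fun _ => []) where
  sub := subset_rfl
  st f hf := by
    obtain ⟨_, x, hx, y, hy, hj⟩ := mem_cut_iff.1 hf
    exact ⟨x, hx, x, hx, y, hy, hj, rfl⟩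
  nd := by simp
  ins := by simp
  dj := by simp

theorem cut_between {f : E} {Z : Set V} (h1 : f ∈ G.cut S X) (h2 : f ∈ G.cut S Z)
    (hXY : X ⊆ Y) (hYZ : Y ⊆ Z) : f ∈ G.cut S Y := by
  obtain ⟨hS, x, hx, y, hy, hj⟩ := mem_cut_iff.1 h1
  refine hj.mem_cut.2 ⟨hS, Or.inl ⟨hXY hx, fun h => ?_⟩⟩
  have := (hj.mem_cut.1 h2).2
  have := hYZ h
  have := hYZ (hXY hx)
  tauto

theorem zorn_waves {ι : Type*} (G : Gr V E) (S : Set E) (A : ι → Set V) (Fb : Set V)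
    (hd : ∀ i j, i ≠ j → Disjoint (A i) (A j)) (hF : ∀ i, Disjoint (A i) Fb) :
    ∃ (X : ι → Set V) (W : ι → E → List E), (∀ i, A i ⊆ X i) ∧
      (∀ i j, i ≠ j → Disjoint (X i) (X j)) ∧ (∀ i, Disjoint (X i) Fb) ∧
      (∀ i, G.Cov S (A i) (X i) (G.cut S (X i)) (W i)) ∧
      ∀ i Z Wz, X i ⊆ Z → Disjoint Z Fb → (∀ j, j ≠ i → Disjoint Z (X j)) →
        G.Cov S (X i) Z (G.cut S Z) Wz → Z = X i := by
  classical
  let St := {p : (ι → Set V) × (ι → E → List E) // (∀ i, A i ⊆ p.1 i) ∧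
      (∀ i j, i ≠ j → Disjoint (p.1 i) (p.1 j)) ∧ (∀ i, Disjoint (p.1 i) Fb) ∧
      (∀ i, G.Cov S (A i) (p.1 i) (G.cut S (p.1 i)) (p.2 i))}
  let r : St → St → Prop := fun p q => ∀ i, p.1.1 i ⊆ q.1.1 i ∧
    ∀ f ∈ G.cut S (p.1.1 i), f ∈ G.cut S (q.1.1 i) → p.1.2 i f = q.1.2 i f
  have hrefl : ∀ p, r p p := fun p i => ⟨subset_rfl, fun _ _ _ => rfl⟩
  have htrans : ∀ {p q s}, r p q → r q s → r p s := by
    intro p q s h1 h2 i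
    refine ⟨(h1 i).1.trans (h2 i).1, fun f hf hf' => ?_⟩
    have := cut_between hf hf' (h1 i).1 (h2 i).1
    rw [(h1 i).2 f hf this, (h2 i).2 f this hf']
  have p0 : St := ⟨(A, fun _ _ => []), fun i => subset_rfl, hd, hF, fun i => Cov.triv G S (A i)⟩
  have hch : ∀ c : Set St, IsChain r c → ∃ ub, ∀ a ∈ c, r a ub := by
    intro c hc
    rcases c.eq_empty_or_nonempty with rfl | ⟨p1, hp1⟩
    · exact ⟨p0, by simp⟩
    have tot : ∀ p ∈ c, ∀ q ∈ c, r p q ∨ r q p := by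
      intro p hp q hq
      by_cases h : p = q
      · subst h; exact Or.inl (hrefl p)
      · exact hc hp hq h
    let Xu : ι → Set V := fun i => {x | ∃ p ∈ c, x ∈ p.1.1 i}
    have hXu : ∀ p ∈ c, ∀ i, p.1.1 i ⊆ Xu i := fun p hp i x hx => ⟨p, hp, hx⟩
    have hdown : ∀ i, ∀ f ∈ G.cut S (Xu i), ∃ p ∈ c, f ∈ G.cut S (p.1.1 i) := by
      intro i f hf
      obtain ⟨hS, x, ⟨p, hp, hx⟩, y, hy, hj⟩ := mem_cut_iff.1 hf
      exact ⟨p, hp, hj.mem_cut.2 ⟨hS, Or.inl ⟨hx, fun h => hy ⟨p, hp, h⟩⟩⟩⟩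
    have hdn2 : ∀ i, ∀ f ∈ G.cut S (Xu i), ∀ p ∈ c, ∀ q ∈ c, r p q → f ∈ G.cut S (p.1.1 i) →
        f ∈ G.cut S (q.1.1 i) := fun i f hf p hp q hq hpq hfp =>
      cut_between hfp hf (hpq i).1 (hXu q hq i)
    haveI : Nonempty St := ⟨p1⟩
    choose! pf hpf1 hpf2 using hdown
    let Wu : ι → E → List E := fun i f => (pf i f).1.2 i f
    have hWu : ∀ i, ∀ f ∈ G.cut S (Xu i), ∀ p ∈ c, f ∈ G.cut S (p.1.1 i) → p.1.2 i f = Wu i f := by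
      intro i f hf p hp hfp
      rcases tot p hp _ (hpf1 i f hf) with h | h
      · exact (h i).2 f hfp (hpf2 i f hf)
      · exact ((h i).2 f (hpf2 i f hf) hfp).symm
    have hcov : ∀ i, G.Cov S (A i) (Xu i) (G.cut S (Xu i)) (Wu i) := by
      intro i
      refine ⟨subset_rfl, ?_, ?_, ?_, ?_⟩
      · intro f hf
        obtain ⟨a, ha, x, hx, y, hy, hj, hw⟩ :=
          ((pf i f).2.2.2.2 i).st f (hpf2 i f hf)
        refine ⟨a, ha, x, hXu _ (hpf1 i f hf) i hx, y, fun h => ?_, hj, hw⟩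
        have := (hj.mem_cut.1 hf).2
        have := hXu _ (hpf1 i f hf) i hx
        tauto
      · intro f hf
        exact ((pf i f).2.2.2.2 i).nd f (hpf2 i f hf)
      · intro f hf e he
        exact ins_mono subset_rfl (hXu _ (hpf1 i f hf) i)
          (((pf i f).2.2.2.2 i).ins f (hpf2 i f hf) e he)
      · intro f hf g hg e he he'
        rcases tot _ (hpf1 i f hf) _ (hpf1 i g hg) with h | h
        · have hf2 := hdn2 i f hf _ (hpf1 i f hf) _ (hpf1 i g hg) h (hpf2 i f hf)
          refine ((pf i g).2.2.2.2 i).dj f hf2 g (hpf2 i g hg) e ?_ he'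
          rw [hWu i f hf _ (hpf1 i g hg) hf2]; exact he
        · have hg2 := hdn2 i g hg _ (hpf1 i g hg) _ (hpf1 i f hf) h (hpf2 i g hg)
          refine ((pf i f).2.2.2.2 i).dj f (hpf2 i f hf) g hg2 e he ?_
          rw [hWu i g hg _ (hpf1 i f hf) hg2]; exact he'
    refine ⟨⟨(Xu, Wu), fun i => (p1.2.1 i).trans (hXu p1 hp1 i), ?_, ?_, hcov⟩, ?_⟩
    · intro i j hij
      rw [Set.disjoint_left]
      rintro x ⟨p, hp, hx⟩ ⟨q, hq, hx'⟩
      rcases tot p hp q hq with h | h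
      · exact Set.disjoint_left.1 (q.2.2.1 i j hij) ((h i).1 hx) hx'
      · exact Set.disjoint_left.1 (p.2.2.1 i j hij) hx ((h j).1 hx')
    · intro i
      rw [Set.disjoint_left]
      rintro x ⟨p, hp, hx⟩ hx'
      exact Set.disjoint_left.1 (p.2.2.2.1 i) hx hx'
    · intro p hp i
      exact ⟨hXu p hp i, fun f hf hf' => hWu i f hf' p hp hf⟩
  obtain ⟨m, hm⟩ := exists_maximal_of_chains_bounded hch (fun {a b c} => htrans)
  refine ⟨m.1.1, m.1.2, m.2.1, m.2.2.1, m.2.2.2.1, m.2.2.2.2, ?_⟩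
  intro i Z Wz hZ hZF hZd hcov
  obtain ⟨W', hW', hW'1, _⟩ := (m.2.2.2.2 i).comp hcov subset_rfl hZ subset_rfl
  let q : St := ⟨(Function.update m.1.1 i Z, Function.update m.1.2 i W'), by
    refine ⟨?_, ?_, ?_, ?_⟩
    · intro j
      by_cases h : j = i
      · subst h; simpa using (m.2.1 j).trans hZ
      · simpa [h] using m.2.1 j
    · intro j k hjk
      by_cases h : j = i
      · subst h; simpa [hjk.symm] using hZd k hjk.symm
      · by_cases h' : k = i
        · subst h'; simpa [hjk] using (hZd j hjk).symm
        · simpa [h, h'] using m.2.2.1 j k hjk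
    · intro j
      by_cases h : j = i
      · subst h; simpa using hZF
      · simpa [h] using m.2.2.2.1 j
    · intro j
      by_cases h : j = i
      · subst h; simpa using hW'
      · simpa [h] using m.2.2.2.2 j⟩
  have hmq : r m q := by
    intro j
    by_cases h : j = i
    · subst h
      simp only [q, Function.update_self]
      exact ⟨hZ, fun f hf hf' => (hW'1 f hf' hf).symm⟩
    · simp only [q, Function.update_of_ne h]
      exact ⟨subset_rfl, fun _ _ _ => trivial⟩
  have := (hm q hmq i).1
  simp only [q, Function.update_self] at this
  exact Set.Subset.antisymm this hZ

/-- no odd finite cut avoiding `T` -/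
def Par (G : Gr V E) (S : Set E) (T : Set V) : Prop :=
  ∀ U : Set V, Disjoint U T → ¬ ((G.cut S U).Finite ∧ Odd (G.cut S U).ncard)

end Gr
end LC

namespace LC
namespace Gr
variable {V : Type u} {E : Type v} {G : Gr V E} {S S' S1 P P' : Set E} {X X0 Y A : Set V}

open Classical in
/-- the end of a cut edge inside `X` -/
noncomputable def inn (G : Gr V E) (X : Set V) (m : E) : V := if G.s m ∈ X then G.s m else G.t m

theorem inn_eq {m : E} {x y : V} (hj : G.Jn m x y) (hx : x ∈ X) (hy : y ∉ X) : G.inn X m = x := by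
  unfold inn
  rcases hj with ⟨h1, h2⟩ | ⟨h1, h2⟩
  · rw [if_pos (h1 ▸ hx), h1]
  · rw [if_neg (h1 ▸ hy), h2]

theorem inn_spec {m : E} (hm : m ∈ G.cut S X) :
    G.inn X m ∈ X ∧ ∃ y, y ∉ X ∧ G.Jn m (G.inn X m) y := by
  obtain ⟨_, x, hx, y, hy, hj⟩ := mem_cut_iff.1 hm
  rw [inn_eq hj hx hy]
  exact ⟨hx, y, hy, hj⟩

theorem Cov.st' {Φ : Set E} {W : E → List E} (h : G.Cov S A X Φ W) {f : E} (hf : f ∈ Φ) :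
    ∃ a ∈ A, G.Wlk a (W f) (G.inn X f) := by
  obtain ⟨a, ha, x, hx, y, hy, hj, hw⟩ := h.st f hf
  exact ⟨a, ha, by rw [inn_eq hj hx hy]; exact hw⟩

/-- unused edges -/
def Un (G : Gr V E) (S : Set E) (X : Set V) (Φ : Set E) (W : E → List E) : Set E :=
  {e | e ∈ G.ins S X ∧ ∀ f ∈ Φ, e ∉ W f}

open Classical in
theorem Cov.add {Φ : Set E} {W : E → List E} (h : G.Cov S A X Φ W) {m : E}
    (hm : m ∈ G.cut S X) {l : List E} {a : V} (ha : a ∈ A)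
    (hw : G.Wlk a l (G.inn X m)) (hl : l.Nodup) (hi : ∀ e ∈ l, e ∈ G.ins S X)
    (hd : ∀ e ∈ l, ∀ f ∈ Φ, f ≠ m → e ∉ W f) :
    G.Cov S A X (insert m Φ) (Function.update W m l) := by
  have hu : ∀ f, f ≠ m → Function.update W m l f = W f := fun f hf => Function.update_of_ne hf _ _
  have hs : Function.update W m l m = l := Function.update_self _ _ _
  refine ⟨Set.insert_subset hm h.sub, ?_, ?_, ?_, ?_⟩
  · intro f hf
    by_cases hfm : f = m
    · subst hfm
      rw [hs]
      obtain ⟨h1, y, hy, hj⟩ := inn_spec hm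
      exact ⟨a, ha, _, h1, y, hy, hj, hw⟩
    · rw [hu f hfm]; exact h.st f (hf.resolve_left hfm)
  · intro f hf
    by_cases hfm : f = m
    · subst hfm; rw [hs]; exact hl
    · rw [hu f hfm]; exact h.nd f (hf.resolve_left hfm)
  · intro f hf
    by_cases hfm : f = m
    · subst hfm; rw [hs]; exact hi
    · rw [hu f hfm]; exact h.ins f (hf.resolve_left hfm)
  · intro f hf g hg e he he'
    by_cases hfm : f = m
    · subst hfm
      rw [hs] at he
      by_contra hgm
      rw [hu g (fun h => hgm h.symm)] at he'
      exact hd e he g (hg.resolve_left (fun h => hgm h.symm)) (fun h => hgm h.symm) he'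
    · rw [hu f hfm] at he
      by_cases hgm : g = m
      · subst hgm
        rw [hs] at he'
        exact (hd e he' f (hf.resolve_left hfm) hfm he).elim
      · rw [hu g hgm] at he'
        exact h.dj f (hf.resolve_left hfm) g (hg.resolve_left hgm) e he he'

theorem even_biUnion {α β : Type*} {I : Set α} (hI : I.Finite) (c : α → Set β)
    (hc : ∀ i ∈ I, (c i).Finite ∧ Even (c i).ncard)
    (hd : ∀ i ∈ I, ∀ j ∈ I, ∀ b, b ∈ c i → b ∈ c j → i = j) :
    (⋃ i ∈ I, c i).Finite ∧ Even (⋃ i ∈ I, c i).ncard := by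
  induction I, hI using Set.Finite.induction_on with
  | empty => simp
  | @insert a s ha hs ih =>
    have h1 := ih (fun i hi => hc i (Or.inr hi)) (fun i hi j hj => hd i (Or.inr hi) j (Or.inr hj))
    have h2 := hc a (Or.inl rfl)
    rw [Set.biUnion_insert]
    refine ⟨h2.1.union h1.1, ?_⟩
    rw [Set.ncard_union_eq _ h2.1 h1.1]
    · exact h2.2.add h1.2
    · rw [Set.disjoint_left]
      intro b hb hb'
      simp only [Set.mem_iUnion] at hb'
      obtain ⟨i, hi, hb'⟩ := hb'
      exact ha (hd a (Or.inl rfl) i (Or.inr hi) b hb hb' ▸ hi)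

/-- the component of a mark sees infinitely many strands -/
theorem inf_strands {M : Set E} {W : E → List E} (hM : M ⊆ G.cut S X)
    (hP : G.Par S (A ∪ Xᶜ)) (h : G.Cov S A X (G.cut S X \ M) W)
    {m : E} (hm : m ∈ M)
    (hsep : ∀ m' ∈ M, m' ≠ m → ¬ G.Reach (G.Un S X (G.cut S X \ M) W) (G.inn X m) (G.inn X m'))
    (hA : ∀ a ∈ A, ¬ G.Reach (G.Un S X (G.cut S X \ M) W) (G.inn X m) a) :
    {f | f ∈ G.cut S X \ M ∧
      G.Vis {y | G.Reach (G.Un S X (G.cut S X \ M) W) (G.inn X m) y}ᶜᶜ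
        (G.inn X f) (W f).reverse}.Infinite := by
  classical
  intro hfin
  set Ω := G.Un S X (G.cut S X \ M) W with hΩ
  set U := {y | G.Reach Ω (G.inn X m) y} with hU
  have hUX : U ⊆ X := by
    intro y hy
    refine Reach.mem_of_closed hy (inn_spec (hM hm)).1 ?_
    intro e he he'
    exact ins_not_cut he.1 he'
  have hcl : ∀ e ∈ Ω, e ∉ G.cut Ω U := by
    intro e he he'
    obtain ⟨_, x, hx, y, hy, hj⟩ := mem_cut_iff.1 he'
    exact hy (Reach.trans hx (Reach.single hj he))
  have hmU : G.inn X m ∈ U := Reach.refl _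
  -- strands
  let I := {f | f ∈ G.cut S X \ M ∧ G.Vis Uᶜᶜ (G.inn X f) (W f).reverse}
  let c : E → Set E := fun f => {e | e ∈ W f ++ [f] ∧ e ∈ G.cut Set.univ U}
  have hb := even_biUnion (I := I) hfin c (by
    intro f hf
    refine ⟨(List.finite_toSet (W f ++ [f])).subset (fun e he => he.1), ?_⟩
    obtain ⟨a, ha, hw⟩ := h.st' hf.1
    obtain ⟨hx, y, hy, hj⟩ := inn_spec hf.1.1
    refine Wlk.cross_even (hw.append (Wlk.single hj)) ?_ ?_ ?_
    · rw [List.nodup_append]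
      refine ⟨h.nd f hf.1, by simp, ?_⟩
      intro e he e' he' hee
      obtain rfl : e' = f := by simpa using he'
      subst hee
      exact h.not_mem hf.1 hf.1.1 he
    · intro h'; exact hA a ha h'
    · intro h'; exact hy (hUX h')) (by
    intro f hf g hg e he he'
    rcases List.mem_append.1 he.1 with he1 | he1 <;> rcases List.mem_append.1 he'.1 with he2 | he2
    · exact h.dj f hf.1 g hg.1 e he1 he2
    · obtain rfl : e = g := by simpa using he2
      exact (h.not_mem hf.1 hg.1.1 he1).elim
    · obtain rfl : e = f := by simpa using he1
      exact (h.not_mem hg.1 hf.1.1 he2).elim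
    · obtain rfl : e = f := by simpa using he1
      simpa using he2)
  have hcut : G.cut S U = insert m (⋃ i ∈ I, c i) := by
    ext e
    constructor
    · intro he
      obtain ⟨heS, x, hx, y, hy, hj⟩ := mem_cut_iff.1 he
      by_cases heM : e ∈ M
      · left
        by_contra hne
        obtain ⟨hix, z, hz, hjz⟩ := inn_spec (hM heM)
        have : G.inn X e ∈ U := by
          rcases hj.pair hjz with h | h
          · rw [h.1]; exact hx
          · exact (hz (h.2 ▸ hUX hx)).elim
        exact hsep e heM hne this
      right
      simp only [Set.mem_iUnion]
      by_cases hyX : y ∈ X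
      · have hein : e ∈ G.ins S X := hj.mem_ins.2 ⟨heS, hUX hx, hyX⟩
        by_cases hu : e ∈ Ω
        · exact (hcl e hu ⟨hu, he.2⟩).elim
        · have : ∃ f ∈ G.cut S X \ M, e ∈ W f := by
            by_contra hno
            push Not at hno
            exact hu ⟨hein, hno⟩
          obtain ⟨f, hf, hef⟩ := this
          refine ⟨f, ⟨hf, ?_⟩, List.mem_append_left _ hef, trivial, he.2⟩
          obtain ⟨a, ha, hw⟩ := h.st' hf
          refine vis_of_mem hw.reverse (by simpa using hef) ?_
          rw [hj.av, compl_compl]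
          tauto
      · have hec : e ∈ G.cut S X := hj.mem_cut.2 ⟨heS, Or.inl ⟨hUX hx, hyX⟩⟩
        refine ⟨e, ⟨⟨hec, heM⟩, ?_⟩, by simp, trivial, he.2⟩
        apply vis_start
        rw [inn_eq hj (hUX hx) hyX, compl_compl]; exact hx
    · rintro (rfl | he)
      · obtain ⟨hix, z, hz, hjz⟩ := inn_spec (hM hm)
        exact hjz.mem_cut.2 ⟨(hM hm).1, Or.inl ⟨hmU, fun h => hz (hUX h)⟩⟩
      · simp only [Set.mem_iUnion] at he
        obtain ⟨f, hf, he, he'⟩ := he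
        refine ⟨?_, he'.2⟩
        rcases List.mem_append.1 he with he1 | he1
        · exact (h.ins f hf.1 e he1).1
        · obtain rfl : e = f := by simpa using he1
          exact hf.1.1.1
  have hmn : m ∉ ⋃ i ∈ I, c i := by
    simp only [Set.mem_iUnion]
    rintro ⟨f, hf, he, he'⟩
    rcases List.mem_append.1 he with he1 | he1
    · exact h.not_mem hf.1 (hM hm) he1
    · obtain rfl : m = f := by simpa using he1
      exact hf.1.2 hm
  refine hP U ?_ ⟨?_, ?_⟩
  · rw [Set.disjoint_left]
    rintro x hx (hxA | hxX)
    · exact hA x hxA hx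
    · exact hxX (hUX hx)
  · rw [hcut]; exact hb.1.insert m
  · rw [hcut, Set.ncard_insert_of_notMem hmn hb.1]
    exact hb.2.add_one

/-- one step of the process -/
theorem proc_step {M H : Set E} {W : E → List E} (hM : M ⊆ G.cut S X) (hMne : M.Nonempty)
    (hH : H.Finite) (hP : G.Par S (A ∪ Xᶜ)) (h : G.Cov S A X (G.cut S X \ M) W)
    (hsep : ∀ m ∈ M, ∀ m' ∈ M, m' ≠ m →
      ¬ G.Reach (G.Un S X (G.cut S X \ M) W) (G.inn X m) (G.inn X m'))
    (hA : ∀ m ∈ M, ∀ a ∈ A, ¬ G.Reach (G.Un S X (G.cut S X \ M) W) (G.inn X m) a) :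
    ∃ m ∈ M, ∃ f ∈ G.cut S X, f ∉ M ∧ f ∉ H ∧ ∃ W' : E → List E, (∀ g, g ≠ m → W' g = W g) ∧
      G.Cov S A X (G.cut S X \ (insert f (M \ {m}))) W' ∧
      ∀ m₁ ∈ insert f (M \ {m}), ∀ m' ∈ insert f (M \ {m}), m' ≠ m₁ →
      ¬ G.Reach (G.Un S X (G.cut S X \ (insert f (M \ {m}))) W') (G.inn X m₁) (G.inn X m') := by
  classical
  set Ω := G.Un S X (G.cut S X \ M) W with hΩ
  obtain ⟨m0, hm0⟩ := hMne
  have hinf := inf_strands hM hP h hm0 (hsep m0 hm0) (hA m0 hm0)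
  rw [← hΩ] at hinf
  obtain ⟨f, ⟨hf, hvis⟩, hfH⟩ := hinf.exists_notMem_finite hH
  rw [compl_compl] at hvis
  obtain ⟨a, ha, hw⟩ := h.st' hf
  let UU : Set V := {y | ∃ m ∈ M, G.Reach Ω (G.inn X m) y}
  have hvis2 : G.Vis UU a (W f) := by
    by_contra hn
    have hav := not_vis_av hw hn
    obtain ⟨l1, l2, w, h1, h2, h3⟩ := hvis
    have hwU : w ∈ UU := ⟨m0, hm0, h3⟩
    have h4 : W f = l2.reverse ++ l1.reverse := by
      rw [← List.reverse_append, ← h1, List.reverse_reverse]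
    rw [h4] at hw
    obtain ⟨b, hb1, hb2⟩ := hw.split
    obtain rfl : b = w := by
      have := hb2.reverse
      rw [List.reverse_reverse] at this
      exact this.det h2
    exact hn ⟨l2.reverse, l1.reverse, b, h4, hb1, hwU⟩
  obtain ⟨l1, l2, w, hl, hw1, ⟨m, hm, hmw⟩, hw2, hcl⟩ := last_vis hw hvis2
  obtain ⟨tr, ht1, ht2, ht3⟩ := hmw.symm.trail
  have hmf : m ≠ f := fun h' => hf.2 (h' ▸ hm)
  have hnd := h.nd f hf
  rw [hl, List.nodup_append] at hnd
  have hins := h.ins f hf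
  have hset : G.cut S X \ (insert f (M \ {m})) = insert m ((G.cut S X \ M) \ {f}) := by
    ext e
    by_cases h1 : e = m
    · subst h1; simp [hmf, hM hm]
    · simp only [Set.mem_sdiff, Set.mem_insert_iff, Set.mem_singleton_iff, h1, not_false_eq_true,
        and_true, false_or]
      tauto
  refine ⟨m, hm, f, hf.1, hf.2, hfH, Function.update W m (l1 ++ tr),
    fun g hg => Function.update_of_ne hg _ _, ?_, ?_⟩
  · rw [hset]
    refine (h.mono Set.sdiff_subset).add (hM hm) ha (hw1.append ht1) ?_ ?_ ?_
    · rw [List.nodup_append]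
      refine ⟨hnd.1, ht2, ?_⟩
      rintro e he e' he' rfl
      exact (ht3 e he').2 f hf (by rw [hl]; simp [he])
    · intro e he
      rcases List.mem_append.1 he with he | he
      · exact hins e (by rw [hl]; simp [he])
      · exact (ht3 e he).1
    · intro e he g hg hgm heg
      rcases List.mem_append.1 he with he | he
      · exact hg.2 (h.dj f hf g hg.1 e (by rw [hl]; simp [he]) heg).symm
      · exact (ht3 e he).2 g hg.1 heg
  · -- separation
    rw [hset]
    set Ω' := G.Un S X (insert m ((G.cut S X \ M) \ {f})) (Function.update W m (l1 ++ tr)) with hΩ'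
    have hΩ'2 : ∀ e ∈ Ω', e ∈ Ω ∨ e ∈ l2 := by
      intro e he
      by_contra hn
      push Not at hn
      apply hn.1
      refine ⟨he.1, fun g hg heg => ?_⟩
      by_cases hgf : g = f
      · subst hgf
        rw [hl, List.mem_append] at heg
        rcases heg with heg | heg
        · exact he.2 m (Or.inl rfl) (by rw [Function.update_self]; simp [heg])
        · exact hn.2 heg
      · have hgm : g ≠ m := fun h' => hg.2 (h' ▸ hm)
        exact he.2 g (Or.inr ⟨hg, hgf⟩) (by rw [Function.update_of_ne hgm]; exact heg)
    have hstay : ∀ m' ∈ M, m' ≠ m → ∀ y, G.Reach Ω' (G.inn X m') y → G.Reach Ω (G.inn X m') y := by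
      intro m' hm' hne y hy
      refine Reach.mem_of_closed (X := {y | G.Reach Ω (G.inn X m') y}) hy (Reach.refl _) ?_
      intro e he hec
      obtain ⟨_, x, hx, z, hz, hj⟩ := mem_cut_iff.1 hec
      rcases hΩ'2 e he with he | he
      · exact hz (Reach.trans hx (Reach.single hj he))
      · have hxU : x ∈ UU := ⟨m', hm', hx⟩
        have hwx : ¬ x = w := by
          rintro rfl
          exact hsep m' hm' m hm hne.symm (Reach.trans hx hmw.symm)
        cases l2 with
        | nil => cases he
        | cons e0 l2 =>
          obtain ⟨⟨c, hc, hcU⟩, hc2⟩ := hcl e0 l2 rfl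
          rcases List.mem_cons.1 he with rfl | he
          · rcases hc.pair hj with h | h
            · exact hwx h.1
            · exact hcU (h.1 ▸ hxU)
          · exact (hj.av.1 (hc2 e he)).1 hxU
    have hfout : ∀ m' ∈ M, m' ≠ m → ¬ G.Reach Ω (G.inn X m') (G.inn X f) := by
      intro m' hm' hne hr
      cases l2 with
      | nil =>
        cases hw2
        exact hsep m' hm' m hm hne.symm (hr.trans hmw.symm)
      | cons e0 l2 =>
        have hfU : G.inn X f ∈ UU := ⟨m', hm', hr⟩
        obtain ⟨⟨c, hc, hcU⟩, hc2⟩ := hcl e0 l2 rfl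
        obtain ⟨c', hc', hw2⟩ := hw2
        obtain rfl := hc.det hc'
        rcases List.eq_nil_or_concat l2 with rfl | ⟨l', e', rfl⟩
        · cases hw2; exact hcU hfU
        · rw [List.concat_eq_append] at hw2 hc2
          obtain ⟨b, _, hb⟩ := hw2.split
          obtain ⟨b', hb', rfl⟩ := hb
          exact (hb'.av.1 (hc2 e' (by simp))).2 hfU
    rintro m₁ (rfl | ⟨hm1, hne1⟩) m' (rfl | ⟨hm', hne'⟩) hne hr
    · exact hne rfl
    · exact hfout m' hm' hne' (hstay m' hm' hne' _ hr.symm)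
    · exact hfout m₁ hm1 hne1 (hstay m₁ hm1 hne1 _ hr)
    · exact hsep m₁ hm1 m' hm' hne (hstay m₁ hm1 hne1 _ hr)

end Gr
end LC

namespace LC
namespace Gr
variable {V : Type u} {E : Type v} {G : Gr V E} {S S' S1 P P' : Set E} {X X0 Y A : Set V}

/-- pairwise separated marks -/
def Sep (G : Gr V E) (S : Set E) (X : Set V) (M : Set E) (W : E → List E) : Prop :=
  ∀ m ∈ M, ∀ m' ∈ M, m' ≠ m →
      ¬ G.Reach (G.Un S X (G.cut S X \ M) W) (G.inn X m) (G.inn X m')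

/-- covering directly a mark whose component meets `A` -/
theorem Cov.direct {M : Set E} {W : E → List E} (hM : M ⊆ G.cut S X)
    (h : G.Cov S A X (G.cut S X \ M) W) {m : E} (hm : m ∈ M) {a : V} (ha : a ∈ A)
    (hr : G.Reach (G.Un S X (G.cut S X \ M) W) (G.inn X m) a) :
    ∃ W', (∀ g, g ≠ m → W' g = W g) ∧ G.Cov S A X (G.cut S X \ (M \ {m})) W' := by
  classical
  obtain ⟨l, h1, h2, h3⟩ := hr.symm.trail
  refine ⟨Function.update W m l, fun g hg => Function.update_of_ne hg _ _, ?_⟩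
  have : G.cut S X \ (M \ {m}) = insert m (G.cut S X \ M) := by
    ext e
    by_cases h1 : e = m
    · subst h1; simp [hM hm]
    · simp [h1]
  rw [this]
  exact h.add (hM hm) ha h1 h2 (fun e he => (h3 e he).1) (fun e he f hf _ => (h3 e he).2 f hf)

/-- the states of the process -/
structure PSt (G : Gr V E) (S : Set E) (A X : Set V) (N : ℕ) (σ : Set E × Set E × (E → List E)) :
    Prop where
  sub : σ.1 ⊆ G.cut S X
  MH : σ.1 ⊆ σ.2.1
  fin : σ.2.1.Finite
  card : σ.1.ncard = N
  cov : G.Cov S A X (G.cut S X \ σ.1) σ.2.2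
  sep : G.Sep S X σ.1 σ.2.2

theorem proc (hP : G.Par S (A ∪ Xᶜ)) {M : Set E} {W : E → List E} (hM : M ⊆ G.cut S X)
    (hMf : M.Finite) (hMn : M.Nonempty) (h : G.Cov S A X (G.cut S X \ M) W) (hsep : G.Sep S X M W) :
    ∃ M' W', M' ⊆ G.cut S X ∧ M'.Finite ∧ M'.ncard < M.ncard ∧ G.Cov S A X (G.cut S X \ M') W' ∧
      ∃ J : Set E, J.Countable ∧ M ⊆ J ∧ M' ⊆ J ∧ ∀ g, g ∉ J → W' g = W g := by
  classical
  by_contra hcon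
  let N := M.ncard
  have hN : 0 < N := (Set.ncard_pos hMf).2 hMn
  let Q := {σ : Set E × Set E × (E → List E) // G.PSt S A X N σ ∧ M ⊆ σ.2.1 ∧
    ∀ g, g ∉ σ.2.1 → σ.2.2 g = W g}
  have hstep : ∀ σ : Q, ∃ τ : Q, ∃ m ∈ σ.1.1, ∃ f, f ∉ σ.1.2.1 ∧
      τ.1.1 = insert f (σ.1.1 \ {m}) ∧ τ.1.2.1 = insert f σ.1.2.1 ∧
      ∀ g, g ≠ m → τ.1.2.2 g = σ.1.2.2 g := by
    rintro ⟨⟨M1, H, W1⟩, hσ, hMH, hW1⟩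
    have hM1f : M1.Finite := hσ.fin.subset hσ.MH
    have hne : M1.Nonempty := (Set.ncard_pos hM1f).1 (by rw [hσ.card]; exact hN)
    have hAn : ∀ m ∈ M1, ∀ a ∈ A, ¬ G.Reach (G.Un S X (G.cut S X \ M1) W1) (G.inn X m) a := by
      intro m hm a ha hr
      obtain ⟨W', hW', hcov⟩ := hσ.cov.direct hσ.sub hm ha hr
      refine hcon ⟨M1 \ {m}, W', Set.sdiff_subset.trans hσ.sub, hM1f.subset Set.sdiff_subset, ?_,
        hcov, H, hσ.fin.countable, hMH, Set.sdiff_subset.trans hσ.MH, ?_⟩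
      · have := Set.ncard_sdiff_singleton_lt_of_mem hm hM1f
        have h2 := hσ.card
        simp only at h2
        omega
      · intro g hg
        rw [hW' g (fun h => hg (h ▸ hσ.MH hm))]
        exact hW1 g hg
    obtain ⟨m, hm, f, hf, hfM, hfH, W', hW', hcov, hsep'⟩ :=
      proc_step hσ.sub hne hσ.fin hP hσ.cov hσ.sep hAn
    have hcard : (insert f (M1 \ {m})).ncard = N := by
      rw [Set.ncard_insert_of_notMem (fun h => hfM h.1) (hM1f.subset Set.sdiff_subset)]
      have := Set.ncard_sdiff_singleton_add_one hm hM1f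
      rw [this]; exact hσ.card
    refine ⟨⟨⟨insert f (M1 \ {m}), insert f H, W'⟩, ⟨?_, ?_, ?_, hcard, hcov, hsep'⟩, ?_, ?_⟩,
      m, hm, f, hfH, rfl, rfl, hW'⟩
    · exact Set.insert_subset hf (Set.sdiff_subset.trans hσ.sub)
    · exact Set.insert_subset_insert (Set.sdiff_subset.trans hσ.MH)
    · exact hσ.fin.insert f
    · exact hMH.trans (Set.subset_insert _ _)
    · intro g hg
      have hgH : g ∉ H := fun h => hg (Or.inr h)
      exact (hW' g (fun h => hgH (h ▸ hσ.MH hm))).trans (hW1 g hgH)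
  choose nx m hm f hf hM1 hH1 hW1 using hstep
  let q0 : Q := ⟨⟨M, M, W⟩, ⟨hM, subset_rfl, hMf, rfl, h, hsep⟩, subset_rfl, fun _ _ => rfl⟩
  let q : ℕ → Q := fun n => nx^[n] q0
  have hq : ∀ n, q (n + 1) = nx (q n) := fun n => Function.iterate_succ_apply' nx n q0
  let Mn : ℕ → Set E := fun n => (q n).1.1
  let Hn : ℕ → Set E := fun n => (q n).1.2.1
  let Wn : ℕ → E → List E := fun n => (q n).1.2.2
  have hMH : ∀ n, Mn n ⊆ Hn n := fun n => (q n).2.1.MH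
  have hHs : ∀ n, Hn n ⊆ Hn (n + 1) := by
    intro n
    simp only [Hn, hq, hH1]
    exact Set.subset_insert _ _
  have hHmono : Monotone Hn := monotone_nat_of_le_succ hHs
  -- once out, always out
  have hout1 : ∀ n g, g ∈ Hn n → g ∉ Mn n → g ∉ Mn (n + 1) ∧ Wn (n + 1) g = Wn n g := by
    intro n g hg hgM
    constructor
    · simp only [Mn, hq, hM1]
      rintro (rfl | h)
      · exact hf (q n) hg
      · exact hgM h.1
    · simp only [Wn, hq]
      exact hW1 (q n) g (fun h => hgM (h ▸ hm (q n)))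
  have hout : ∀ n g, g ∈ Hn n → g ∉ Mn n → ∀ k, n ≤ k → g ∉ Mn k ∧ Wn k g = Wn n g := by
    intro n g hg hgM k hk
    induction k, hk using Nat.le_induction with
    | base => exact ⟨hgM, rfl⟩
    | succ k hk ih =>
      have := hout1 k g (hHmono hk hg) ih.1
      exact ⟨this.1, this.2.trans ih.2⟩
  let Mi : Set E := {g | ∃ n, ∀ k, n ≤ k → g ∈ Mn k}
  have hev : ∀ g, g ∉ Mi → ∃ n, ∀ k, n ≤ k → g ∉ Mn k ∧ Wn k g = Wn n g := by
    intro g hg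
    by_cases hgH : ∃ n, g ∈ Hn n
    · obtain ⟨n, hn⟩ := hgH
      have : ∃ k, n ≤ k ∧ g ∉ Mn k := by
        by_contra hno
        push Not at hno
        exact hg ⟨n, hno⟩
      obtain ⟨k, hk, hgk⟩ := this
      exact ⟨k, hout k g (hHmono hk hn) hgk⟩
    · push Not at hgH
      refine ⟨0, fun k _ => ⟨fun h => hgH k (hMH k h), ?_⟩⟩
      rw [show Wn k g = W g from (q k).2.2.2 g (hgH k), show Wn 0 g = W g from (q 0).2.2.2 g (hgH 0)]
  choose! st hst using hev
  let Wi : E → List E := fun g => Wn (st g) g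
  have hWi : ∀ g, g ∉ Mi → ∀ k, st g ≤ k → g ∉ Mn k ∧ Wn k g = Wi g := hst
  have hcovn : ∀ n, G.Cov S A X (G.cut S X \ Mn n) (Wn n) := fun n => (q n).2.1.cov
  have hMnf : ∀ n, (Mn n).Finite := fun n => (q n).2.1.fin.subset (hMH n)
  have hMnc : ∀ n, (Mn n).ncard = N := fun n => (q n).2.1.card
  have hfinsub : ∀ F : Finset E, (F : Set E) ⊆ Mi → ∃ n, ∀ k, n ≤ k → (F : Set E) ⊆ Mn k := by
    intro F
    induction F using Finset.induction_on with
    | empty => intro _; exact ⟨0, by simp⟩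
    | insert a s ha ih =>
      intro hs
      rw [Finset.coe_insert, Set.insert_subset_iff] at hs
      obtain ⟨n1, h1⟩ := ih hs.2
      obtain ⟨n2, h2⟩ := hs.1
      refine ⟨max n1 n2, fun k hk => ?_⟩
      rw [Finset.coe_insert]
      exact Set.insert_subset (h2 k (le_of_max_le_right hk)) (h1 k (le_of_max_le_left hk))
  have hMifin : Mi.Finite := by
    by_contra hinf
    obtain ⟨F, hF, hFc⟩ := Set.Infinite.exists_subset_card_eq hinf (N + 1)
    obtain ⟨n, hn⟩ := hfinsub F hF
    have := Set.ncard_le_ncard (hn n le_rfl) (hMnf n)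
    rw [Set.ncard_coe_finset, hMnc n] at this
    omega
  have hMicard : Mi.ncard < N := by
    obtain ⟨n, hn⟩ := hfinsub hMifin.toFinset (by simp)
    rw [Set.Finite.coe_toFinset] at hn
    by_contra hge
    push Not at hge
    have e1 : Mi = Mn n := Set.eq_of_subset_of_ncard_le (hn n le_rfl) (by rw [hMnc n]; exact hge) (hMnf n)
    have e2 : Mi = Mn (n + 1) :=
      Set.eq_of_subset_of_ncard_le (hn _ (by omega)) (by rw [hMnc]; exact hge) (hMnf _)
    have : f (q n) ∈ Mn (n + 1) := by
      simp only [Mn, hq, hM1]; exact Or.inl rfl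
    rw [← e2, e1] at this
    exact hf (q n) (hMH n this)
  refine hcon ⟨Mi, Wi, ?_, hMifin, hMicard, ⟨fun g hg => hg.1, ?_, ?_, ?_, ?_⟩, ⋃ n, Hn n,
    Set.countable_iUnion fun n => (q n).2.1.fin.countable, ?_, ?_, ?_⟩
  · rintro g ⟨n, hn⟩
    exact (q n).2.1.sub (hn n le_rfl)
  · intro g hg
    exact (hcovn (st g)).st g ⟨hg.1, (hWi g hg.2 _ le_rfl).1⟩
  · intro g hg
    exact (hcovn (st g)).nd g ⟨hg.1, (hWi g hg.2 _ le_rfl).1⟩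
  · intro g hg
    exact (hcovn (st g)).ins g ⟨hg.1, (hWi g hg.2 _ le_rfl).1⟩
  · intro g hg g' hg' e he he'
    have h1 := hWi g hg.2 (max (st g) (st g')) (le_max_left _ _)
    have h2 := hWi g' hg'.2 (max (st g) (st g')) (le_max_right _ _)
    refine (hcovn (max (st g) (st g'))).dj g ⟨hg.1, h1.1⟩ g' ⟨hg'.1, h2.1⟩ e ?_ ?_
    · rw [h1.2]; exact he
    · rw [h2.2]; exact he'
  · exact Set.subset_iUnion Hn 0
  · rintro g ⟨n, hn⟩
    exact Set.mem_iUnion.2 ⟨n, hMH n (hn n le_rfl)⟩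
  · intro g hg
    exact (q (st g)).2.2.2 g (fun h => hg (Set.mem_iUnion.2 ⟨_, h⟩))

/-- one uncovered edge can be covered -/
theorem proc_one (hP : G.Par S (A ∪ Xᶜ)) {k : E} {W : E → List E} (hk : k ∈ G.cut S X)
    (h : G.Cov S A X (G.cut S X \ {k}) W) :
    ∃ W', G.Cov S A X (G.cut S X) W' ∧
      ∃ J : Set E, J.Countable ∧ k ∈ J ∧ ∀ g, g ∉ J → W' g = W g := by
  obtain ⟨M', W', h1, h2, h3, h4, J, h5, h6, h7, h8⟩ := proc hP (M := {k}) (W := W)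
    (by simpa using hk) (by simp) (by simp) h (by
      intro m hm m' hm' hne
      exact (hne (by rw [Set.mem_singleton_iff.1 hm, Set.mem_singleton_iff.1 hm'])).elim)
  rw [Set.ncard_singleton] at h3
  have : M' = ∅ := (Set.ncard_eq_zero h2).1 (by omega)
  subst this
  rw [Set.sdiff_empty] at h4
  exact ⟨W', h4, J, h5, h6 rfl, h8⟩

/-- at most one uncovered edge -/
theorem proc_one' (hP : G.Par S (A ∪ Xᶜ)) {k : E} {W : E → List E}
    (h : G.Cov S A X (G.cut S X \ {k}) W) : ∃ W', G.Cov S A X (G.cut S X) W' := by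
  by_cases hk : k ∈ G.cut S X
  · obtain ⟨W', h', _⟩ := proc_one hP hk h
    exact ⟨W', h'⟩
  · exact ⟨W, by rwa [Set.sdiff_singleton_eq_self hk] at h⟩

/-- two uncovered edges in different components -/
theorem proc_two (hP : G.Par S (A ∪ Xᶜ)) {k g : E} {W : E → List E} (hk : k ∈ G.cut S X)
    (hg : g ∈ G.cut S X) (hkg : k ≠ g)
    (h : G.Cov S A X (G.cut S X \ {k, g}) W)
    (hs : ¬ G.Reach (G.Un S X (G.cut S X \ {k, g}) W) (G.inn X k) (G.inn X g)) :
    ∃ W', G.Cov S A X (G.cut S X) W' := by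
  obtain ⟨M', W', h1, h2, h3, h4, J, h5, h6, h7, h8⟩ := proc hP (M := {k, g}) (W := W)
    (by
      rintro e (rfl | rfl)
      · exact hk
      · exact hg) (by simp) (by simp) h (by
      rintro m (rfl | rfl) m' (rfl | rfl) hne
      · exact (hne rfl).elim
      · exact hs
      · exact fun h => hs h.symm
      · exact (hne rfl).elim)
  rw [Set.ncard_pair hkg] at h3
  rcases M'.eq_empty_or_nonempty with rfl | ⟨m, hm⟩
  · rw [Set.sdiff_empty] at h4
    exact ⟨W', h4⟩
  · have : M' = {m} := by
      symm
      apply Set.eq_of_subset_of_ncard_le (by simpa using hm) _ h2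
      rw [Set.ncard_singleton]; omega
    subst this
    exact proc_one' hP h4

end Gr
end LC

namespace LC
namespace Gr
variable {V : Type u} {E : Type v} {G : Gr V E} {S S' S1 P P' : Set E} {X X0 Y A : Set V}

open Classical in
/-- token states of the augmentation process -/
inductive Tok (G : Gr V E) (S : Set E) (A X : Set V) (Φ : Set E) (W : E → List E) :
    (E → List E) → List E → V → Prop
  | start (a : V) (ha : a ∈ A) : Tok G S A X Φ W W [] a
  | free {W' : E → List E} {D : List E} {x y : V} {e : E} (h : Tok G S A X Φ W W' D x)
      (he : e ∈ G.ins S X) (hj : G.Jn e x y) (hD : e ∉ D) (hf : ∀ f ∈ Φ, e ∉ W' f) :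
      Tok G S A X Φ W W' (D ++ [e]) y
  | swap {W' : E → List E} {D : List E} {x z a' : V} {f : E} {l1 l2 l3 : List E}
      (h : Tok G S A X Φ W W' D x)
      (hf : f ∈ Φ) (hl : W' f = l1 ++ l2 ++ l3) (ha : a' ∈ A) (h1 : G.Wlk a' l1 z)
      (h2 : G.Wlk z l2 x) (h3 : G.Wlk x l3 (G.inn X f)) :
      Tok G S A X Φ W (Function.update W' f (D ++ l3)) l1 z

theorem Tok.valid {Φ : Set E} {W W' : E → List E} {D : List E} {x : V} (hc : G.Cov S A X Φ W)
    (hA : A ⊆ X) (h : G.Tok S A X Φ W W' D x) :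
    G.Cov S A X Φ W' ∧ (∃ a ∈ A, G.Wlk a D x) ∧ D.Nodup ∧ (∀ e ∈ D, e ∈ G.ins S X) ∧
      (∀ e ∈ D, ∀ f ∈ Φ, e ∉ W' f) ∧ x ∈ X := by
  classical
  induction h with
  | start a ha => exact ⟨hc, ⟨a, ha, rfl⟩, by simp, by simp, by simp, hA ha⟩
  | @free W' D x y e h he hj hD hf ih =>
    obtain ⟨i1, ⟨a, ha, i2⟩, i3, i4, i5, i6⟩ := ih
    refine ⟨i1, ⟨a, ha, i2.append (Wlk.single hj)⟩, ?_, ?_, ?_, (hj.mem_ins.1 he).2.2⟩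
    · rw [List.nodup_append]
      refine ⟨i3, by simp, ?_⟩
      rintro e1 he1 e2 he2 rfl
      obtain rfl : e1 = e := by simpa using he2
      exact hD he1
    · intro e' he'
      rcases List.mem_append.1 he' with he' | he'
      · exact i4 e' he'
      · obtain rfl : e' = e := by simpa using he'
        exact he
    · intro e' he'
      rcases List.mem_append.1 he' with he' | he'
      · exact i5 e' he'
      · obtain rfl : e' = e := by simpa using he'
        exact hf
  | @swap W' D x z a' f l1 l2 l3 h hf hl ha h1 h2 h3 ih =>
    obtain ⟨i1, ⟨a, ha', i2⟩, i3, i4, i5, i6⟩ := ih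
    have hnd := i1.nd f hf
    have hin := i1.ins f hf
    have hdj := fun g hg e he he' => i1.dj f hf g hg e he he'
    rw [hl] at hnd hin hdj
    rw [List.nodup_append, List.nodup_append] at hnd
    obtain ⟨⟨n1, n2, n3⟩, n4, n5⟩ := hnd
    have hz : z ∈ X := by
      cases hl2 : l2 with
      | nil => rw [hl2] at h2; cases h2; exact i6
      | cons e0 l2' =>
        rw [hl2] at h2
        obtain ⟨c, hc, _⟩ := h2
        exact (hc.mem_ins.1 (hin e0 (by simp [hl2]))).2.1
    refine ⟨?_, ⟨a', ha, h1⟩, n1, fun e he => hin e (by simp [he]), ?_, hz⟩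
    · have := i1.add (m := f) (i1.sub hf) ha' (i2.append h3) ?_ ?_ ?_
      · rwa [Set.insert_eq_of_mem hf] at this
      · rw [List.nodup_append]
        refine ⟨i3, n4, ?_⟩
        rintro e1 he1 e2 he2 rfl
        exact i5 e1 he1 f hf (by rw [hl]; simp [he2])
      · intro e he
        rcases List.mem_append.1 he with he | he
        · exact i4 e he
        · exact hin e (by simp [he])
      · intro e he g hg hgf heg
        rcases List.mem_append.1 he with he | he
        · exact i5 e he g hg heg
        · exact hgf (hdj g hg e (by simp [he]) heg).symm
    · intro e he g hg heg
      by_cases hgf : g = f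
      · subst hgf
        rw [Function.update_self, List.mem_append] at heg
        rcases heg with heg | heg
        · exact i5 e heg g hg (by rw [hl]; simp [he])
        · exact n5 e (by simp [he]) e heg rfl
      · rw [Function.update_of_ne hgf] at heg
        exact hgf (hdj g hg e (by simp [he]) heg).symm

theorem residual {Φ : Set E} {W : E → List E} (hc : G.Cov S A X Φ W) (hA : A ⊆ X)
    {e : E} {a v : V} (ha : a ∈ A) (hj : G.Jn e a v) (he : e ∈ G.ins S X)
    (hu : ∀ f ∈ Φ, e ∉ W f) :
    (∃ q ∈ G.cut S X, q ∉ Φ ∧ ∃ W', G.Cov S A X (insert q Φ) W') ∨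
    (∃ X' W', A ⊆ X' ∧ X' ⊆ X ∧ v ∈ X' ∧ G.Cov S A X' (G.cut S X') W') := by
  classical
  by_cases hq : ∃ q ∈ G.cut S X, q ∉ Φ ∧ ∃ W' D, G.Tok S A X Φ W W' D (G.inn X q)
  · left
    obtain ⟨q, hq1, hq2, W', D, ht⟩ := hq
    obtain ⟨i1, ⟨a, ha', i2⟩, i3, i4, i5, i6⟩ := ht.valid hc hA
    exact ⟨q, hq1, hq2, _, i1.add hq1 ha' i2 i3 i4 (fun e he f hf _ => i5 e he f hf)⟩
  right
  push Not at hq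
  let X' : Set V := {x | ∃ W' D, G.Tok S A X Φ W W' D x}
  have hXpX : X' ⊆ X := by
    rintro x ⟨W', D, ht⟩
    exact (ht.valid hc hA).2.2.2.2.2
  have hAX' : A ⊆ X' := fun a ha => ⟨W, [], Tok.start a ha⟩
  -- upstream closure
  have hup : ∀ {W' D x}, G.Tok S A X Φ W W' D x → ∀ f ∈ Φ, ∀ l1 l3, W' f = l1 ++ l3 →
      G.Wlk x l3 (G.inn X f) → ∀ e ∈ l1, e ∈ G.ins S X' := by
    intro W' D x ht f hf l1 l3 hl h3 e he
    obtain ⟨i1, _⟩ := ht.valid hc hA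
    obtain ⟨a', ha', hw⟩ := i1.st' hf
    have hre : G.Wlk x l1.reverse a' := by
      have h4 := hw.reverse
      rw [hl, List.reverse_append] at h4
      exact h4.split_at h3.reverse
    have h1 : G.Wlk a' l1 x := by simpa using hre.reverse
    obtain ⟨p, p', rfl⟩ := List.append_of_mem he
    obtain ⟨z, hz1, z', hz2, hz3⟩ := h1.split
    have m1 : z ∈ X' := ⟨_, _, Tok.swap ht hf hl ha' hz1 ⟨z', hz2, hz3⟩ h3⟩
    have m2 : z' ∈ X' := ⟨_, _, Tok.swap (l1 := p ++ [e]) (l2 := p') ht hf (by simpa using hl) ha'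
      (hz1.append (Wlk.single hz2)) hz3 h3⟩
    exact hz2.mem_ins.2 ⟨(i1.ins f hf e (by rw [hl]; exact List.mem_append_left _ he)).1, m1, m2⟩
  have hinv : ∀ {W' D x}, G.Tok S A X Φ W W' D x → (∀ e ∈ D, e ∈ G.ins S X') ∧
      ∀ f ∈ Φ, ∃ w w0 r, W' f = w ++ r ∧ W f = w0 ++ r ∧ (∀ e ∈ w, e ∈ G.ins S X') ∧
        ∀ e ∈ w0, e ∈ G.ins S X' := by
    intro W' D x ht
    induction ht with
    | start a ha => exact ⟨by simp, fun f hf => ⟨[], [], W f, rfl, rfl, by simp, by simp⟩⟩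
    | @free W' D x y e h he hj hD hf ih =>
      refine ⟨?_, ih.2⟩
      intro e' he'
      rcases List.mem_append.1 he' with he' | he'
      · exact ih.1 e' he'
      · obtain rfl : e' = e := by simpa using he'
        exact hj.mem_ins.2 ⟨he.1, ⟨_, _, h⟩, ⟨_, _, Tok.free h he hj hD hf⟩⟩
    | @swap W' D x z a' f l1 l2 l3 h hf hl ha h1 h2 h3 ih =>
      have hupf := hup h f hf (l1 ++ l2) l3 hl h3
      refine ⟨fun e he => hupf e (by simp [he]), ?_⟩
      intro g hg
      by_cases hgf : g = f
      · subst hgf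
        rw [Function.update_self]
        obtain ⟨w, w0, r, e1, e2, e3, e4⟩ := ih.2 g hf
        have hh : (l1 ++ l2) ++ l3 = w ++ r := by rw [← hl, e1]
        rcases List.append_eq_append_iff.1 hh with ⟨t, ht1, ht2⟩ | ⟨t, ht1, ht2⟩
        · refine ⟨D ++ t, w0, r, by simp [ht2], e2, ?_, e4⟩
          intro e he
          rcases List.mem_append.1 he with he | he
          · exact ih.1 e he
          · exact e3 e (by rw [ht1]; simp [he])
        · refine ⟨D, w0 ++ t, l3, rfl, by rw [e2, ht2]; simp, ih.1, ?_⟩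
          intro e he
          rcases List.mem_append.1 he with he | he
          · exact e4 e he
          · exact hupf e (by rw [ht1]; simp [he])
      · rw [Function.update_of_ne hgf]; exact ih.2 g hg
  -- strands
  have key : ∀ g ∈ G.cut S X', ∃ p, (∃ a ∈ A, ∃ x ∈ X', ∃ y, y ∉ X' ∧ G.Jn g x y ∧ G.Wlk a p x) ∧
      (∀ e ∈ p, e ∈ G.ins S X') ∧ ∃ f ∈ Φ, ((∃ r, W f = p ++ g :: r) ∨ (g = f ∧ p = W f)) := by
    intro g hg
    obtain ⟨hgS, x, ⟨W', D, ht⟩, y, hy, hj⟩ := mem_cut_iff.1 hg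
    obtain ⟨i1, _, i3, i4, i5, i6⟩ := ht.valid hc hA
    have hx : x ∈ X' := ⟨W', D, ht⟩
    by_cases hyX : y ∈ X
    · have hgi : g ∈ G.ins S X := hj.mem_ins.2 ⟨hgS, i6, hyX⟩
      have hgD : g ∉ D := fun h => hy (hj.mem_ins.1 ((hinv ht).1 g h)).2.2
      have : ∃ f ∈ Φ, g ∈ W' f := by
        by_contra hno
        push Not at hno
        exact hy ⟨_, _, Tok.free ht hgi hj hgD hno⟩
      obtain ⟨f, hf, hgf⟩ := this
      obtain ⟨s, s', hs⟩ := List.append_of_mem hgf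
      obtain ⟨a', ha', hw⟩ := i1.st' hf
      rw [hs] at hw
      obtain ⟨x1, hw1, y1, hj1, hw2⟩ := hw.split
      have hxy : x1 = x ∧ y1 = y := by
        rcases hj.pair hj1 with h | h
        · exact h
        · exfalso
          have := hup ht f hf (s ++ [g]) s' (by simp [hs]) (h.2 ▸ hw2) g (by simp)
          exact hy (hj.mem_ins.1 this).2.2
      obtain ⟨rfl, rfl⟩ := hxy
      have hsX := hup ht f hf s (g :: s') hs ⟨y1, hj1, hw2⟩
      obtain ⟨w, w0, r, e1, e2, e3, e4⟩ := (hinv ht).2 f hf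
      have hh : s ++ g :: s' = w ++ r := by rw [← hs, e1]
      have hgw : g ∉ w := fun h => hy (hj.mem_ins.1 (e3 g h)).2.2
      have : ∃ t, s = w ++ t ∧ r = t ++ g :: s' := by
        rcases List.append_eq_append_iff.1 hh with ⟨t, ht1, ht2⟩ | ⟨t, ht1, ht2⟩
        · cases t with
          | nil => exact ⟨[], by simp_all, by simp_all⟩
          | cons g' t =>
            simp only [List.cons_append, List.cons.injEq] at ht2
            exact (hgw (by rw [ht1, ht2.1]; simp)).elim
        · exact ⟨t, ht1, ht2⟩
      obtain ⟨t, ht1, ht2⟩ := this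
      obtain ⟨a0, ha0, hw0⟩ := hc.st' hf
      have e2' : W f = (w0 ++ t) ++ g :: s' := by rw [e2, ht2]; simp
      rw [e2'] at hw0
      obtain ⟨x2, hx2, y2, hj2, hw3⟩ := hw0.split
      have : x2 = x1 := by
        have r1 := hw2.reverse
        have r2 := hw3.reverse
        have := r1.det r2
        subst this
        exact hj2.symm.det hj1.symm
      subst this
      refine ⟨w0 ++ t, ⟨a0, ha0, x2, hx, y1, hy, hj, hx2⟩, ?_, f, hf, Or.inl ⟨s', e2'⟩⟩
      intro e he
      rcases List.mem_append.1 he with he | he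
      · exact e4 e he
      · exact hsX e (by rw [ht1]; simp [he])
    · have hgX : g ∈ G.cut S X := hj.mem_cut.2 ⟨hgS, Or.inl ⟨i6, hyX⟩⟩
      have hinn : G.inn X g = x := inn_eq hj i6 hyX
      have hgΦ : g ∈ Φ := by
        by_contra hno
        exact hq g hgX hno W' D (by rw [hinn]; exact ht)
      obtain ⟨w, w0, r, e1, e2, e3, e4⟩ := (hinv ht).2 g hgΦ
      have hall := hup ht g hgΦ (W' g) [] (by simp) hinn.symm
      obtain ⟨a0, ha0, hw0⟩ := hc.st' hgΦ
      rw [hinn] at hw0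
      refine ⟨W g, ⟨a0, ha0, x, hx, y, hy, hj, hw0⟩, ?_, g, hgΦ, Or.inr ⟨rfl, rfl⟩⟩
      intro e he
      rw [e2] at he
      rcases List.mem_append.1 he with he | he
      · exact e4 e he
      · exact hall e (by rw [e1]; simp [he])
  choose! p hp1 hp2 F hF hp3 using key
  have hsubF : ∀ g ∈ G.cut S X', ∀ e ∈ p g, e ∈ W (F g) := by
    intro g hg e he
    rcases hp3 g hg with ⟨r, h⟩ | ⟨h, h'⟩
    · rw [h]; simp [he]
    · rw [← h']; exact he
  refine ⟨X', p, hAX', hXpX, ?_, subset_rfl, hp1, ?_, hp2, ?_⟩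
  · exact ⟨_, _, Tok.free (Tok.start a ha) he hj (by simp) hu⟩
  · intro g hg
    have := hc.nd _ (hF g hg)
    rcases hp3 g hg with ⟨r, h⟩ | ⟨h, h'⟩
    · rw [h, List.nodup_append] at this; exact this.1
    · rw [h']; exact this
  · intro f hf g hg e he he'
    have hFF : F f = F g := hc.dj _ (hF f hf) _ (hF g hg) e (hsubF f hf e he) (hsubF g hg e he')
    have main : ∀ f ∈ G.cut S X', ∀ g ∈ G.cut S X', F f = F g → ∀ r, W (F f) = p f ++ f :: r →
        f = g := by
      intro f hf g hg hFF r hr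
      rcases hp3 g hg with ⟨r', h'⟩ | ⟨h1, h'⟩
      · have hh : p f ++ f :: r = p g ++ g :: r' := by rw [← hr, hFF, h']
        rcases List.append_eq_append_iff.1 hh with ⟨t, ht1, ht2⟩ | ⟨t, ht1, ht2⟩
        · cases t with
          | nil => simpa using congrArg List.head? ht2
          | cons g' t =>
            simp only [List.cons_append, List.cons.injEq] at ht2
            exact (ins_not_cut (hp2 g hg f (by rw [ht1, ht2.1]; simp)) hf).elim
        · cases t with
          | nil => simpa using congrArg List.head? ht2.symm
          | cons g' t =>
            simp only [List.cons_append, List.cons.injEq] at ht2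
            exact (ins_not_cut (hp2 f hf g (by rw [ht1, ht2.1]; simp)) hg).elim
      · have : f ∈ p g := by rw [h', ← hFF, hr]; simp
        exact (ins_not_cut (hp2 g hg f this) hf).elim
    rcases hp3 f hf with ⟨r, h⟩ | ⟨h1, h2⟩
    · exact main f hf g hg hFF r h
    · rcases hp3 g hg with ⟨r', h'⟩ | ⟨h1', h2'⟩
      · exact (main g hg f hf hFF.symm r' h').symm
      · rw [h1, h1', hFF]

end Gr
end LC

namespace LC
namespace Gr
variable {V : Type u} {E : Type v} {ι : Type w} {G G' : Gr V E} {S S' S1 P P' : Set E}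
  {X X0 Y : Set V} {A : ι → Set V} {z : V}

/-- agreement of two graphs on an edge -/
def Agr (G G' : Gr V E) (e : E) : Prop := G'.s e = G.s e ∧ G'.t e = G.t e

theorem Agr.symm {e : E} (h : Agr G G' e) : Agr G' G e := ⟨h.1.symm, h.2.symm⟩
theorem Agr.jn {e : E} (h : Agr G G' e) {a b : V} : G'.Jn e a b ↔ G.Jn e a b := by
  unfold Jn; rw [h.1, h.2]
theorem Agr.cut {e : E} (h : Agr G G' e) : e ∈ G'.cut S X ↔ e ∈ G.cut S X := by
  simp only [Gr.cut, Set.mem_ofPred_eq]; rw [h.1, h.2]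
theorem Agr.ins {e : E} (h : Agr G G' e) : e ∈ G'.ins S X ↔ e ∈ G.ins S X := by
  simp only [Gr.ins, Set.mem_ofPred_eq]; rw [h.1, h.2]
theorem Agr.av {e : E} (h : Agr G G' e) : G'.Av X e ↔ G.Av X e := by
  simp only [Gr.Av]; rw [h.1, h.2]

theorem Wlk.chg {a b : V} {l : List E} (h : G.Wlk a l b) (hG : ∀ e ∈ l, Agr G G' e) :
    G'.Wlk a l b := by
  induction l generalizing a with
  | nil => exact h
  | cons e l ih =>
    obtain ⟨c, hc, h⟩ := h
    exact ⟨c, (hG e (by simp)).jn.2 hc, ih h (fun e' he' => hG e' (by simp [he']))⟩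

theorem Cov.chg {A : Set V} {Φ : Set E} {W : E → List E} (h : G.Cov S A X Φ W)
    (hG : ∀ f ∈ Φ, (Agr G G' f ∧ f ∈ S') ∧ ∀ e ∈ W f, Agr G G' e ∧ e ∈ S') :
    G'.Cov S' A X Φ W := by
  refine ⟨?_, ?_, h.nd, ?_, h.dj⟩
  · intro f hf
    have := (hG f hf).1.1.cut.2 (h.sub hf)
    exact ⟨(hG f hf).1.2, this.2⟩
  · intro f hf
    obtain ⟨a, ha, x, hx, y, hy, hj, hw⟩ := h.st f hf
    exact ⟨a, ha, x, hx, y, hy, (hG f hf).1.1.jn.2 hj, hw.chg (fun e he => ((hG f hf).2 e he).1)⟩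
  · intro f hf e he
    have := ((hG f hf).2 e he).1.ins.2 (h.ins f hf e he)
    exact ⟨((hG f hf).2 e he).2, this.2⟩

theorem Cov.monoS {A : Set V} {Φ : Set E} {W : E → List E} (h : G.Cov S A X Φ W) (hS : S ⊆ S') :
    G.Cov S' A X Φ W :=
  h.chg fun f hf => ⟨⟨⟨rfl, rfl⟩, hS (h.sub hf).1⟩, fun e he => ⟨⟨rfl, rfl⟩, hS (h.ins f hf e he).1⟩⟩

open Classical in
/-- give an edge new ends -/
noncomputable def reEnd (G : Gr V E) (k : E) (a b : V) : Gr V E :=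
  ⟨Function.update G.s k a, Function.update G.t k b⟩

theorem reEnd_agr {k e : E} {a b : V} (h : e ≠ k) : Agr G (G.reEnd k a b) e := by
  simp [Agr, reEnd, h]

theorem reEnd_jn {k : E} {a b : V} : (G.reEnd k a b).Jn k a b := by
  left; simp [reEnd]

/-- all terminals -/
def Tm (A : ι → Set V) (z : V) : Set V := {x | x = z ∨ ∃ i, x ∈ A i}
/-- the terminals not in `A j` -/
def Ot (A : ι → Set V) (z : V) (j : ι) : Set V := {x | x = z ∨ ∃ i, i ≠ j ∧ x ∈ A i}

/-- disjoint terminal classes -/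
structure Dis (A : ι → Set V) (z : V) : Prop where
  dj : ∀ i j, i ≠ j → Disjoint (A i) (A j)
  nz : ∀ i, z ∉ A i

/-- admissible sets -/
structure Adm (A : ι → Set V) (z : V) (j : ι) (X : Set V) : Prop where
  sub : A j ⊆ X
  dj : Disjoint X (Ot A z j)

theorem Adm.nz {j : ι} (h : Adm A z j X) : z ∉ X :=
  fun h' => Set.disjoint_left.1 h.dj h' (Or.inl rfl)
theorem Adm.other {i j : ι} (h : Adm A z j X) (hij : i ≠ j) {x : V} (hx : x ∈ X) : x ∉ A i :=
  fun h' => Set.disjoint_left.1 h.dj hx (Or.inr ⟨i, hij, h'⟩)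

theorem Adm.intro {j : ι} (h1 : A j ⊆ X) (h2 : z ∉ X) (h3 : ∀ i, i ≠ j → ∀ x ∈ X, x ∉ A i) :
    Adm A z j X := by
  refine ⟨h1, Set.disjoint_left.2 ?_⟩
  rintro x hx (rfl | ⟨i, hi, hxi⟩)
  · exact h2 hx
  · exact h3 i hi x hx hxi

theorem Adm.subset {j : ι} {X' : Set V} (h : Adm A z j X) (h1 : A j ⊆ X') (h2 : X' ⊆ X) :
    Adm A z j X' := ⟨h1, h.dj.mono_left h2⟩

theorem Adm.par {j : ι} (h : Adm A z j X) (hP : G.Par S (Tm A z)) : G.Par S (A j ∪ Xᶜ) := by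
  intro U hU
  apply hP
  rw [Set.disjoint_left] at hU ⊢
  rintro x hx (rfl | ⟨i, hi⟩)
  · exact hU hx (Or.inr h.nz)
  · by_cases hij : i = j
    · subst hij; exact hU hx (Or.inl hi)
    · exact hU hx (Or.inr (fun hxX => h.other hij hxX hi))

/-- looseness -/
def Loose (G : Gr V E) (S : Set E) (A : ι → Set V) (z : V) : Prop :=
  ∀ j X W, Adm A z j X → G.Cov S (A j) X (G.cut S X) W → ∀ e ∈ G.cut S (A j), e ∉ G.ins S X

theorem Cov.first {A : Set V} {Φ : Set E} {W : E → List E} (h : G.Cov S A X Φ W) {f : E}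
    (hf : f ∈ Φ) (hi : G.inn X f ∉ A) : ∃ e ∈ W f, ∃ a ∈ A, ∃ v, v ∉ A ∧ G.Jn e a v := by
  obtain ⟨a, ha, hw⟩ := h.st' hf
  obtain ⟨l1, f', l2, x, y, h1, h2, h3, h4, h5, _⟩ := last_exit hw (vis_start ha) hi
  exact ⟨f', by rw [h1]; simp, x, h3, y, h5, h4⟩

theorem Loose.one {j : ι} (hL : G.Loose S A z) (hP : G.Par S (Tm A z)) (hX : Adm A z j X) {k : E}
    {W : E → List E} (h : G.Cov S (A j) X (G.cut S X \ {k}) W) {e : E}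
    (he : e ∈ G.cut S (A j)) : e ∉ G.ins S X := by
  obtain ⟨W', h'⟩ := proc_one' (hX.par hP) h
  exact hL j X W' hX h' e he

/-- a cut edge with inner end outside `A j` cannot be covered -/
theorem Loose.no_cover {j : ι} (hL : G.Loose S A z) (hP : G.Par S (Tm A z)) (hX : Adm A z j X)
    {k f : E} {W : E → List E} (h : G.Cov S (A j) X (G.cut S X \ {k}) W) (hf : f ∈ G.cut S X)
    (hfk : f ≠ k) (hi : G.inn X f ∉ A j) : False := by
  obtain ⟨e, he, a, ha, v, hv, hj⟩ := h.first ⟨hf, hfk⟩ hi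
  have hei := h.ins f ⟨hf, hfk⟩ e he
  exact hL.one hP hX h (hj.mem_cut.2 ⟨hei.1, Or.inl ⟨ha, hv⟩⟩) hei

/-- no free edge -/
theorem Loose.nf {j : ι} (hL : G.Loose S A z) (hP : G.Par S (Tm A z)) (hX : Adm A z j X)
    {k g : E} {W : E → List E} (h : G.Cov S (A j) X (G.cut S X \ {k, g}) W) {e : E}
    (he : e ∈ G.cut S (A j)) (hei : e ∈ G.ins S X) : ∃ f ∈ G.cut S X \ {k, g}, e ∈ W f := by
  by_contra hno
  push Not at hno
  obtain ⟨heS, a, ha, v, hv, hj⟩ := mem_cut_iff.1 he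
  rcases residual h hX.sub ha hj hei hno with ⟨q, hq, hqn, W', h'⟩ | ⟨X', W', h1, h2, h3, h4⟩
  · have hq' : q = k ∨ q = g := by
      by_contra hn
      exact hqn ⟨hq, hn⟩
    rcases hq' with rfl | rfl
    · exact hL.one hP hX (k := g) (h'.mono (by
        rintro x ⟨hx, hxn⟩
        by_cases hxq : x = q
        · exact Or.inl hxq
        · exact Or.inr ⟨hx, by simp [hxq]; simpa using hxn⟩)) he hei
    · exact hL.one hP hX (k := k) (h'.mono (by
        rintro x ⟨hx, hxn⟩
        by_cases hxq : x = q
        · exact Or.inl hxq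
        · exact Or.inr ⟨hx, by simp [hxq]; simpa using hxn⟩)) he hei
  · exact hL j X' W' (hX.subset h1 h2) h4 e he (hj.mem_ins.2 ⟨heS, h1 ha, h3⟩)

/-- tight links -/
structure TL (G : Gr V E) (S : Set E) (A X : Set V) (W : E → List E) : Prop where
  sub : A ⊆ X
  cov : G.Cov S A X (G.cut S X) W
  tr : G.Tr S A (G.cut S X) W
  full : ∀ e ∈ G.cut S A, e ∈ G.ins S X → ∃ f ∈ G.cut S X, e ∈ W f

theorem TL.triv (G : Gr V E) (S : Set E) (A : Set V) : G.TL S A A (fun _ => []) where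
  sub := subset_rfl
  cov := Cov.triv G S A
  tr := fun f hf => Or.inl ⟨rfl, hf⟩
  full := fun e he he' => (ins_not_cut he' he).elim

theorem Av.mono {e : E} (h : G.Av Y e) (hs : X ⊆ Y) : G.Av X e :=
  ⟨fun h' => h.1 (hs h'), fun h' => h.2 (hs h')⟩

/-- uniqueness of the terminal edge on a trimmed strand -/
theorem Tr.uniq {A : Set V} {Φ : Set E} {W : E → List E} (h : G.Tr S A Φ W) {f e e' : E}
    (hf : f ∈ Φ) (he : e ∈ W f ∨ e = f) (he' : e' ∈ W f ∨ e' = f) (hc : e ∈ G.cut S A)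
    (hc' : e' ∈ G.cut S A) : e = e' := by
  rcases h f hf with ⟨h1, h2⟩ | ⟨e0, l, h1, h2, h3, h4⟩
  · simp only [h1, List.not_mem_nil, false_or] at he he'
    rw [he, he']
  · have key : ∀ e, (e ∈ W f ∨ e = f) → e ∈ G.cut S A → e = e0 := by
      intro e he hc
      rw [h1, List.mem_cons] at he
      rcases he with (he | he) | he
      · exact he
      · exact ((h3 e he).not_cut hc).elim
      · exact (h4.not_cut (he ▸ hc)).elim
    rw [key e he hc, key e' he' hc']

theorem TL.comp {A X0 X : Set V} {W0 W1 : E → List E} (h0 : G.TL S A X0 W0) (h1 : G.TL S X0 X W1) :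
    ∃ W, G.TL S A X W := by
  obtain ⟨W, hW, c1, c2⟩ := h0.cov.comp h1.cov subset_rfl h1.sub subset_rfl
  refine ⟨W, h0.sub.trans h1.sub, hW, ?_, ?_⟩
  · intro f hf
    by_cases hc : f ∈ G.cut S X0
    · rw [c1 f hf hc]; exact h0.tr f hc
    · obtain ⟨f', hf', l0, l, e1, e2, e3, e4⟩ := c2 f hf hc
      right
      rw [e2]
      rcases h0.tr f' hf' with ⟨t1, t2⟩ | ⟨e0, l', t1, t2, t3, t4⟩
      · exact ⟨f', l, by rw [t1]; rfl, t2, fun e he => (e3 e he).mono h0.sub, e4.mono h0.sub⟩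
      · refine ⟨e0, l' ++ f' :: l, by rw [t1]; rfl, t2, ?_, e4.mono h0.sub⟩
        intro e he
        simp only [List.mem_append, List.mem_cons] at he
        rcases he with he | rfl | he
        · exact t3 e he
        · exact t4
        · exact (e3 e he).mono h0.sub
  · -- full
    have step : ∀ f' ∈ G.cut S X0, ∀ e, (e ∈ W0 f' ∨ e = f') → e ∈ G.ins S X →
        ∃ f ∈ G.cut S X, e ∈ W f := by
      intro f' hf' e he hei
      by_cases hc : f' ∈ G.cut S X
      · refine ⟨f', hc, ?_⟩
        rw [c1 f' hc hf']
        rcases he with he | rfl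
        · exact he
        · exact (ins_not_cut hei hc).elim
      · have hfi : f' ∈ G.ins S X := by
          obtain ⟨hS, x, hx, y, hy, hj⟩ := mem_cut_iff.1 hf'
          rw [hj.mem_cut] at hc
          rw [hj.mem_ins]
          have := h1.sub hx
          tauto
        obtain ⟨f, hf, hff⟩ := h1.full f' hf' hfi
        have hfn : f ∉ G.cut S X0 := by
          intro hfc
          have := h1.tr.uniq hf (Or.inl hff) (Or.inr rfl) hf' hfc
          exact hc (this ▸ hf)
        obtain ⟨f'', hf'', l0, l, e1, e2, e3, e4⟩ := c2 f hf hfn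
        have : f' = f'' := h1.tr.uniq hf (Or.inl hff) (Or.inl (by rw [e1]; simp)) hf' hf''
        subst this
        refine ⟨f, hf, ?_⟩
        rw [e2]
        rcases he with he | rfl
        · simp [he]
        · simp
    intro e he hei
    by_cases hc : e ∈ G.cut S X0
    · exact step e hc e (Or.inr rfl) hei
    · have : e ∈ G.ins S X0 := by
        obtain ⟨hS, x, hx, y, hy, hj⟩ := mem_cut_iff.1 he
        rw [hj.mem_cut] at hc
        rw [hj.mem_ins]
        have := h0.sub hx
        tauto
      obtain ⟨f', hf', hef⟩ := h0.full e he this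
      exact step f' hf' e (Or.inl hef) hei

/-- restricting a tight link to fewer edges -/
theorem TL.chg {A X : Set V} {W : E → List E} (h : G.TL S A X W) (hS : S' ⊆ S)
    (hG : ∀ e ∈ S', Agr G G' e)
    (hf : ∀ f ∈ G.cut S X, f ∈ S' → ∀ e ∈ W f, e ∈ S')
    (hf2 : ∀ f ∈ G.cut S X, f ∉ S' → ∀ e ∈ W f, e ∈ G.cut S A → e ∉ S') : G'.TL S' A X W := by
  have hcut : ∀ Z e, e ∈ G'.cut S' Z ↔ e ∈ G.cut S Z ∧ e ∈ S' := by
    intro Z e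
    constructor
    · intro he
      have := (hG e he.1).cut.1 he
      exact ⟨⟨hS he.1, this.2⟩, he.1⟩
    · rintro ⟨h1, h2⟩
      exact (hG e h2).cut.2 ⟨h2, h1.2⟩
  refine ⟨h.sub, ?_, ?_, ?_⟩
  · refine (h.cov.mono (fun e he => ((hcut X e).1 he).1)).chg ?_
    intro f hfc
    obtain ⟨h1, h2⟩ := (hcut X f).1 hfc
    exact ⟨⟨hG f h2, h2⟩, fun e he => ⟨hG e (hf f h1 h2 e he), hf f h1 h2 e he⟩⟩
  · intro f hfc
    obtain ⟨h1, h2⟩ := (hcut X f).1 hfc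
    rcases h.tr f h1 with ⟨t1, t2⟩ | ⟨e0, l, t1, t2, t3, t4⟩
    · exact Or.inl ⟨t1, (hcut _ _).2 ⟨t2, h2⟩⟩
    · refine Or.inr ⟨e0, l, t1, (hcut _ _).2 ⟨t2, hf f h1 h2 e0 (by simp [t1])⟩, ?_, (hG f h2).av.2 t4⟩
      intro e he
      exact (hG e (hf f h1 h2 e (by simp [t1, he]))).av.2 (t3 e he)
  · intro e he hei
    obtain ⟨h1, h2⟩ := (hcut _ _).1 he
    have h3 := (hG e h2).ins.1 hei
    obtain ⟨f, hfc, hef⟩ := h.full e h1 ⟨hS h2, h3.2⟩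
    refine ⟨f, (hcut _ _).2 ⟨hfc, ?_⟩, hef⟩
    by_contra hn
    exact hf2 f hfc hn e hef h1 h2

/-- the residual structure -/
def Res (G : Gr V E) (S : Set E) (A : ι → Set V) (z : V) : Prop :=
  ∃ (X : ι → Set V) (W : ι → E → List E), (∀ i, G.TL S (A i) (X i) (W i)) ∧ Dis X z ∧ G.Loose S X z

theorem Res.comp {X : ι → Set V} {W : ι → E → List E} (h : ∀ i, G.TL S (A i) (X i) (W i))
    (hr : G.Res S X z) : G.Res S A z := by
  obtain ⟨Y, W', h1, h2, h3⟩ := hr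
  have := fun i => (h i).comp (h1 i)
  choose W'' hW'' using this
  exact ⟨Y, W'', hW'', h2, h3⟩

theorem Loose.chg (h : G.Loose S A z) (hG : ∀ e ∈ S, Agr G G' e) : G'.Loose S A z := by
  have hcut : ∀ Z, G'.cut S Z = G.cut S Z := fun Z => Set.ext fun e =>
    ⟨fun he => (hG e he.1).cut.1 he, fun he => (hG e he.1).cut.2 he⟩
  intro j X W hX hc e he hei
  rw [hcut] at hc he
  refine h j X W hX (hc.chg ?_) e he ((hG e he.1).ins.1 hei)
  intro f hf
  exact ⟨⟨(hG f hf.1).symm, hf.1⟩, fun e he => ⟨(hG e (hc.ins f hf e he).1).symm, (hc.ins f hf e he).1⟩⟩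

theorem Res.chg (h : G.Res S A z) (hG : ∀ e ∈ S, Agr G G' e) : G'.Res S A z := by
  obtain ⟨X, W, h1, h2, h3⟩ := h
  refine ⟨X, W, fun i => (h1 i).chg subset_rfl hG ?_ ?_, h2, h3.chg hG⟩
  · intro f hf _ e he; exact ((h1 i).cov.ins f hf e he).1
  · intro f hf hn; exact (hn hf.1).elim

/-- looseness does not depend on edges inside the terminal classes -/
theorem Loose.inside (h : G.Loose S A z) (hS : S' ⊆ S)
    (hin : ∀ e ∈ S, e ∉ S' → ∃ m, e ∈ G.ins S (A m)) : G.Loose S' A z := by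
  intro j X W hX hc e he hei
  have hcut : ∀ Z, Adm A z j Z → G.cut S' Z = G.cut S Z := by
    intro Z hZ
    refine Set.Subset.antisymm (cut_mono hS) ?_
    intro f hf
    refine ⟨?_, hf.2⟩
    by_contra hn
    obtain ⟨m, hm⟩ := hin f hf.1 hn
    by_cases hmj : m = j
    · subst hmj
      exact ins_not_cut (ins_mono subset_rfl hZ.sub hm) hf
    · have : G.Av Z f := ⟨fun h => hZ.other hmj h hm.2.1, fun h => hZ.other hmj h hm.2.2⟩
      exact this.not_cut hf
  refine h j X W hX ?_ e (cut_mono hS he) (ins_mono hS subset_rfl hei)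
  rw [← hcut X hX]
  exact hc.monoS hS

/-- parity transfer -/
theorem par_transfer {C D L K : Set E} (hL : L.Finite) (hK : K.Finite) (hCD : C \ L = D \ K)
    (hpar : Even (C ∩ L).ncard ↔ Even (D ∩ K).ncard) (h : D.Finite ∧ Odd D.ncard) :
    C.Finite ∧ Odd C.ncard := by
  have hC : C = (C \ L) ∪ (C ∩ L) := (Set.sdiff_union_inter C L).symm
  have hD : D = (D \ K) ∪ (D ∩ K) := (Set.sdiff_union_inter D K).symm
  have hDf : (D \ K).Finite := h.1.subset Set.sdiff_subset
  have hCf : (C \ L).Finite := hCD ▸ hDf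
  have hCLf : (C ∩ L).Finite := hL.subset Set.inter_subset_right
  have hfin : C.Finite := by rw [hC]; exact hCf.union hCLf
  have n1 : (C ∩ L).ncard + (C \ L).ncard = C.ncard := Set.ncard_inter_add_ncard_sdiff_eq_ncard C L hfin
  have n2 : (D ∩ K).ncard + (D \ K).ncard = D.ncard := Set.ncard_inter_add_ncard_sdiff_eq_ncard D K h.1
  refine ⟨hfin, ?_⟩
  have h2 := h.2
  rw [← n2, ← hCD] at h2
  rw [← n1]
  rw [Nat.odd_add, ← Nat.not_even_iff_odd] at h2 ⊢
  tauto

theorem Wlk.cross_iff {a b : V} {l : List E} (h : G.Wlk a l b) (hl : l.Nodup) {U : Set V}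
    (hS : ∀ e ∈ l, e ∈ S) : Even ((G.cut S U ∩ {e | e ∈ l}).ncard) ↔ (a ∈ U ↔ b ∈ U) := by
  classical
  rw [← h.cross U]
  have h2 : G.cut S U ∩ {e | e ∈ l} =
      ((l.filter (fun e => decide (e ∈ G.cut Set.univ U))).toFinset : Set E) := by
    ext e
    simp only [Set.mem_inter_iff, Set.mem_ofPred_eq, List.coe_toFinset, List.mem_filter,
      decide_eq_true_eq]
    constructor
    · rintro ⟨h1, h2⟩; exact ⟨h2, trivial, h1.2⟩
    · rintro ⟨h1, h2⟩; exact ⟨⟨hS e h1, h2.2⟩, h1⟩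
  rw [h2, Set.ncard_coe_finset, List.toFinset_card_of_nodup (hl.filter _)]

/-- deleting a trail between terminals preserves parity -/
theorem Par.delete {T : Set V} (hP : G.Par S T) {a b : V} {l : List E} (h : G.Wlk a l b)
    (hl : l.Nodup) (hS : ∀ e ∈ l, e ∈ S) (ha : a ∈ T) (hb : b ∈ T) : G.Par (S \ {e | e ∈ l}) T := by
  intro U hU hcon
  refine hP U hU (par_transfer (L := {e | e ∈ l}) (K := ∅) (List.finite_toSet l) Set.finite_empty ?_ ?_ hcon)
  · ext e
    simp only [cut, Set.mem_sdiff, Set.mem_ofPred_eq, Set.mem_empty_iff_false, not_false_eq_true,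
      and_true]
    tauto
  · rw [h.cross_iff hl hS]
    simp only [Set.inter_empty, Set.ncard_empty, Even.zero, iff_true]
    have h1 : a ∉ U := fun h => Set.disjoint_left.1 hU h ha
    have h2 : b ∉ U := fun h => Set.disjoint_left.1 hU h hb
    tauto

/-- replacing a trail starting with `k` by the single edge `k` preserves parity -/
theorem Par.replace {T : Set V} (hP : G.Par S T) {x : V} {k : E} {l : List E}
    (h : G.Wlk z (k :: l) x) (hl : (k :: l).Nodup) (hS : ∀ e ∈ k :: l, e ∈ S) :
    (G.reEnd k z x).Par (S \ {e | e ∈ l}) T := by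
  intro U hU hcon
  refine hP U hU (par_transfer (L := {e | e ∈ k :: l}) (K := {e | e ∈ [k]}) (List.finite_toSet _)
    (List.finite_toSet _) ?_ ?_ hcon)
  · ext e
    by_cases hek : e = k
    · subst hek; simp
    · have := (reEnd_agr (G := G) (a := z) (b := x) hek).cut (S := S \ {e | e ∈ l}) (X := U)
      simp only [Set.mem_sdiff, this, Set.mem_ofPred_eq, List.mem_cons, hek, List.not_mem_nil,
        false_or, or_false, not_false_eq_true, and_true]
      simp only [cut, Set.mem_ofPred_eq, Set.mem_sdiff]
      tauto
  · rw [h.cross_iff hl hS]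
    have hw : (G.reEnd k z x).Wlk z [k] x := Wlk.single reEnd_jn
    rw [hw.cross_iff (by simp)]
    intro e he
    obtain rfl : e = k := by simpa using he
    exact ⟨hS e (by simp), (List.nodup_cons.1 hl).1⟩

end Gr
end LC

namespace LC
namespace Gr
variable {V : Type u} {E : Type v} {ι : Type w} {G G' : Gr V E} {S S' S1 P P' : Set E}
  {X X0 Y : Set V} {A : ι → Set V} {z : V}

/-- a set all of whose cut edges but two are linked to `A j` -/
structure Ex2 (G : Gr V E) (S : Set E) (A : ι → Set V) (z : V) (k : E) (x0 : V) (j : ι)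
    (X : Set V) (g : E) (W : E → List E) : Prop where
  adm : Adm A z j X
  x0m : x0 ∈ X
  gm : g ∈ G.cut S X
  ne : g ≠ k
  cov : G.Cov S (A j) X (G.cut S X \ {k, g}) W

theorem mem_Tm_of {i : ι} {x : V} (h : x ∈ A i) : x ∈ Tm A z := Or.inr ⟨i, h⟩

theorem Adm.not_Tm {j : ι} (h : Adm A z j X) {x : V} (hx : x ∈ X) (hj : x ∉ A j) : x ∉ Tm A z := by
  rintro (rfl | ⟨i, hi⟩)
  · exact h.nz hx
  · by_cases hij : i = j
    · subst hij; exact hj hi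
    · exact h.other hij hx hi

/-- base case -/
theorem loose_base {k o : E} {x0 : V} (hL : G.Loose S A z) (hk : G.Jn k z x0) (ho : G.Jn o z x0)
    (hoS : o ∈ S) (hko : k ≠ o)
    (hno : ∀ j X g W, ¬ G.Ex2 S A z k x0 j X g W) : G.Loose (S \ {k, o}) A z := by
  intro j X W hX hc e he hei
  by_cases hx : x0 ∈ X
  · refine hno j X o W ⟨hX, hx, ho.mem_cut.2 ⟨hoS, Or.inr ⟨hx, hX.nz⟩⟩, hko.symm, ?_⟩
    refine (hc.monoS Set.sdiff_subset).mono ?_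
    rintro f ⟨hf, hn⟩
    exact ⟨⟨hf.1, hn⟩, hf.2⟩
  · refine hL j X W hX ((hc.monoS Set.sdiff_subset).mono ?_) e (cut_mono Set.sdiff_subset he)
      (ins_mono Set.sdiff_subset subset_rfl hei)
    intro f hf
    refine ⟨⟨hf.1, ?_⟩, hf.2⟩
    rintro (rfl | h)
    · have := hk.mem_cut.1 hf; have := hX.nz; tauto
    · rw [Set.mem_singleton_iff] at h; subst h
      have := ho.mem_cut.1 hf; have := hX.nz; tauto

/-- transfer of covers along `reEnd`, away from `k` -/
theorem cov_back {B : Set V} {k : E} {x1 : V} {Φ Φ' : Set E} {W : E → List E}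
    (hc : (G.reEnd k z x1).Cov S' B X Φ W) (hz : z ∉ X) (hS : S' ⊆ S) (hk : k ∉ Φ')
    (hΦ : Φ' ⊆ Φ) : G.Cov S B X Φ' W := by
  refine (hc.mono hΦ).chg ?_
  intro f hf
  have hfk : f ≠ k := fun h => hk (h ▸ hf)
  refine ⟨⟨(reEnd_agr hfk).symm, hS (hc.sub (hΦ hf)).1⟩, ?_⟩
  intro e he
  have hei := hc.ins f (hΦ hf) e he
  have hek : e ≠ k := by
    rintro rfl
    have := reEnd_jn.mem_ins.1 hei
    exact hz this.2.1
  exact ⟨(reEnd_agr hek).symm, hS hei.1⟩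

theorem cut_back {k : E} {x1 : V} {f : E} (hfk : f ≠ k) :
    f ∈ (G.reEnd k z x1).cut S X ↔ f ∈ G.cut S X := (reEnd_agr hfk).cut
theorem ins_back {k : E} {x1 : V} {f : E} (hfk : f ≠ k) :
    f ∈ (G.reEnd k z x1).ins S X ↔ f ∈ G.ins S X := (reEnd_agr hfk).ins

/-- step -/
theorem loose_step {k f : E} {x0 x1 : V} (hL : G.Loose S A z) (hk : G.Jn k z x0)
    (hkS : k ∈ S) (hf : G.Jn f x0 x1) (hfS : f ∈ S) (hfk : f ≠ k) (h1 : x1 ∉ Tm A z)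
    (hno : ∀ j X g W, ¬ G.Ex2 S A z k x0 j X g W) :
    (G.reEnd k z x1).Loose (S \ {f}) A z := by
  intro j X W hX hc e he hei
  have hz := hX.nz
  have hek : e ≠ k := by
    rintro rfl
    have := reEnd_jn.mem_ins.1 hei
    exact hz this.2.1
  have he' : e ∈ G.cut S (A j) := cut_mono Set.sdiff_subset ((cut_back hek).1 he)
  have hei' : e ∈ G.ins S X := ins_mono Set.sdiff_subset subset_rfl ((ins_back hek).1 hei)
  have hcut : ∀ g, g ≠ k → g ≠ f → g ∈ G.cut S X → g ∈ (G.reEnd k z x1).cut (S \ {f}) X := by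
    intro g h1 h2 h3
    rw [cut_back h1]
    exact ⟨⟨h3.1, h2⟩, h3.2⟩
  have hk' : k ∈ (G.reEnd k z x1).cut (S \ {f}) X ↔ x1 ∈ X := by
    rw [reEnd_jn.mem_cut]
    have : k ∈ S \ {f} := ⟨hkS, hfk.symm⟩
    tauto
  have hf' : f ∈ G.cut S X ↔ ((x0 ∈ X ∧ x1 ∉ X) ∨ (x1 ∈ X ∧ x0 ∉ X)) := by
    rw [hf.mem_cut]; tauto
  have hkk : k ∈ G.cut S X ↔ x0 ∈ X := by
    rw [hk.mem_cut]; tauto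
  have hbase : G.Cov S (A j) X (G.cut S X \ {k, f}) W :=
    cov_back hc hz Set.sdiff_subset (by simp) (by
      rintro g ⟨hg, hn⟩
      simp only [Set.mem_insert_iff, Set.mem_singleton_iff, not_or] at hn
      exact hcut g hn.1 hn.2 hg)
  by_cases hx0 : x0 ∈ X
  · by_cases hx1 : x1 ∈ X
    · -- both in
      have hkc := hk'.2 hx1
      obtain ⟨a, ha, hw⟩ := hc.st' hkc
      rw [inn_eq reEnd_jn.symm hx1 hz] at hw
      have hkW : ∀ e ∈ W k, e ∈ S \ {f} ∧ e ≠ k ∧ e ∈ G.ins S X := by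
        intro e he
        have h := hc.ins k hkc e he
        have : e ≠ k := by
          rintro rfl
          have := reEnd_jn.mem_ins.1 h
          exact hz this.2.1
        exact ⟨h.1, this, ins_mono Set.sdiff_subset subset_rfl ((ins_back this).1 h)⟩
      have hw' : G.Wlk a (W k) x1 := hw.chg (fun e he => (reEnd_agr (hkW e he).2.1).symm)
      have hcov := hbase.add (m := k) (hkk.2 hx0) (l := W k ++ [f]) ha
        (by rw [inn_eq hk.symm hx0 hz]; exact hw'.append (Wlk.single hf.symm))
        (by
          rw [List.nodup_append]
          refine ⟨hc.nd k hkc, by simp, ?_⟩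
          intro x hx y hy
          simp only [List.mem_singleton] at hy
          rw [hy]
          exact (hkW x hx).1.2)
        (by
          intro e he
          simp only [List.mem_append, List.mem_singleton] at he
          rcases he with he | rfl
          · exact (hkW e he).2.2
          · exact hf.mem_ins.2 ⟨hfS, hx0, hx1⟩)
        (by
          intro e he g hg hgk heg
          have hgc := hcut g (by simp_all) (by have := hg.2; simp_all) hg.1
          simp only [List.mem_append, List.mem_singleton] at he
          rcases he with he | rfl
          · exact hgk (hc.dj k hkc g hgc e he heg).symm
          · exact (hc.ins g hgc e heg).1.2 rfl)
      refine hL j X _ hX (hcov.mono ?_) e he' hei'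
      intro g hg
      by_cases hgk : g = k
      · exact Or.inl hgk
      · refine Or.inr ⟨hg, ?_⟩
        rintro (h | h)
        · exact hgk h
        · rw [Set.mem_singleton_iff.1 h] at hg
          rw [hf'] at hg; tauto
    · exact hno j X f W ⟨hX, hx0, hf'.2 (Or.inl ⟨hx0, hx1⟩), hfk, hbase⟩
  · by_cases hx1 : x1 ∈ X
    · have hkc := hk'.2 hx1
      obtain ⟨a, ha, hw⟩ := hc.st' hkc
      rw [inn_eq reEnd_jn.symm hx1 hz] at hw
      have hkW : ∀ e ∈ W k, e ∈ S \ {f} ∧ e ≠ k ∧ e ∈ G.ins S X := by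
        intro e he
        have h := hc.ins k hkc e he
        have : e ≠ k := by
          rintro rfl
          have := reEnd_jn.mem_ins.1 h
          exact hz this.2.1
        exact ⟨h.1, this, ins_mono Set.sdiff_subset subset_rfl ((ins_back this).1 h)⟩
      have hw' : G.Wlk a (W k) x1 := hw.chg (fun e he => (reEnd_agr (hkW e he).2.1).symm)
      have hcov := hbase.add (m := f) (hf'.2 (Or.inr ⟨hx1, hx0⟩)) (l := W k) ha
        (by rw [inn_eq hf.symm hx1 hx0]; exact hw')
        (hc.nd k hkc) (fun e he => (hkW e he).2.2)
        (by
          intro e he g hg hgk heg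
          have hgc := hcut g (by have := hg.2; simp_all) hgk hg.1
          have := hc.dj k hkc g hgc e he heg
          exact hg.2 (Or.inl this.symm))
      refine hL j X _ hX (hcov.mono ?_) e he' hei'
      intro g hg
      by_cases hgk : g = f
      · exact Or.inl hgk
      · refine Or.inr ⟨hg, ?_⟩
        rintro (h | h)
        · rw [h] at hg
          rw [hkk] at hg; tauto
        · exact hgk h
    · refine hL j X W hX (hbase.mono ?_) e he' hei'
      intro g hg
      refine ⟨hg, ?_⟩
      rintro (h | h)
      · rw [h, hkk] at hg; exact hx0 hg
      · rw [Set.mem_singleton_iff] at h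
        rw [h, hf'] at hg; tauto

/-- making the second exceptional edge the one we like -/
theorem Ex2.convert {k : E} {x0 w x' : V} {j : ι} {g h : E} {W : E → List E}
    (hL : G.Loose S A z) (hP : G.Par S (Tm A z)) (hk : G.Jn k z x0)
    (hx : G.Ex2 S A z k x0 j X g W) (hh : G.Jn h w x') (hhS : h ∈ S) (hhk : h ≠ k) (hw : w ∈ X)
    (hx' : x' ∉ X) (hwA : w ∉ A j) :
    ∃ X' W', w ∈ X' ∧ X' ⊆ X ∧ G.Ex2 S A z k x0 j X' h W' := by
  have hhc : h ∈ G.cut S X := hh.mem_cut.2 ⟨hhS, Or.inl ⟨hw, hx'⟩⟩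
  by_cases hgh : g = h
  · subst hgh; exact ⟨X, W, hw, subset_rfl, hx⟩
  have hhΦ : h ∈ G.cut S X \ {k, g} := ⟨hhc, by simp [hhk, Ne.symm hgh]⟩
  obtain ⟨e, he, a, ha, v, hv, hj⟩ := hx.cov.first hhΦ (by rw [inn_eq hh hw hx']; exact hwA)
  have hei := hx.cov.ins h hhΦ e he
  have hkc : k ∈ G.cut S X → True := fun _ => trivial
  have hsub : S \ {k, h} ⊆ S := Set.sdiff_subset
  have hkc' : ∀ f ∈ G.cut S X \ {k, g, h}, f ∈ G.cut S X \ {k, g} := by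
    rintro f ⟨h1, h2⟩
    refine ⟨h1, fun h3 => h2 ?_⟩
    rcases h3 with h3 | h3
    · exact Or.inl h3
    · exact Or.inr (Or.inl h3)
  have hkcut : k ∉ G.ins S X := fun h => by
    have := hk.mem_ins.1 h
    exact hx.adm.nz this.2.1
  have hhins : h ∉ G.ins S X := fun h => hx' (hh.mem_ins.1 h).2.2
  have hins2 : ∀ e ∈ G.ins S X, e ∈ S \ {k, h} := by
    intro e he
    refine ⟨he.1, ?_⟩
    rintro (h1 | h1)
    · exact hkcut (h1 ▸ he)
    · exact hhins (Set.mem_singleton_iff.1 h1 ▸ he)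
  have hc2 : G.Cov (S \ {k, h}) (A j) X (G.cut S X \ {k, g, h}) W := by
    refine (hx.cov.mono hkc').chg ?_
    intro f hf
    refine ⟨⟨⟨rfl, rfl⟩, hf.1.1, ?_⟩, ?_⟩
    · have := hf.2; simp at this ⊢; tauto
    · intro e he
      exact ⟨⟨rfl, rfl⟩, hins2 e (hx.cov.ins f (hkc' f hf) e he)⟩
  rcases residual hc2 hx.adm.sub ha hj ⟨hins2 e hei, hei.2⟩ (by
      intro f hf hef
      have := hx.cov.dj h hhΦ f (hkc' f hf) e he hef
      have h2 := hf.2; simp at h2; exact h2.2.2 this.symm) with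
    ⟨q, hq, hqn, W', h'⟩ | ⟨X', W', h1, h2, h3, h4⟩
  · have hqg : q = g := by
      by_contra hn
      apply hqn
      refine ⟨⟨hq.1.1, hq.2⟩, ?_⟩
      have := hq.1.2; simp at this ⊢; tauto
    subst hqg
    refine ⟨X, W', hw, subset_rfl, hx.adm, hx.x0m, hhc, hhk, ?_⟩
    refine (h'.monoS hsub).mono ?_
    rintro f ⟨hf, hn⟩
    by_cases hfq : f = q
    · exact Or.inl hfq
    · refine Or.inr ⟨hf, ?_⟩
      simp at hn ⊢; tauto
  · have hX' := hx.adm.subset h1 h2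
    have h5 : G.Cov S (A j) X' (G.cut S X' \ {k, h}) W' := by
      refine (h4.monoS hsub).mono ?_
      rintro f ⟨hf, hn⟩
      exact ⟨⟨hf.1, hn⟩, hf.2⟩
    have hec : e ∈ G.cut S (A j) := hj.mem_cut.2 ⟨hei.1, Or.inl ⟨ha, hv⟩⟩
    have hei' : e ∈ G.ins S X' := hj.mem_ins.2 ⟨hei.1, h1 ha, h3⟩
    by_cases hkX : k ∈ G.cut S X'
    · by_cases hhX : h ∈ G.cut S X'
      · have a1 := hk.mem_cut.1 hkX
        have a2 := hX'.nz
        have a3 := hh.mem_cut.1 hhX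
        have a4 : x' ∉ X' := fun h => hx' (h2 h)
        exact ⟨X', W', by tauto, h2, hX', by tauto, hhX, hhk, h5⟩
      · exfalso
        refine hL.one hP hX' (k := k) (h5.mono ?_) hec hei'
        rintro f ⟨hf, hn⟩
        refine ⟨hf, ?_⟩
        rintro (h6 | h6)
        · exact hn h6
        · exact hhX (Set.mem_singleton_iff.1 h6 ▸ hf)
    · exfalso
      refine hL.one hP hX' (k := h) (h5.mono ?_) hec hei'
      rintro f ⟨hf, hn⟩
      refine ⟨hf, ?_⟩
      rintro (h6 | h6)
      · exact hkX (h6 ▸ hf)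
      · exact hn h6

/-- the connecting trail -/
theorem Ex2.trail {k : E} {x0 w x' : V} {j : ι} {h : E} {W : E → List E}
    (hL : G.Loose S A z) (hP : G.Par S (Tm A z)) (hk : G.Jn k z x0) (hkS : k ∈ S)
    (hx : G.Ex2 S A z k x0 j X h W) (hh : G.Jn h w x') (hw : w ∈ X)
    (hx' : x' ∉ X) (hx0A : x0 ∉ A j) :
    ∃ ρ, G.Wlk x0 ρ w ∧ ρ.Nodup ∧ (∀ e ∈ ρ, e ∈ G.Un S X (G.cut S X \ {k, h}) W) ∧
      ∀ e ∈ ρ, G.Av (Tm A z) e := by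
  have hkc : k ∈ G.cut S X := hk.mem_cut.2 ⟨hkS, Or.inr ⟨hx.x0m, hx.adm.nz⟩⟩
  have hik : G.inn X k = x0 := inn_eq hk.symm hx.x0m hx.adm.nz
  have hih : G.inn X h = w := inn_eq hh hw hx'
  have hr : G.Reach (G.Un S X (G.cut S X \ {k, h}) W) x0 w := by
    by_contra hr
    obtain ⟨W', h'⟩ := proc_two (hx.adm.par hP) hkc hx.gm hx.ne.symm hx.cov (by rwa [hik, hih])
    exact hL.no_cover hP hx.adm (k := h) (h'.mono Set.sdiff_subset) hkc hx.ne.symm (by rwa [hik])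
  obtain ⟨ρ, h1, h2, h3⟩ := hr.trail
  refine ⟨ρ, h1, h2, h3, ?_⟩
  intro e he
  have hav : G.Av (A j) e := by
    by_contra hn
    obtain ⟨l1, l2, c, e1, e2, e3⟩ := vis_of_mem h1 he hn
    obtain ⟨W', -, h'⟩ := hx.cov.direct (by
      rintro f (rfl | hf)
      · exact hkc
      · rw [Set.mem_singleton_iff.1 hf]; exact hx.gm) (m := k) (Or.inl rfl) (a := c) e3
      (by rw [hik]; exact ⟨l1, e2, fun e he => h3 e (by rw [e1]; simp [he])⟩)
    refine hL.no_cover hP hx.adm (k := h) (h'.mono ?_) hkc hx.ne.symm (by rwa [hik])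
    rintro f ⟨hf, hn⟩
    refine ⟨hf, ?_⟩
    rintro ⟨h4 | h4, h5⟩
    · exact h5 h4
    · exact hn h4
  have hi := (h3 e he).1
  exact ⟨hx.adm.not_Tm hi.2.1 hav.1, hx.adm.not_Tm hi.2.2 hav.2⟩

end Gr
end LC

namespace LC
namespace Gr
variable {V : Type u} {E : Type v} {ι : Type w} {G G' : Gr V E} {S S' S1 P P' : Set E}
  {X X0 Y : Set V} {A : ι → Set V} {z : V}

open Classical in
/-- enlarge an exceptional set to a maximal one -/
theorem Ex2.extend {k : E} {x0 w x' : V} {j : ι} {h : E} {W : E → List E}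
    (hL : G.Loose S A z) (hP : G.Par S (Tm A z)) (hD : Dis A z) (hk : G.Jn k z x0) (hkS : k ∈ S)
    (hx : G.Ex2 S A z k x0 j X h W) (hh : G.Jn h w x') (hw : w ∈ X)
    (hx' : x' ∉ X) (hx0A : x0 ∉ A j) {ρ : List E} (hρ : G.Wlk x0 ρ w)
    (hnd : ρ.Nodup) (hun : ∀ e ∈ ρ, e ∈ G.Un S X (G.cut S X \ {k, h}) W) :
    ∃ X1 W1, X ⊆ X1 ∧ x' ∉ X1 ∧ G.Ex2 S A z k x0 j X1 h W1 ∧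
      (G.reEnd k z x').TL (S \ {e | e ∈ ρ ++ [h]}) (A j) X1 W1 ∧
      Dis (Function.update A j X1) z ∧
      (G.reEnd k z x').Loose (S \ {e | e ∈ ρ ++ [h]}) (Function.update A j X1) z := by
  have hz := hx.adm.nz
  set G1 := G.reEnd k z x' with hG1
  set S1 := S \ {e | e ∈ ρ ++ [h]} with hS1
  have hS1S : S1 ⊆ S := Set.sdiff_subset
  have mS1 : ∀ e, e ∈ S1 ↔ e ∈ S ∧ e ∉ ρ ∧ e ≠ h := by
    intro e; simp [hS1]
  have hhX : h ∉ G.ins S X := fun h' => ins_not_cut h' hx.gm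
  have hkc : k ∈ G.cut S X := hk.mem_cut.2 ⟨hkS, Or.inr ⟨hx.x0m, hz⟩⟩
  have hkX : k ∉ G.ins S X := fun h' => ins_not_cut h' hkc
  have hρX : ∀ e ∈ ρ, e ∈ G.ins S X := fun e he => (hun e he).1
  have hhS : h ∈ S := hx.gm.1
  have hhρ : h ∉ ρ := fun h' => hhX (hρX _ h')
  have hkρ : k ∉ ρ := fun h' => hkX (hρX _ h')
  have hkS1 : k ∈ S1 := (mS1 k).2 ⟨hkS, hkρ, hx.ne.symm⟩
  have hk1 : ∀ Z, z ∉ Z → (k ∈ G1.cut S1 Z ↔ x' ∈ Z) := by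
    intro Z hZ
    rw [hG1, reEnd_jn.mem_cut]
    tauto
  -- cuts of sets containing X
  have hcut : ∀ Z, X ⊆ Z → z ∉ Z → ∀ f, f ≠ k → (f ∈ G1.cut S1 Z ↔ f ∈ G.cut S Z ∧ f ≠ h) := by
    intro Z hXZ hZ f hfk
    rw [hG1, cut_back hfk]
    constructor
    · intro hf
      exact ⟨cut_mono hS1S hf, ((mS1 f).1 hf.1).2.2⟩
    · rintro ⟨h1, h2⟩
      refine ⟨(mS1 f).2 ⟨h1.1, ?_, h2⟩, h1.2⟩
      intro h3
      exact ins_not_cut (ins_mono subset_rfl hXZ (hρX f h3)) h1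
  have h0 : G1.Cov S1 (A j) X (G1.cut S1 X) W := by
    have hsub : G1.cut S1 X ⊆ G.cut S X \ {k, h} := by
      intro f hf
      have hfk : f ≠ k := by
        rintro rfl
        exact hx' ((hk1 X hz).1 hf)
      have := (hcut X subset_rfl hz f hfk).1 hf
      exact ⟨this.1, by simp [hfk, this.2]⟩
    refine (hx.cov.mono hsub).chg ?_
    intro f hf
    have hfk : f ≠ k := fun h' => (hsub hf).2 (Or.inl h')
    refine ⟨⟨reEnd_agr hfk, hf.1⟩, ?_⟩
    intro e he
    have hei := hx.cov.ins f (hsub hf) e he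
    refine ⟨reEnd_agr (fun h' => hkX (h' ▸ hei)), (mS1 e).2 ⟨hei.1, ?_, fun h' => hhX (h' ▸ hei)⟩⟩
    intro h'
    exact (hun e h').2 f (hsub hf) he
  obtain ⟨Xz, Wz, z1, z2, z3, z4, z5⟩ := zorn_waves G1 S1 (fun _ : Unit => X) (Ot A z j)
    (fun i j hij => (hij rfl).elim) (fun _ => hx.adm.dj)
  obtain ⟨X1, hX1⟩ : ∃ X1, X1 = Xz () := ⟨_, rfl⟩
  have y1 : X ⊆ X1 := hX1 ▸ z1 ()
  have y3 := z3 ()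
  have y4 := z4 ()
  rw [← hX1] at y3 y4
  have y5 : ∀ Z Wz, X1 ⊆ Z → Disjoint Z (Ot A z j) → G1.Cov S1 X1 Z (G1.cut S1 Z) Wz → Z = X1 := by
    intro Z Wz h1 h2 h3
    rw [hX1] at h1 h3 ⊢
    exact z5 () Z Wz h1 h2 (fun i hi => (hi rfl).elim) h3
  have hadm : Adm A z j X1 := ⟨hx.adm.sub.trans y1, y3⟩
  have hz1 := hadm.nz
  obtain ⟨Wc, hWc, -, -⟩ := h0.comp y4 subset_rfl y1 subset_rfl
  obtain ⟨W1, hW1, htr, -⟩ := hWc.trim hadm.sub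
  have hback : ∀ f, f ∈ G.cut S X1 \ {k, h} → f ∈ G1.cut S1 X1 := by
    rintro f ⟨hf, hn⟩
    simp only [Set.mem_insert_iff, Set.mem_singleton_iff, not_or] at hn
    exact (hcut X1 y1 hz1 f hn.1).2 ⟨hf, hn.2⟩
  have hcovG : G.Cov S (A j) X1 (G.cut S X1 \ {k, h}) W1 :=
    cov_back hW1 hz1 hS1S (by simp) hback
  have hx0X1 : x0 ∈ X1 := y1 hx.x0m
  have hkX1 : k ∈ G.cut S X1 := hk.mem_cut.2 ⟨hkS, Or.inr ⟨hx0X1, hz1⟩⟩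
  have hxn : x' ∉ X1 := by
    intro hin
    have hkc1 := (hk1 X1 hz1).2 hin
    obtain ⟨a, ha, hwk⟩ := hW1.st' hkc1
    rw [inn_eq reEnd_jn.symm hin hz1] at hwk
    have hkW : ∀ e ∈ W1 k, e ∈ S1 ∧ e ≠ k ∧ e ∈ G.ins S X1 := by
      intro e he
      have h := hW1.ins k hkc1 e he
      have : e ≠ k := by
        rintro rfl
        have := reEnd_jn.mem_ins.1 h
        exact hz1 this.2.1
      exact ⟨h.1, this, ins_mono hS1S subset_rfl ((ins_back this).1 h)⟩
    have hw' : G.Wlk a (W1 k) x' := hwk.chg (fun e he => (reEnd_agr (hkW e he).2.1).symm)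
    have hcov := hcovG.add (m := k) hkX1 (l := W1 k ++ h :: ρ.reverse) ha
      (by rw [inn_eq hk.symm hx0X1 hz1]; exact hw'.append ⟨w, hh.symm, hρ.reverse⟩)
      (by
        rw [List.nodup_append]
        refine ⟨hW1.nd k hkc1, by simp [hhρ, hnd], ?_⟩
        intro x hx y hy
        have h1 := (mS1 x).1 (hkW x hx).1
        simp only [List.mem_cons, List.mem_reverse] at hy
        rintro rfl
        tauto)
      (by
        intro e he
        simp only [List.mem_append, List.mem_cons, List.mem_reverse] at he
        rcases he with he | rfl | he
        · exact (hkW e he).2.2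
        · exact hh.mem_ins.2 ⟨hhS, y1 hw, hin⟩
        · exact ins_mono subset_rfl y1 (hρX e he))
      (by
        intro e he g hg hgk heg
        have hgc := hback g hg
        have h1 := (mS1 e).1 (hW1.ins g hgc e heg).1
        simp only [List.mem_append, List.mem_cons, List.mem_reverse] at he
        rcases he with he | he
        · exact hgk (hW1.dj k hkc1 g hgc e he heg).symm
        · tauto)
    refine hL.no_cover hP hadm (k := h) (hcov.mono ?_) hkX1 hx.ne.symm
      (by rwa [inn_eq hk.symm hx0X1 hz1])
    rintro f ⟨hf, hn⟩
    by_cases hfk : f = k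
    · exact Or.inl hfk
    · exact Or.inr ⟨hf, by simp [hfk]; exact hn⟩
  have hhX1 : h ∈ G.cut S X1 := hh.mem_cut.2 ⟨hhS, Or.inl ⟨y1 hw, hxn⟩⟩
  have hdis : Dis (Function.update A j X1) z := by
    constructor
    · intro i i' hii
      by_cases hi : i = j
      · subst hi
        rw [Function.update_self, Function.update_of_ne hii.symm]
        exact Set.disjoint_left.2 fun x hx => hadm.other hii.symm hx
      · by_cases hi' : i' = j
        · subst hi'
          rw [Function.update_self, Function.update_of_ne hii]
          exact Set.disjoint_right.2 fun x hx => hadm.other hii hx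
        · rw [Function.update_of_ne hi, Function.update_of_ne hi']
          exact hD.dj i i' hii
    · intro i
      by_cases hi : i = j
      · subst hi; rw [Function.update_self]; exact hz1
      · rw [Function.update_of_ne hi]; exact hD.nz i
  refine ⟨X1, W1, y1, hxn, ⟨hadm, hx0X1, hhX1, hx.ne, hcovG⟩, ⟨hadm.sub, hW1, htr, ?_⟩, hdis, ?_⟩
  · intro e he hei
    have hek : e ≠ k := by
      rintro rfl
      have := reEnd_jn.mem_ins.1 hei
      exact hz1 this.2.1
    obtain ⟨f, hf, hef⟩ := hL.nf hP hadm hcovG (cut_mono hS1S ((cut_back hek).1 he))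
      (ins_mono hS1S subset_rfl ((ins_back hek).1 hei))
    exact ⟨f, hback f hf, hef⟩
  · intro i Z WZ hZ hc e he hei
    have hzZ := hZ.nz
    by_cases hij : i = j
    · subst hij
      rw [Function.update_self] at hc he
      have hs : X1 ⊆ Z := by have := hZ.sub; rwa [Function.update_self] at this
      have : Z = X1 := by
        refine y5 Z WZ hs (Set.disjoint_left.2 ?_) hc
        rintro x hxZ (rfl | ⟨i', hi', hxi⟩)
        · exact hzZ hxZ
        · apply hZ.other hi' hxZ; rwa [Function.update_of_ne hi']
      rw [this] at hei
      exact ins_not_cut hei he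
    · rw [Function.update_of_ne hij] at hc he
      have hZX : ∀ x ∈ Z, x ∉ X1 := by
        intro x hx
        have := hZ.other (i := j) (Ne.symm hij) hx
        rwa [Function.update_self] at this
      have hZ' : Adm A z i Z := by
        refine Adm.intro ?_ hzZ ?_
        · have := hZ.sub; rwa [Function.update_of_ne hij] at this
        · intro i' hi' x hxZ hxi
          by_cases hj' : i' = j
          · subst hj'
            exact hZX x hxZ (hadm.sub hxi)
          · apply hZ.other hi' hxZ; rwa [Function.update_of_ne hj']
      have hek : e ≠ k := by
        rintro rfl
        have := reEnd_jn.mem_ins.1 hei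
        exact hzZ this.2.1
      have he' : e ∈ G.cut S (A i) := cut_mono hS1S ((cut_back hek).1 he)
      have hei' : e ∈ G.ins S Z := ins_mono hS1S subset_rfl ((ins_back hek).1 hei)
      have hkZ : k ∉ G.cut S Z := by
        rw [hk.mem_cut]
        have : x0 ∉ Z := fun h => hZX x0 h hx0X1
        tauto
      have hhZ : h ∈ G.cut S Z ↔ x' ∈ Z := by
        rw [hh.mem_cut]
        have : w ∉ Z := fun h => hZX w h (y1 hw)
        tauto
      have hbk : ∀ f, f ∈ G.cut S Z → f ≠ h → f ∈ G1.cut S1 Z := by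
        intro f hf hfh
        have hfk : f ≠ k := fun h => hkZ (h ▸ hf)
        rw [hG1, cut_back hfk]
        refine ⟨(mS1 f).2 ⟨hf.1, ?_, hfh⟩, hf.2⟩
        intro hfρ
        have h1 := hρX f hfρ
        have : G.Av Z f := ⟨fun h => hZX _ h (y1 h1.2.1), fun h => hZX _ h (y1 h1.2.2)⟩
        exact this.not_cut hf
      have hbase : G.Cov S (A i) Z (G.cut S Z \ {h}) WZ :=
        cov_back hc hzZ hS1S (fun h => hkZ h.1) (fun f hf => hbk f hf.1 hf.2)
      by_cases hin : x' ∈ Z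
      · have hkc1 := (hk1 Z hzZ).2 hin
        obtain ⟨a, ha, hwk⟩ := hc.st' hkc1
        rw [inn_eq reEnd_jn.symm hin hzZ] at hwk
        have hkW : ∀ e ∈ WZ k, e ∈ S1 ∧ e ≠ k ∧ e ∈ G.ins S Z := by
          intro e he
          have h := hc.ins k hkc1 e he
          have : e ≠ k := by
            rintro rfl
            have := reEnd_jn.mem_ins.1 h
            exact hzZ this.2.1
          exact ⟨h.1, this, ins_mono hS1S subset_rfl ((ins_back this).1 h)⟩
        have hw' : G.Wlk a (WZ k) x' := hwk.chg (fun e he => (reEnd_agr (hkW e he).2.1).symm)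
        have hcov := hbase.add (m := h) (hhZ.2 hin) (l := WZ k) ha
          (by rw [inn_eq hh.symm hin (fun h => hZX w h (y1 hw))]; exact hw')
          (hc.nd k hkc1) (fun e he => (hkW e he).2.2)
          (by
            intro e he g hg hgk heg
            have := hc.dj k hkc1 g (hbk g hg.1 hgk) e he heg
            exact hkZ (this ▸ hg.1))
        refine hL i Z _ hZ' (hcov.mono ?_) e he' hei'
        intro f hf
        by_cases hfh : f = h
        · exact Or.inl hfh
        · exact Or.inr ⟨hf, hfh⟩
      · refine hL i Z _ hZ' (hbase.mono ?_) e he' hei'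
        intro f hf
        refine ⟨hf, ?_⟩
        rintro rfl
        exact hin (hhZ.1 hf)

end Gr
end LC

namespace LC
namespace Gr
variable {V : Type u} {E : Type v} {ι : Type w} {G G' : Gr V E} {S S' S1 P P' : Set E}
  {X X0 Y : Set V} {A : ι → Set V} {z : V}

theorem Wlk.av_end {a b : V} {l : List E} (h : G.Wlk a l b) (hl : ∀ e ∈ l, G.Av Y e) (ha : a ∉ Y) :
    b ∉ Y := by
  induction l generalizing a with
  | nil => exact h ▸ ha
  | cons e l ih =>
    obtain ⟨c, hc, h⟩ := h
    exact ih h (fun e' he' => hl e' (by simp [he'])) (hc.av.1 (hl e (by simp))).2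

theorem Loose.loop {k : E} (hL : G.Loose S A z) (hk : G.Jn k z z) : G.Loose (S \ {k}) A z := by
  intro j X W hX hc e he hei
  refine hL j X W hX ((hc.monoS Set.sdiff_subset).mono ?_) e (cut_mono Set.sdiff_subset he)
      (ins_mono Set.sdiff_subset subset_rfl hei)
  intro f hf
  refine ⟨⟨hf.1, ?_⟩, hf.2⟩
  rintro rfl
  have := hk.mem_cut.1 hf; have := hX.nz; tauto

theorem Par.anti {T T' : Set V} (h : G.Par S T) (hT : T ⊆ T') : G.Par S T' :=
  fun U hU => h U (hU.mono_right hT)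

theorem Av.ne_of_jn {k e : E} {a b : V} (h : G.Av Y e) (hk : G.Jn k a b) (ha : a ∈ Y) : e ≠ k := by
  rintro rfl
  exact (hk.av.1 h).1 ha

open Classical in
theorem strong_lemma {o : E} {xn : V} (n : ℕ) : ∀ (G : Gr V E) (S : Set E) (A : ι → Set V)
    (k : E) (x0 : V) (π : List E), π.length = n → Dis A z → G.Loose S A z → G.Par S (Tm A z) →
    k ∈ S → o ∈ S → k ≠ o → G.Jn k z x0 → G.Jn o z xn → x0 ∉ Tm A z → G.Wlk x0 π xn → π.Nodup →
    (∀ e ∈ π, e ∈ S ∧ G.Av (Tm A z) e) →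
    ∃ l, l.Nodup ∧ G.Wlk x0 l xn ∧ (∀ e ∈ l, e ∈ S ∧ G.Av (Tm A z) e) ∧
      G.Res (S \ ({e | e ∈ l} ∪ {k, o})) A z := by
  induction n using Nat.strong_induction_on with
  | _ n ih =>
  intro G S A k x0 π hn hD hL hP hkS hoS hko hk ho hx0 hπ hπn hπS
  have hzT : z ∈ Tm A z := Or.inl rfl
  by_cases hex : ∃ j X g W, G.Ex2 S A z k x0 j X g W
  swap
  · push Not at hex
    cases π with
    | nil =>
      refine ⟨[], by simp, hπ, by simp, A, fun _ _ => [], fun i => TL.triv _ _ _, hD, ?_⟩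
      have : (S \ ({e | e ∈ ([] : List E)} ∪ {k, o})) = S \ {k, o} := by simp
      rw [this]
      have hπ' : x0 = xn := hπ
      subst hπ'
      exact loose_base hL hk ho hoS hko hex
    | cons f π' =>
      obtain ⟨x1, hf, hπ'⟩ := hπ
      obtain ⟨hfS, hfav⟩ := hπS f (by simp)
      have hfk : f ≠ k := hfav.ne_of_jn hk hzT
      have hfo : f ≠ o := hfav.ne_of_jn ho hzT
      have hx1 : x1 ∉ Tm A z := (hf.av.1 hfav).2
      obtain ⟨hfπ, hπn'⟩ := List.nodup_cons.1 hπn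
      have hL' := loose_step hL hk hkS hf hfS hfk hx1 hex
      have hset : S \ {e | e ∈ [f]} = S \ {f} := by ext; simp
      have hP' := Par.replace hP (k := k) (l := [f]) (x := x1) ⟨x0, hk, x1, hf, rfl⟩
        (by simp [hfk.symm]) (by simp [hkS, hfS])
      rw [hset] at hP'
      have hne : ∀ e ∈ π', e ≠ k := fun e he => (hπS e (by simp [he])).2.ne_of_jn hk hzT
      obtain ⟨l, l1, l2, l3, l4⟩ := ih π'.length (by simp at hn; omega) (G.reEnd k z x1) (S \ {f}) A k
        x1 π' rfl hD hL' hP' ⟨hkS, hfk.symm⟩ ⟨hoS, hfo.symm⟩ hko reEnd_jn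
        ((reEnd_agr hko.symm).jn.2 ho) hx1 (hπ'.chg fun e he => reEnd_agr (hne e he)) hπn' (by
          intro e he
          refine ⟨⟨(hπS e (by simp [he])).1, ?_⟩, (reEnd_agr (hne e he)).av.2 (hπS e (by simp [he])).2⟩
          rintro rfl; exact hfπ he)
      have hlk : ∀ e ∈ l, e ≠ k := fun e he => (l3 e he).2.ne_of_jn reEnd_jn hzT
      refine ⟨f :: l, List.nodup_cons.2 ⟨fun h => (l3 f h).1.2 rfl, l1⟩,
        ⟨x1, hf, l2.chg fun e he => (reEnd_agr (hlk e he)).symm⟩, ?_, ?_⟩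
      · intro e he
        rcases List.mem_cons.1 he with rfl | he
        · exact ⟨hfS, hfav⟩
        · exact ⟨(l3 e he).1.1, (reEnd_agr (hlk e he)).av.1 (l3 e he).2⟩
      · have hset2 : (S \ {f}) \ ({e | e ∈ l} ∪ {k, o}) = S \ ({e | e ∈ f :: l} ∪ {k, o}) := by
          ext e; simp; tauto
        rw [hset2] at l4
        refine l4.chg fun e he => (reEnd_agr ?_).symm
        rintro rfl
        exact he.2 (Or.inr (Or.inl rfl))
  · -- exceptional sets exist
    have hQ : ∃ m, ∃ j X g W π1 π2 w, G.Ex2 S A z k x0 j X g W ∧ π = π1 ++ π2 ∧ G.Wlk x0 π1 w ∧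
        w ∈ X ∧ π2.length = m := by
      obtain ⟨j, X, g, W, h⟩ := hex
      exact ⟨_, j, X, g, W, [], π, x0, h, rfl, rfl, h.x0m, rfl⟩
    obtain ⟨j, X, g, W, π1, π2, w, hE, hsp, hw1, hwX, hlen⟩ := Nat.find_spec hQ
    have hmin : ∀ j X g W π1' π2' w, G.Ex2 S A z k x0 j X g W → π = π1' ++ π2' → G.Wlk x0 π1' w →
        w ∈ X → π2.length ≤ π2'.length := by
      intro j X g W π1' π2' w h1 h2 h3 h4
      rw [hlen]
      exact Nat.find_min' hQ ⟨j, X, g, W, π1', π2', w, h1, h2, h3, h4, rfl⟩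
    clear hlen hQ
    have hw2 : G.Wlk w π2 xn := (hsp ▸ hπ).split_at hw1
    have hwT : w ∉ Tm A z := hw1.av_end (fun e he => (hπS e (by rw [hsp]; simp [he])).2) hx0
    have hTA : ∀ {x i}, x ∉ Tm A z → x ∉ A i := fun h h' => h (mem_Tm_of h')
    cases π2 with
    | nil =>
      have hwn : w = xn := hw2
      subst hwn
      obtain ⟨X', W', hwX', hXpX, hE'⟩ := hE.convert hL hP hk ho.symm hoS hko.symm hwX hE.adm.nz (hTA hwT)
      have hz' := hE'.adm.nz
      obtain ⟨ρ, r1, r2, r3, r4⟩ := hE'.trail hL hP hk hkS ho.symm hwX' hz' (hTA hx0)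
      obtain ⟨X1, W1, y1, y2, y3, y4, y5, y6⟩ := hE'.extend hL hP hD hk hkS ho.symm hwX' hz' (hTA hx0) r1 r2 r3
      refine ⟨ρ, r2, r1, fun e he => ⟨(r3 e he).1.1, r4 e he⟩, ?_⟩
      have hset : (S \ {e | e ∈ ρ ++ [o]}) \ {k} = S \ ({e | e ∈ ρ} ∪ {k, o}) := by
        ext e; simp; tauto
      have hagr : ∀ e ∈ S \ ({e | e ∈ ρ} ∪ {k, o}), Agr (G.reEnd k z z) G e := by
        intro e he
        refine (reEnd_agr ?_).symm
        rintro rfl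
        exact he.2 (Or.inr (Or.inl rfl))
      have hsub : S \ ({e | e ∈ ρ} ∪ {k, o}) ⊆ S \ {e | e ∈ ρ ++ [o]} := by
        rw [← hset]; exact Set.sdiff_subset
      refine ⟨Function.update A j X1, fun i => if i = j then W1 else fun _ => [], ?_, y5, ?_⟩
      · intro i
        by_cases hij : i = j
        · subst hij
          simp only [if_true, Function.update_self]
          refine y4.chg hsub hagr ?_ ?_
          · intro f hf hfS e he
            have hei := y4.cov.ins f hf e he
            rw [← hset]
            refine ⟨hei.1, ?_⟩
            rintro rfl
            exact y3.adm.nz (reEnd_jn.mem_ins.1 hei).2.1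
          · intro f hf hfS
            exfalso
            rw [← hset] at hfS
            have : f = k := by
              by_contra hn
              exact hfS ⟨hf.1, hn⟩
            subst this
            have := reEnd_jn.mem_cut.1 hf
            tauto
        · simp only [hij, if_false, ne_eq, not_false_eq_true, Function.update_of_ne]
          exact TL.triv _ _ _
      · have := y6.loop (k := k) reEnd_jn
        rw [hset] at this
        exact this.chg hagr
    | cons h π3 =>
      obtain ⟨x', hh, hw3⟩ := hw2
      have hhπ : h ∈ π := by rw [hsp]; simp
      obtain ⟨hhS, hhav⟩ := hπS h hhπ
      have hhk : h ≠ k := hhav.ne_of_jn hk hzT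
      have hho : h ≠ o := hhav.ne_of_jn ho hzT
      have hx'T : x' ∉ Tm A z := (hh.av.1 hhav).2
      have hxpX : x' ∉ X := by
        intro hin
        have := hmin j X g W (π1 ++ [h]) π3 x' hE (by rw [hsp]; simp) (hw1.append (Wlk.single hh)) hin
        simp at this
      obtain ⟨X', W', hwX', hXpX, hE'⟩ := hE.convert hL hP hk hh hhS hhk hwX hxpX (hTA hwT)
      have hxpXp : x' ∉ X' := fun h => hxpX (hXpX h)
      obtain ⟨ρ, r1, r2, r3, r4⟩ := hE'.trail hL hP hk hkS hh hwX' hxpXp (hTA hx0)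
      obtain ⟨X1, W1, y1, y2, y3, y4, y5, y6⟩ := hE'.extend hL hP hD hk hkS hh hwX' hxpXp (hTA hx0) r1 r2 r3
      have hρk : ∀ e ∈ ρ, e ≠ k := fun e he => (r4 e he).ne_of_jn hk hzT
      have hρo : ∀ e ∈ ρ, e ≠ o := fun e he => (r4 e he).ne_of_jn ho hzT
      have hρh : h ∉ ρ := fun h' => ins_not_cut (r3 h h').1 hE'.gm
      set S1 := S \ {e | e ∈ ρ ++ [h]} with hS1
      have mS1 : ∀ e, e ∈ S1 ↔ e ∈ S ∧ e ∉ ρ ∧ e ≠ h := by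
        intro e; simp [hS1]
      have hTmsub : Tm A z ⊆ Tm (Function.update A j X1) z := by
        rintro x (rfl | ⟨i, hi⟩)
        · exact Or.inl rfl
        · by_cases hij : i = j
          · subst hij
            exact Or.inr ⟨i, by rw [Function.update_self]; exact y3.adm.sub hi⟩
          · exact Or.inr ⟨i, by rwa [Function.update_of_ne hij]⟩
      have hTm2 : ∀ x, x ∈ Tm (Function.update A j X1) z ↔ x ∈ Tm A z ∨ x ∈ X1 := by
        intro x
        constructor
        · rintro (rfl | ⟨i, hi⟩)
          · exact Or.inl (Or.inl rfl)
          · by_cases hij : i = j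
            · subst hij
              rw [Function.update_self] at hi
              exact Or.inr hi
            · rw [Function.update_of_ne hij] at hi
              exact Or.inl (Or.inr ⟨i, hi⟩)
        · rintro (hx | hx)
          · exact hTmsub hx
          · exact Or.inr ⟨j, by rwa [Function.update_self]⟩
      have hP1 := (Par.replace hP (k := k) (l := ρ ++ [h]) (x := x')
        ⟨x0, hk, r1.append (Wlk.single hh)⟩
        (by
          rw [List.nodup_cons, List.nodup_append]
          refine ⟨?_, r2, by simp, ?_⟩
          · simp only [List.mem_append, List.mem_singleton, not_or]
            exact ⟨fun h => hρk k h rfl, hhk.symm⟩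
          · intro a ha b hb
            rw [List.mem_singleton] at hb
            rw [hb]
            rintro rfl
            exact hρh ha)
        (by
          intro e he
          simp only [List.mem_cons, List.mem_append, List.not_mem_nil, or_false] at he
          rcases he with rfl | he | rfl
          · exact hkS
          · exact (r3 e he).1.1
          · exact hhS)).anti hTmsub
      have hav3 : ∀ e ∈ π3, G.Av X1 e := by
        intro e he
        by_contra hn
        obtain ⟨a, b, c, c1, c2, c3⟩ := vis_of_mem hw3 he hn
        have := hmin j X1 h W1 (π1 ++ h :: a) b c y3 (by rw [hsp, c1]; simp)
          (hw1.append ⟨x', hh, c2⟩) c3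
        simp [c1] at this
      have hπ3 : ∀ e ∈ π3, e ∈ π := fun e he => by rw [hsp]; simp [he]
      have h3k : ∀ e ∈ π3, e ≠ k := fun e he => (hπS e (hπ3 e he)).2.ne_of_jn hk hzT
      have hπn2 : (h :: π3).Nodup := (hsp ▸ hπn).of_append_right
      obtain ⟨l, l1, l2, l3, l4⟩ := ih π3.length
        (by rw [← hn, hsp]; simp; omega) (G.reEnd k z x') S1
        (Function.update A j X1) k x' π3 rfl y5 y6 hP1
        ((mS1 k).2 ⟨hkS, fun h => hρk k h rfl, hhk.symm⟩)
        ((mS1 o).2 ⟨hoS, fun h => hρo o h rfl, hho.symm⟩) hko reEnd_jn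
        ((reEnd_agr hko.symm).jn.2 ho) (by rw [hTm2]; tauto)
        (hw3.chg fun e he => reEnd_agr (h3k e he)) (List.nodup_cons.1 hπn2).2 (by
          intro e he
          refine ⟨(mS1 e).2 ⟨(hπS e (hπ3 e he)).1, ?_, ?_⟩, (reEnd_agr (h3k e he)).av.2 ?_⟩
          · intro heρ
            exact (hav3 e he).1 (y1 (r3 e heρ).1.2.1)
          · rintro rfl
            exact (List.nodup_cons.1 hπn2).1 he
          · have h1 := (hπS e (hπ3 e he)).2
            have h2 := hav3 e he
            exact ⟨by rw [hTm2]; exact not_or.2 ⟨h1.1, h2.1⟩,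
              by rw [hTm2]; exact not_or.2 ⟨h1.2, h2.2⟩⟩)
      have hzT2 : z ∈ Tm (Function.update A j X1) z := Or.inl rfl
      have hlk : ∀ e ∈ l, e ≠ k := fun e he => (l3 e he).2.ne_of_jn reEnd_jn hzT2
      have hlX1 : ∀ e ∈ l, (G.reEnd k z x').Av X1 e := fun e he =>
        (l3 e he).2.mono (fun x hx => (hTm2 x).2 (Or.inr hx))
      have hxnX1 : xn ∉ X1 := l2.av_end hlX1 y2
      refine ⟨ρ ++ h :: l, ?_, r1.append ⟨x', hh, l2.chg fun e he => (reEnd_agr (hlk e he)).symm⟩, ?_, ?_⟩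
      · rw [List.nodup_append]
        refine ⟨r2, List.nodup_cons.2 ⟨fun h' => ((mS1 h).1 (l3 h h').1).2.2 rfl, l1⟩, ?_⟩
        intro a ha b hb
        rintro rfl
        rcases List.mem_cons.1 hb with rfl | hb
        · exact hρh ha
        · exact ((mS1 a).1 (l3 a hb).1).2.1 ha
      · intro e he
        simp only [List.mem_append, List.mem_cons] at he
        rcases he with he | rfl | he
        · exact ⟨(r3 e he).1.1, r4 e he⟩
        · exact ⟨hhS, hhav⟩
        · exact ⟨((mS1 e).1 (l3 e he).1).1, ((reEnd_agr (hlk e he)).av.1 (l3 e he).2).mono hTmsub⟩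
      · have hset2 : S1 \ ({e | e ∈ l} ∪ {k, o}) = S \ ({e | e ∈ ρ ++ h :: l} ∪ {k, o}) := by
          ext e; simp [hS1]; tauto
        rw [← hset2]
        have hres : (G.reEnd k z x').Res (S1 \ ({e | e ∈ l} ∪ {k, o})) A z := by
          refine Res.comp (W := fun i => if i = j then W1 else fun _ => []) ?_ l4
          intro i
          by_cases hij : i = j
          · subst hij
            simp only [if_true, Function.update_self]
            refine y4.chg Set.sdiff_subset (fun e _ => ⟨rfl, rfl⟩) ?_ ?_
            · intro f hf hfS e he
              have hei := y4.cov.ins f hf e he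
              refine ⟨hei.1, ?_⟩
              rintro (h1 | h1 | h1)
              · exact (hlX1 e h1).not_ins hei
              · subst h1
                exact y3.adm.nz (reEnd_jn.mem_ins.1 hei).2.1
              · rw [Set.mem_singleton_iff] at h1; subst h1
                exact y3.adm.nz (((reEnd_agr hko.symm).jn.2 ho).mem_ins.1 hei).2.1
            · intro f hf hfS
              exfalso
              have : f ∈ ({e | e ∈ l} ∪ {k, o} : Set E) := by
                by_contra hn
                exact hfS ⟨hf.1, hn⟩
              have hz1 := y3.adm.nz
              rcases this with h1 | h1 | h1
              · exact (hlX1 f h1).not_cut hf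
              · subst h1
                have := reEnd_jn.mem_cut.1 hf
                tauto
              · rw [Set.mem_singleton_iff] at h1; subst h1
                have := ((reEnd_agr hko.symm).jn.2 ho).mem_cut.1 hf
                tauto
          · simp only [hij, if_false, ne_eq, not_false_eq_true, Function.update_of_ne]
            exact TL.triv _ _ _
        refine hres.chg fun e he => (reEnd_agr ?_).symm
        rintro rfl
        exact he.2 (Or.inr (Or.inl rfl))

end Gr
end LC

namespace LC
namespace Gr
variable {V : Type u} {E : Type v} {ι : Type w} {G G' : Gr V E} {S S' S1 P P' : Set E}
  {X X0 Y : Set V} {A : ι → Set V} {z : V}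

/-- the paths we look for -/
def Good (G : Gr V E) (A : ι → Set V) (p : List E) : Prop :=
  ∃ i j a b, i ≠ j ∧ a ∈ A i ∧ b ∈ A j ∧ G.Wlk a p b ∧ p.Nodup ∧
    ∀ m, ∀ e ∈ p, e ∈ G.cut Set.univ (A m) → (m = i ∨ m = j) ∧
      ∀ e' ∈ p, e' ∈ G.cut Set.univ (A m) → e = e'

theorem Res.inside (h : G.Res S A z) (hS : S' ⊆ S)
    (hin : ∀ e ∈ S, e ∉ S' → ∃ m, e ∈ G.ins S (A m)) : G.Res S' A z := by
  obtain ⟨Y, W, h1, h2, h3⟩ := h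
  have hYY : ∀ {m m' : ι} {x : V}, x ∈ Y m → x ∈ Y m' → m = m' := by
    intro m m' x hx hx'
    by_contra hn
    exact Set.disjoint_left.1 (h2.dj m m' hn) hx hx'
  refine ⟨Y, W, ?_, h2, h3.inside hS ?_⟩
  · intro m
    refine (h1 m).chg hS (fun _ _ => ⟨rfl, rfl⟩) ?_ ?_
    · intro f hf hfS e he
      have hei := (h1 m).cov.ins f hf e he
      by_contra hn
      obtain ⟨m', hm'⟩ := hin e hei.1 hn
      have : m' = m := hYY ((h1 m').sub hm'.2.1) hei.2.1
      subst this
      rcases (h1 m').tr f hf with ⟨t1, t2⟩ | ⟨e0, l, t1, t2, t3, t4⟩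
      · simp [t1] at he
      · rw [t1] at he
        rcases List.mem_cons.1 he with rfl | he
        · exact ins_not_cut hm' t2
        · exact (t3 e he).not_ins hm'
    · intro f hf hfS
      exfalso
      obtain ⟨m', hm'⟩ := hin f hf.1 hfS
      obtain ⟨-, x, hx, y, hy, hj⟩ := mem_cut_iff.1 hf
      have h4 := hj.mem_ins.1 hm'
      have : m' = m := hYY ((h1 m').sub h4.2.1) hx
      subst this
      exact hy ((h1 m').sub h4.2.2)
  · intro e he hn
    obtain ⟨m, hm⟩ := hin e he hn
    exact ⟨m, ins_mono subset_rfl (h1 m).sub hm⟩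

theorem op_core {X : ι → Set V} {W : ι → E → List E} (hT : ∀ i, G.TL S (A i) (X i) (W i))
    (hX : Dis X z) {i l : ι} (hil : i ≠ l) {f o : E} (hf : f ∈ G.cut S (X i))
    (ho : o ∈ G.cut S (X l)) {p : List E} {a b : V} (ha : a ∈ A i) (hb : b ∈ A l)
    (hw : G.Wlk a p b) (hn : p.Nodup) (hpS : ∀ e ∈ p, e ∈ S) (hfp : f ∈ p) (hop : o ∈ p)
    (hWf : ∀ e ∈ W i f, e ∈ p) (hWo : ∀ e ∈ W l o, e ∈ p)
    (ci : ∀ e ∈ p, e ∈ W i f ∨ e = f ∨ G.Av (X i) e)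
    (cl : ∀ e ∈ p, e ∈ W l o ∨ e = o ∨ G.Av (X l) e)
    (cm : ∀ m, m ≠ i → m ≠ l → ∀ e ∈ p, G.Av (X m) e)
    (hR : G.Res (S \ {e | e ∈ p}) X z) :
    G.Good A p ∧ G.Res (S \ {e | e ∈ p}) A z := by
  constructor
  · refine ⟨i, l, a, b, hil, ha, hb, hw, hn, ?_⟩
    intro m e he hec
    have hS : ∀ e ∈ p, e ∈ G.cut Set.univ (A m) → e ∈ G.cut S (A m) := fun e he hec => ⟨hpS e he, hec.2⟩
    by_cases hmi : m = i
    · subst hmi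
      refine ⟨Or.inl rfl, fun e' he' hec' => ?_⟩
      have key : ∀ e ∈ p, e ∈ G.cut Set.univ (A m) → e ∈ W m f ∨ e = f := by
        intro e he hec
        rcases ci e he with h | h | h
        · exact Or.inl h
        · exact Or.inr h
        · exact ((h.mono (hT m).sub).not_cut hec).elim
      exact (hT m).tr.uniq hf (key e he hec) (key e' he' hec') (hS e he hec) (hS e' he' hec')
    by_cases hml : m = l
    · subst hml
      refine ⟨Or.inr rfl, fun e' he' hec' => ?_⟩
      have key : ∀ e ∈ p, e ∈ G.cut Set.univ (A m) → e ∈ W m o ∨ e = o := by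
        intro e he hec
        rcases cl e he with h | h | h
        · exact Or.inl h
        · exact Or.inr h
        · exact ((h.mono (hT m).sub).not_cut hec).elim
      exact (hT m).tr.uniq ho (key e he hec) (key e' he' hec') (hS e he hec) (hS e' he' hec')
    · exact ((cm m hmi hml e he).mono (hT m).sub).not_cut hec |>.elim
  · refine Res.comp (W := W) ?_ hR
    -- a one-index statement
    have one : ∀ m g, g ∈ G.cut S (X m) → g ∈ p → (∀ e ∈ W m g, e ∈ p) →
        (∀ e ∈ p, e ∈ W m g ∨ e = g ∨ G.Av (X m) e) →
        G.TL (S \ {e | e ∈ p}) (A m) (X m) (W m) := by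
      intro m g hg hgp hWg cg
      refine (hT m).chg Set.sdiff_subset (fun _ _ => ⟨rfl, rfl⟩) ?_ ?_
      · intro f' hf' hfS e he
        have hei := (hT m).cov.ins f' hf' e he
        refine ⟨hei.1, ?_⟩
        intro hep
        rcases cg e hep with h | h | h
        · have := (hT m).cov.dj f' hf' g hg e he h
          exact hfS.2 (this ▸ hgp)
        · subst h; exact ins_not_cut hei hg
        · exact h.not_ins hei
      · intro f' hf' hfS e he _ heS
        have hfp : f' ∈ p := by
          by_contra hn
          exact hfS ⟨hf'.1, hn⟩
        rcases cg f' hfp with h | h | h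
        · exact ins_not_cut ((hT m).cov.ins g hg f' h) hf'
        · subst h; exact heS.2 (hWg e he)
        · exact h.not_cut hf'
    intro m
    by_cases hmi : m = i
    · subst hmi; exact one m f hf hfp hWf ci
    by_cases hml : m = l
    · subst hml; exact one m o ho hop hWo cl
    · refine (hT m).chg Set.sdiff_subset (fun _ _ => ⟨rfl, rfl⟩) ?_ ?_
      · intro f' hf' hfS e he
        have hei := (hT m).cov.ins f' hf' e he
        exact ⟨hei.1, fun hep => (cm m hmi hml e hep).not_ins hei⟩
      · intro f' hf' hfS
        exfalso
        have hfp : f' ∈ p := by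
          by_contra hn
          exact hfS ⟨hf'.1, hn⟩
        exact (cm m hmi hml f' hfp).not_cut hf'

theorem loose_delete {X : ι → Set V} (hL : G.Loose S X z) {i l : ι} {f : E}
    {x y : V} (hf : G.Jn f x y) (hx : x ∈ X i) (hy : y ∈ X l) :
    G.Loose (S \ {f}) X z := by
  intro j Z W hZ hc e he hei
  have hs : S \ {f} ⊆ S := Set.sdiff_subset
  have hbase : G.Cov S (X j) Z (G.cut S Z \ {f}) W :=
    (hc.monoS hs).mono (fun g hg => ⟨⟨hg.1.1, hg.2⟩, hg.1.2⟩)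
  have hin : ∀ {v m}, v ∈ Z → v ∈ X m → v ∈ X j := by
    intro v m hv hm
    by_cases hmj : m = j
    · exact hmj ▸ hm
    · exact (hZ.other hmj hv hm).elim
  by_cases hfc : f ∈ G.cut S Z
  · have hi : G.inn Z f ∈ X j := by
      have := (hf.mem_cut.1 hfc).2
      rcases this with ⟨h1, h2⟩ | ⟨h1, h2⟩
      · rw [inn_eq hf h1 h2]; exact hin h1 hx
      · rw [inn_eq hf.symm h1 h2]; exact hin h1 hy
    have := hbase.add hfc (l := []) hi rfl (by simp) (by simp) (by simp)
    refine hL j Z _ hZ (this.mono ?_) e (cut_mono hs he) (ins_mono hs subset_rfl hei)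
    intro g hg
    by_cases h : g = f
    · exact Or.inl h
    · exact Or.inr ⟨hg, h⟩
  · refine hL j Z _ hZ (hbase.mono ?_) e (cut_mono hs he) (ins_mono hs subset_rfl hei)
    intro g hg
    exact ⟨hg, fun h => hfc (Set.mem_singleton_iff.1 h ▸ hg)⟩

theorem loose_reEnd {X : ι → Set V} (hL : G.Loose S X z) {i : ι} {f : E} (hfS : f ∈ S)
    {x y : V} (hf : G.Jn f x y) (hx : x ∈ X i) :
    (G.reEnd f z y).Loose S X z := by
  intro j Z W hZ hc e he hei
  have hz := hZ.nz
  have hef : e ≠ f := by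
    rintro rfl
    exact hz (reEnd_jn.mem_ins.1 hei).2.1
  have he' := (cut_back hef).1 he
  have hei' := (ins_back hef).1 hei
  have hbase : G.Cov S (X j) Z (G.cut S Z \ {f}) W :=
    cov_back hc hz subset_rfl (by simp) (fun g hg => (cut_back hg.2).2 hg.1)
  have hins : ∀ g, G.Cov S (X j) Z (insert f (G.cut S Z \ {f})) g → False := by
    intro g hg
    refine hL j Z _ hZ (hg.mono ?_) e he' hei'
    intro g hg
    by_cases h : g = f
    · exact Or.inl h
    · exact Or.inr ⟨hg, h⟩
  by_cases hfc : f ∈ G.cut S Z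
  · by_cases hxZ : x ∈ Z
    · have hxj : x ∈ X j := by
        by_cases hmj : i = j
        · exact hmj ▸ hx
        · exact (hZ.other hmj hxZ hx).elim
      have hyZ : y ∉ Z := by have := (hf.mem_cut.1 hfc).2; tauto
      exact hins _ (hbase.add hfc (l := []) hxj (inn_eq hf hxZ hyZ).symm (by simp) (by simp) (by simp))
    · have hyZ : y ∈ Z := by have := (hf.mem_cut.1 hfc).2; tauto
      have hfc' : f ∈ (G.reEnd f z y).cut S Z := reEnd_jn.mem_cut.2 ⟨hfS, Or.inr ⟨hyZ, hz⟩⟩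
      obtain ⟨a, ha, hw⟩ := hc.st' hfc'
      rw [inn_eq reEnd_jn.symm hyZ hz] at hw
      have hkW : ∀ e ∈ W f, e ≠ f ∧ e ∈ G.ins S Z := by
        intro e he
        have h := hc.ins f hfc' e he
        have : e ≠ f := by
          rintro rfl
          exact hz (reEnd_jn.mem_ins.1 h).2.1
        exact ⟨this, (ins_back this).1 h⟩
      refine hins _ (hbase.add hfc (l := W f) ha ?_ (hc.nd f hfc') (fun e he => (hkW e he).2) ?_)
      · rw [inn_eq hf.symm hyZ hxZ]
        exact hw.chg (fun e he => (reEnd_agr (hkW e he).1).symm)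
      · intro e he g hg hgf heg
        exact hgf (hc.dj f hfc' g ((cut_back hg.2).2 hg.1) e he heg).symm
  · refine hL j Z _ hZ (hbase.mono ?_) e he' hei'
    intro g hg
    exact ⟨hg, fun h => hfc (Set.mem_singleton_iff.1 h ▸ hg)⟩

theorem par_reEnd {T : Set V} (hP : G.Par S T) {f : E} {x y : V} (hf : G.Jn f x y) (hx : x ∈ T)
    (hz : z ∈ T) : (G.reEnd f z y).Par S T := by
  intro U hU
  have : (G.reEnd f z y).cut S U = G.cut S U := by
    ext e
    by_cases hef : e = f
    · subst hef
      rw [reEnd_jn.mem_cut, hf.mem_cut]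
      have h1 : x ∉ U := fun h => Set.disjoint_left.1 hU h hx
      have h2 : z ∉ U := fun h => Set.disjoint_left.1 hU h hz
      tauto
    · exact cut_back hef
  rw [this]
  exact hP U hU

/-- empty strands -/
theorem Cov.triv_mem {B : Set V} {Φ : Set E}
    (h : ∀ g ∈ Φ, g ∈ G.cut S X ∧ ∃ c ∈ B, c ∈ X ∧ ∃ d, d ∉ X ∧ G.Jn g c d) :
    G.Cov S B X Φ (fun _ => []) where
  sub := fun g hg => (h g hg).1
  st := by
    intro g hg
    obtain ⟨-, c, hc, hcX, d, hd, hj⟩ := h g hg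
    exact ⟨c, hc, c, hcX, d, hd, hj, rfl⟩
  nd := by simp
  ins := by simp
  dj := by simp

/-- one path -/
theorem one_path (hR : G.Res S A z) (hP : G.Par S (Tm A z))
    (hz : ∀ e ∈ S, G.s e ≠ z ∧ G.t e ≠ z) {i : ι} {e : E} (he : e ∈ G.cut S (A i)) :
    ∃ p, e ∈ p ∧ (∀ e ∈ p, e ∈ S) ∧ G.Good A p ∧ G.Res (S \ {e | e ∈ p}) A z := by
  obtain ⟨X, W, hT, hX, hL⟩ := hR
  have hPX : G.Par S (Tm X z) := hP.anti (by
    rintro x (rfl | ⟨i, hi⟩)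
    · exact Or.inl rfl
    · exact Or.inr ⟨i, (hT i).sub hi⟩)
  have hXX : ∀ {m m' : ι} {x : V}, x ∈ X m → x ∈ X m' → m = m' := by
    intro m m' x hx hx'
    by_contra hn
    exact Set.disjoint_left.1 (hX.dj m m' hn) hx hx'
  have hzj : ∀ {e a b}, e ∈ S → G.Jn e a b → a ≠ z ∧ b ≠ z := by
    intro e a b he hj
    have := hz e he
    rcases hj with ⟨h1, h2⟩ | ⟨h1, h2⟩
    · exact ⟨h1 ▸ this.1, h2 ▸ this.2⟩
    · exact ⟨h2 ▸ this.2, h1 ▸ this.1⟩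
  obtain ⟨f, hf, hef⟩ : ∃ f ∈ G.cut S (X i), e ∈ W i f ∨ e = f := by
    by_cases hc : e ∈ G.cut S (X i)
    · exact ⟨e, hc, Or.inr rfl⟩
    · have : e ∈ G.ins S (X i) := by
        obtain ⟨hS, x, hx, y, hy, hj⟩ := mem_cut_iff.1 he
        rw [hj.mem_cut] at hc
        rw [hj.mem_ins]
        have := (hT i).sub hx
        tauto
      obtain ⟨f, hf, h⟩ := (hT i).full e he this
      exact ⟨f, hf, Or.inl h⟩
  obtain ⟨a, ha, hwf⟩ := (hT i).cov.st' hf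
  obtain ⟨hxi, y, hy, hj⟩ := inn_spec hf
  set x := G.inn (X i) f with hxdef
  have hWi : ∀ e ∈ W i f, e ∈ G.ins S (X i) := (hT i).cov.ins f hf
  have avo : ∀ {m m' : ι} {e}, m ≠ m' → e ∈ G.ins S (X m) → G.Av (X m') e := by
    intro m m' e hmm h
    exact ⟨fun h' => hmm (hXX h.2.1 h'), fun h' => hmm (hXX h.2.2 h')⟩
  by_cases hyl : ∃ l, y ∈ X l
  · obtain ⟨l, hyl⟩ := hyl
    have hil : i ≠ l := by rintro rfl; exact hy hyl
    have hxl : x ∉ X l := fun h => hil (hXX hxi h)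
    have hfl : f ∈ G.cut S (X l) := hj.mem_cut.2 ⟨hf.1, Or.inr ⟨hyl, hxl⟩⟩
    obtain ⟨b, hb, hwo⟩ := (hT l).cov.st' hfl
    rw [inn_eq hj.symm hyl hxl] at hwo
    have hWl : ∀ e ∈ W l f, e ∈ G.ins S (X l) := (hT l).cov.ins f hfl
    set p := W i f ++ f :: (W l f).reverse with hp
    have hmp : ∀ e, e ∈ p ↔ e ∈ W i f ∨ e = f ∨ e ∈ W l f := by intro e; simp [hp]
    have hfi' : f ∉ W i f := fun h => ins_not_cut (hWi f h) hf
    have hfl' : f ∉ W l f := fun h => ins_not_cut (hWl f h) hfl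
    have hpS : ∀ e ∈ p, e ∈ S := by
      intro e he
      rcases (hmp e).1 he with h | rfl | h
      · exact (hWi e h).1
      · exact hf.1
      · exact (hWl e h).1
    refine ⟨p, ?_, hpS, ?_⟩
    · rw [hmp]; tauto
    refine op_core hT hX hil hf hfl ha hb (hwf.append ⟨y, hj, hwo.reverse⟩) ?_ hpS (by simp [hp])
      (by simp [hp]) (fun e he => (hmp e).2 (Or.inl he)) (fun e he => (hmp e).2 (Or.inr (Or.inr he)))
      ?_ ?_ ?_ ?_
    · rw [hp, List.nodup_append]
      refine ⟨(hT i).cov.nd f hf, by simp [hfl', (hT l).cov.nd f hfl], ?_⟩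
      intro c hc d hd
      rintro rfl
      simp only [List.mem_cons, List.mem_reverse] at hd
      rcases hd with rfl | hd
      · exact hfi' hc
      · exact (avo hil (hWi c hc)).not_ins (hWl c hd)
    · intro e he
      rcases (hmp e).1 he with h | h | h
      · exact Or.inl h
      · exact Or.inr (Or.inl h)
      · exact Or.inr (Or.inr (avo hil.symm (hWl e h)))
    · intro e he
      rcases (hmp e).1 he with h | h | h
      · exact Or.inr (Or.inr (avo hil (hWi e h)))
      · exact Or.inr (Or.inl h)
      · exact Or.inl h
    · intro m hmi hml e he
      rcases (hmp e).1 he with h | rfl | h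
      · exact avo (Ne.symm hmi) (hWi e h)
      · rw [hj.av]; exact ⟨fun h => hmi (hXX h hxi), fun h => hml (hXX h hyl)⟩
      · exact avo (Ne.symm hml) (hWl e h)
    · have h1 := loose_delete hL hj hxi hyl
      have h2 : G.Loose (S \ {e | e ∈ p}) X z := by
        refine h1.inside ?_ ?_
        · rintro e ⟨h1, h2⟩
          exact ⟨h1, fun h => h2 ((hmp e).2 (Or.inr (Or.inl h)))⟩
        · rintro e ⟨h1, h2⟩ h3
          have : e ∈ p := by
            by_contra hn
            exact h3 ⟨h1, hn⟩
          rcases (hmp e).1 this with h | h | h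
          · exact ⟨i, ⟨h1, h2⟩, (hWi e h).2⟩
          · exact (h2 h).elim
          · exact ⟨l, ⟨h1, h2⟩, (hWl e h).2⟩
      exact ⟨X, fun _ _ => [], fun _ => TL.triv _ _ _, hX, h2⟩
  · push Not at hyl
    have hyT : y ∉ Tm X z := by
      rintro (h | ⟨l, hl⟩)
      · exact (hzj hf.1 hj).2 h
      · exact hyl l hl
    set Q : Set E := {e | e ∈ S ∧ G.Av (Tm X z) e} with hQ
    obtain ⟨o, y', b0, l, hoS, hor, hoj, hbl, hil⟩ : ∃ o y' b0 l, o ∈ S ∧ G.Reach Q y y' ∧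
        G.Jn o b0 y' ∧ b0 ∈ X l ∧ i ≠ l := by
      by_contra hno
      have hK : ∀ {v}, G.Reach Q y v → v ∉ Tm X z := by
        rintro v ⟨r, hr, hrQ⟩
        exact hr.av_end (fun e he => (hrQ e he).2) hyT
      set Z : Set V := {v | v ∈ X i ∨ G.Reach Q y v} with hZ
      have hadm : Adm X z i Z := by
        refine Adm.intro (fun v hv => Or.inl hv) ?_ ?_
        · rintro (h | h)
          · exact hX.nz i h
          · exact hK h (Or.inl rfl)
        · rintro m hm v (h | h) hvm
          · exact hm (hXX hvm h)
          · exact hK h (Or.inr ⟨m, hvm⟩)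
      refine hL i Z (fun _ => []) hadm ((Cov.triv_mem ?_)) f hf
        (hj.mem_ins.2 ⟨hf.1, Or.inl hxi, Or.inr (Reach.refl y)⟩)
      intro g hg
      obtain ⟨hgS, c, hc, d, hd, hgj⟩ := mem_cut_iff.1 hg
      refine ⟨hg, c, ?_, hc, d, hd, hgj⟩
      rcases hc with hc | hc
      · exact hc
      exfalso
      have hd' : d ∉ Tm X z := by
        rintro (h | ⟨m, hm⟩)
        · exact (hzj hgS hgj).2 h
        · by_cases hmi : m = i
          · subst hmi; exact hd (Or.inl hm)
          · exact hno ⟨g, c, d, m, hgS, hc, hgj.symm, hm, Ne.symm hmi⟩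
      exact hd (Or.inr (hc.trans (Reach.single hgj ⟨hgS, hgj.av.2 ⟨hK hc, hd'⟩⟩)))
    obtain ⟨π, π1, π2, π3⟩ := hor.trail
    have hy'T : y' ∉ Tm X z := π1.av_end (fun e he => (π3 e he).2) hyT
    have hxT : x ∈ Tm X z := Or.inr ⟨i, hxi⟩
    have hbT : b0 ∈ Tm X z := Or.inr ⟨l, hbl⟩
    have hzT : z ∈ Tm X z := Or.inl rfl
    have hfo : f ≠ o := by
      rintro rfl
      rcases hj.pair hoj with ⟨h1, h2⟩ | ⟨h1, h2⟩
      · exact hil (hXX hxi (h1 ▸ hbl))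
      · exact hyT (h1 ▸ hbT)
    set G1 := G.reEnd f z y with hG1
    have hoj1 : G1.Jn o b0 y' := (reEnd_agr hfo.symm).jn.2 hoj
    set G2 := G1.reEnd o z y' with hG2
    have hL2 : G2.Loose S X z := loose_reEnd (loose_reEnd hL hf.1 hj hxi) hoS hoj1 hbl
    have hP2 : G2.Par S (Tm X z) := par_reEnd (par_reEnd hPX hj hxT hzT) hoj1 hbT hzT
    have agr : ∀ e, e ≠ f → e ≠ o → Agr G G2 e := by
      intro e h1 h2
      have a1 : Agr G G1 e := reEnd_agr h1
      have a2 : Agr G1 G2 e := reEnd_agr h2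
      exact ⟨a2.1.trans a1.1, a2.2.trans a1.2⟩
    have nf : ∀ {e}, G.Av (Tm X z) e → e ≠ f := fun h => h.ne_of_jn hj hxT
    have no : ∀ {e}, G.Av (Tm X z) e → e ≠ o := fun h => h.ne_of_jn hoj hbT
    have hf2 : G2.Jn f z y := (reEnd_agr hfo).jn.2 reEnd_jn
    have ho2 : G2.Jn o z y' := reEnd_jn
    obtain ⟨q, q1, q2, q3, q4⟩ := strong_lemma π.length G2 S X f y π rfl hX hL2 hP2 hf.1 hoS hfo hf2 ho2
      hyT (π1.chg fun e he => agr e (nf (π3 e he).2) (no (π3 e he).2)) π2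
      (fun e he => ⟨(π3 e he).1, (agr e (nf (π3 e he).2) (no (π3 e he).2)).av.2 (π3 e he).2⟩)
    have qagr : ∀ e ∈ q, Agr G G2 e := fun e he =>
      agr e ((q3 e he).2.ne_of_jn hf2 hzT) ((q3 e he).2.ne_of_jn ho2 hzT)
    have qav : ∀ e ∈ q, G.Av (Tm X z) e := fun e he => (qagr e he).av.1 (q3 e he).2
    have hy'l : y' ∉ X l := fun h => hy'T (Or.inr ⟨l, h⟩)
    have hol : o ∈ G.cut S (X l) := hoj.mem_cut.2 ⟨hoS, Or.inl ⟨hbl, hy'l⟩⟩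
    obtain ⟨b, hb, hwo⟩ := (hT l).cov.st' hol
    rw [inn_eq hoj hbl hy'l] at hwo
    have hWl : ∀ e ∈ W l o, e ∈ G.ins S (X l) := (hT l).cov.ins o hol
    set p := W i f ++ f :: (q ++ o :: (W l o).reverse) with hp
    have hmp : ∀ e, e ∈ p ↔ e ∈ W i f ∨ e = f ∨ e ∈ q ∨ e = o ∨ e ∈ W l o := by intro e; simp [hp]
    have hpS : ∀ e ∈ p, e ∈ S := by
      intro e he
      rcases (hmp e).1 he with h | rfl | h | rfl | h
      · exact (hWi e h).1
      · exact hf.1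
      · exact (q3 e h).1
      · exact hoS
      · exact (hWl e h).1
    have favm : ∀ m, m ≠ i → G.Av (X m) f := by
      intro m hm
      rw [hj.av]; exact ⟨fun h => hm (hXX h hxi), fun h => hyT (Or.inr ⟨m, h⟩)⟩
    have oavm : ∀ m, m ≠ l → G.Av (X m) o := by
      intro m hm
      rw [hoj.av]; exact ⟨fun h => hm (hXX h hbl), fun h => hy'T (Or.inr ⟨m, h⟩)⟩
    have qavm : ∀ m, ∀ e ∈ q, G.Av (X m) e := fun m e he => (qav e he).mono (fun v hv => Or.inr ⟨m, hv⟩)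
    refine ⟨p, ?_, hpS, ?_⟩
    · rw [hmp]; tauto
    refine op_core hT hX hil hf hol ha hb (hwf.append ⟨y, hj,
        (q2.chg fun e he => (qagr e he).symm).append ⟨b0, hoj.symm, hwo.reverse⟩⟩) ?_ hpS (by simp [hp])
      (by simp [hp]) (fun e he => (hmp e).2 (by tauto)) (fun e he => (hmp e).2 (by tauto))
      ?_ ?_ ?_ ?_
    · have i1 : ∀ c ∈ W i f, c ≠ f ∧ c ∉ q ∧ c ≠ o ∧ c ∉ W l o := by
        intro c hc
        have := hWi c hc
        refine ⟨?_, ?_, ?_, ?_⟩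
        · rintro rfl; exact ins_not_cut this hf
        · intro h; exact (qavm i c h).not_ins this
        · rintro rfl; exact (oavm i hil).not_ins this
        · intro h; exact (avo hil this).not_ins (hWl c h)
      have i2 : ∀ c ∈ W l o, c ≠ f ∧ c ∉ q ∧ c ≠ o := by
        intro c hc
        have := hWl c hc
        refine ⟨?_, ?_, ?_⟩
        · rintro rfl; exact (favm l hil.symm).not_ins this
        · intro h; exact (qavm l c h).not_ins this
        · rintro rfl; exact ins_not_cut this hol
      have i3 : ∀ c ∈ q, c ≠ f ∧ c ≠ o := fun c hc => ⟨nf (qav c hc), no (qav c hc)⟩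
      rw [hp, List.nodup_append, List.nodup_cons, List.nodup_append, List.nodup_cons]
      refine ⟨(hT i).cov.nd f hf, ⟨?_, q1, ⟨?_, ?_⟩, ?_⟩, ?_⟩
      · simp only [List.mem_append, List.mem_cons, List.mem_reverse, not_or]
        exact ⟨fun h => (i3 f h).1 rfl, hfo, fun h => (i2 f h).1 rfl⟩
      · simp only [List.mem_reverse]; exact fun h => (i2 o h).2.2 rfl
      · rw [List.nodup_reverse]; exact (hT l).cov.nd o hol
      · intro c hc d hd
        rintro rfl
        simp only [List.mem_cons, List.mem_reverse] at hd
        rcases hd with rfl | hd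
        · exact (i3 _ hc).2 rfl
        · exact (i2 c hd).2.1 hc
      · intro c hc d hd
        rintro rfl
        simp only [List.mem_cons, List.mem_append, List.mem_reverse] at hd
        have := i1 c hc
        tauto
    · intro e he
      rcases (hmp e).1 he with h | h | h | h | h
      · exact Or.inl h
      · exact Or.inr (Or.inl h)
      · exact Or.inr (Or.inr (qavm i e h))
      · subst h; exact Or.inr (Or.inr (oavm i hil))
      · exact Or.inr (Or.inr (avo hil.symm (hWl e h)))
    · intro e he
      rcases (hmp e).1 he with h | h | h | h | h
      · exact Or.inr (Or.inr (avo hil (hWi e h)))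
      · subst h; exact Or.inr (Or.inr (favm l hil.symm))
      · exact Or.inr (Or.inr (qavm l e h))
      · exact Or.inr (Or.inl h)
      · exact Or.inl h
    · intro m hmi hml e he
      rcases (hmp e).1 he with h | rfl | h | rfl | h
      · exact avo (Ne.symm hmi) (hWi e h)
      · exact favm m hmi
      · exact qavm m e h
      · exact oavm m hml
      · exact avo (Ne.symm hml) (hWl e h)
    · have h1 : G.Res (S \ ({e | e ∈ q} ∪ {f, o})) X z := by
        refine q4.chg fun e he => (agr e ?_ ?_).symm
        · rintro rfl; exact he.2 (Or.inr (Or.inl rfl))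
        · rintro rfl; exact he.2 (Or.inr (Or.inr rfl))
      refine h1.inside ?_ ?_
      · rintro e ⟨h1, h2⟩
        refine ⟨h1, fun h => h2 ((hmp e).2 ?_)⟩
        rcases h with h | h | h
        · exact Or.inr (Or.inr (Or.inl h))
        · exact Or.inr (Or.inl h)
        · exact Or.inr (Or.inr (Or.inr (Or.inl h)))
      · rintro e ⟨h1, h2⟩ h3
        have : e ∈ p := by
          by_contra hn
          exact h3 ⟨h1, hn⟩
        rcases (hmp e).1 this with h | h | h | h | h
        · exact ⟨i, ⟨h1, h2⟩, (hWi e h).2⟩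
        · exact (h2 (Or.inr (Or.inl h))).elim
        · exact (h2 (Or.inl h)).elim
        · exact (h2 (Or.inr (Or.inr h))).elim
        · exact ⟨l, ⟨h1, h2⟩, (hWl e h).2⟩

end Gr
end LC

namespace LC

/-- closures of bounded size -/
theorem exists_closure {E : Type v} (R : E → Set E) {μ : Cardinal.{v}} (hμ : Cardinal.aleph0 ≤ μ)
    (hR : ∀ e, Cardinal.mk (R e) ≤ μ) (D : Set E) (hD : Cardinal.mk D ≤ μ) :
    ∃ D', D ⊆ D' ∧ Cardinal.mk D' ≤ μ ∧ ∀ e ∈ D', R e ⊆ D' := by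
  obtain ⟨s, hs0, hs⟩ : ∃ s : ℕ → Set E, s 0 = D ∧ ∀ n, s (n + 1) = s n ∪ ⋃ e : s n, R e.1 :=
    ⟨fun n => Nat.rec D (fun _ C => C ∪ ⋃ e : C, R e.1) n, rfl, fun n => rfl⟩
  have hc : ∀ n, Cardinal.mk ↥(s n) ≤ μ := by
    intro n
    induction n with
    | zero => rw [hs0]; exact hD
    | succ n ih =>
      rw [hs]
      refine (Cardinal.mk_union_le _ _).trans (Cardinal.add_le_of_le hμ ih ?_)
      refine (Cardinal.mk_iUnion_le _).trans ?_
      refine (mul_le_mul' ih (ciSup_le' fun e : s n => hR e.1)).trans ?_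
      exact (Cardinal.mul_eq_self hμ).le
  refine ⟨⋃ n, s n, hs0 ▸ Set.subset_iUnion s 0, ?_, ?_⟩
  · have := Cardinal.mk_iUnion_le_lift (f := s)
    simp only [Cardinal.lift_uzero] at this
    refine this.trans ?_
    refine (mul_le_mul' (by simpa using hμ) (ciSup_le' fun n => hc n)).trans ?_
    exact (Cardinal.mul_eq_self hμ).le
  · intro e he
    obtain ⟨n, hn⟩ := Set.mem_iUnion.1 he
    refine Set.Subset.trans ?_ (Set.subset_iUnion s (n + 1))
    rw [hs]
    exact Set.subset_union_of_subset_right (Set.subset_iUnion (fun e : s n => R e.1) ⟨e, hn⟩) _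

namespace Gr
variable {V : Type u} {E : Type v} {ι : Type w} {G G' : Gr V E} {S S' S1 P P' C D : Set E}
  {X X0 Y U T : Set V} {A : ι → Set V} {z : V} {μ : Cardinal.{v}}

/-- vertices reachable from `T` -/
def RV (G : Gr V E) (T : Set V) (D : Set E) : Set V := {x | ∃ a ∈ T, G.Reach D a x}
/-- edges of `D` connected to `T` -/
def rel (G : Gr V E) (T : Set V) (D : Set E) : Set E := {e | e ∈ D ∧ G.s e ∈ G.RV T D}
/-- robust vertices -/
def Rob (G : Gr V E) (S : Set E) (T : Set V) (μ : Cardinal.{v}) (x : V) : Prop :=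
  ∀ U : Set V, x ∈ U → Disjoint U T → μ < Cardinal.mk (G.cut S U)
/-- closed edge sets -/
structure Clo (G : Gr V E) (S : Set E) (T : Set V) (μ : Cardinal.{v}) (C : Set E) : Prop where
  card : Cardinal.mk C ≤ μ
  rob : ∀ x ∈ G.RV T (S \ C), x ∉ T → ∀ e ∈ C, e ∈ S → ∀ y, G.Jn e x y → G.Rob S T μ x

theorem sub_RV : T ⊆ G.RV T D := fun x hx => ⟨x, hx, Reach.refl x⟩

theorem RV.step {e : E} {x y : V} (hx : x ∈ G.RV T D) (he : e ∈ D) (hj : G.Jn e x y) :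
    y ∈ G.RV T D := by
  obtain ⟨a, ha, hr⟩ := hx
  exact ⟨a, ha, hr.trans (Reach.single hj he)⟩

theorem mem_rel {e : E} {x y : V} (hj : G.Jn e x y) :
    e ∈ G.rel T D ↔ e ∈ D ∧ x ∈ G.RV T D := by
  constructor
  · rintro ⟨h1, h2⟩
    refine ⟨h1, ?_⟩
    obtain ⟨rfl, rfl⟩ | ⟨rfl, rfl⟩ := hj
    · exact h2
    · exact RV.step h2 h1 (Jn.self G e)
  · rintro ⟨h1, h2⟩
    refine ⟨h1, ?_⟩
    obtain ⟨rfl, rfl⟩ | ⟨rfl, rfl⟩ := hj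
    · exact h2
    · exact RV.step h2 h1 (Jn.self G e).symm

theorem rel_sub : G.rel T D ⊆ D := fun _ h => h.1

theorem cut_RV : G.cut S (U ∩ G.RV T (S \ C)) ⊆ C ∪ G.cut (G.rel T (S \ C)) U := by
  intro e he
  obtain ⟨hS, x, hx, y, hy, hj⟩ := mem_cut_iff.1 he
  by_cases hC : e ∈ C
  · exact Or.inl hC
  · right
    refine mem_cut_iff.2 ⟨(mem_rel hj).2 ⟨⟨hS, hC⟩, hx.2⟩, x, hx.1, y, fun h => hy ⟨h, ?_⟩, hj⟩
    exact RV.step hx.2 ⟨hS, hC⟩ hj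

theorem Rob.inf {x : V} (h : G.Rob S T μ x) (hμ : Cardinal.aleph0 ≤ μ) (hC : Cardinal.mk C ≤ μ)
    (hx : x ∈ U) (hx' : x ∈ G.RV T (S \ C)) (hU : Disjoint U T) :
    μ < Cardinal.mk (G.cut (G.rel T (S \ C)) U) := by
  by_contra hn
  push Not at hn
  have h1 := h (U ∩ G.RV T (S \ C)) ⟨hx, hx'⟩ (hU.mono_left Set.inter_subset_left)
  refine h1.not_ge ?_
  refine (Cardinal.mk_le_mk_of_subset cut_RV).trans ?_
  exact (Cardinal.mk_union_le _ _).trans (Cardinal.add_le_of_le hμ hC hn)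

theorem Rob.mem {x : V} (h : G.Rob S T μ x) (hC : Cardinal.mk C ≤ μ) : x ∈ G.RV T (S \ C) := by
  by_contra hn
  refine (h (G.RV T (S \ C))ᶜ hn ?_).not_ge ?_
  · exact Set.disjoint_left.2 fun a ha ha' => ha (sub_RV ha')
  · refine (Cardinal.mk_le_mk_of_subset ?_).trans hC
    intro e he
    obtain ⟨hS, x, hx, y, hy, hj⟩ := mem_cut_iff.1 he
    by_contra hC
    exact hx (RV.step (not_not.1 hy) ⟨hS, hC⟩ hj.symm)

theorem Par.rel (hP : G.Par S T) (hμ : Cardinal.aleph0 ≤ μ) (hC : G.Clo S T μ C) :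
    G.Par (G.rel T (S \ C)) T := by
  rintro U hU ⟨hf, ho⟩
  have key : G.cut S (U ∩ G.RV T (S \ C)) = G.cut (G.rel T (S \ C)) U := by
    ext e
    constructor
    · intro he
      rcases cut_RV he with h | h
      · obtain ⟨hS, x, hx, y, hy, hj⟩ := mem_cut_iff.1 he
        have := (hC.rob x hx.2 (fun h => Set.disjoint_left.1 hU hx.1 h) e h hS y hj).inf hμ hC.card
          hx.1 hx.2 hU
        exact ((this.trans_le hf.lt_aleph0.le).not_ge hμ).elim
      · exact h
    · intro he
      obtain ⟨hS, x, hx, y, hy, hj⟩ := mem_cut_iff.1 he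
      exact mem_cut_iff.2 ⟨hS.1.1, x, ⟨hx, ((mem_rel hj).1 hS).2⟩, y, fun h => hy h.1, hj⟩
  exact hP _ (hU.mono_left Set.inter_subset_left) ⟨by rwa [key], by rwa [key]⟩

/-- the closure operator needed for `Clo` -/
theorem exists_robOp (G : Gr V E) (S : Set E) (T : Set V) (μ : Cardinal.{v}) (hμ : Cardinal.aleph0 ≤ μ) :
    ∃ R : E → Set E, (∀ e, Cardinal.mk (R e) ≤ μ) ∧
      ∀ C : Set E, (∀ e ∈ C, R e ⊆ C) → Cardinal.mk C ≤ μ → G.Clo S T μ C := by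
  classical
  have h1 : ∀ x : V, ∃ F : Set E, Cardinal.mk F ≤ μ ∧ (x ∉ T → ¬ G.Rob S T μ x →
      ∃ U : Set V, x ∈ U ∧ Disjoint U T ∧ G.cut S U = F) := by
    intro x
    by_cases hx : G.Rob S T μ x
    · exact ⟨∅, by simp, fun _ h => (h hx).elim⟩
    · have hx' := hx
      unfold Rob at hx'
      push Not at hx'
      obtain ⟨U, h1, h2, h3⟩ := hx'
      exact ⟨G.cut S U, h3, fun _ _ => ⟨U, h1, h2, rfl⟩⟩
  choose F hF hF' using h1
  refine ⟨fun e => F (G.s e) ∪ F (G.t e), fun e => (Cardinal.mk_union_le _ _).trans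
    (Cardinal.add_le_of_le hμ (hF _) (hF _)), ?_⟩
  intro C hC hcard
  refine ⟨hcard, ?_⟩
  intro x hx hxT e he heS y hj
  by_contra hr
  obtain ⟨U, h1, h2, h3⟩ := hF' x hxT hr
  have h4 : F x ⊆ C := by
    refine Set.Subset.trans ?_ (hC e he)
    obtain ⟨rfl, rfl⟩ | ⟨rfl, rfl⟩ := hj
    · exact Set.subset_union_left
    · exact Set.subset_union_right
  obtain ⟨a, ha, hr⟩ := hx
  have := hr.symm.mem_of_closed h1 (by
    intro e he hc
    exact he.2 (h4 (h3 ▸ ⟨he.1, hc.2⟩)))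
  exact Set.disjoint_left.1 h2 this ha

end Gr
end LC

namespace LC
namespace Gr
variable {V : Type u} {E : Type v} {ι : Type w} {G G' : Gr V E} {S S' S1 P P' C D : Set E}
  {X X0 Y U T A0 : Set V} {A : ι → Set V} {z : V} {μ : Cardinal.{v}}

/-- closed under strands -/
def WC (G : Gr V E) (S : Set E) (X : Set V) (W : E → List E) (M : Set E) : Prop :=
  ∀ f ∈ G.cut S X, ∀ e ∈ M, (e = f ∨ e ∈ W f) → f ∈ M ∧ ∀ e' ∈ W f, e' ∈ M

theorem Cov.exists_op {W : E → List E} (h : G.Cov S A0 X (G.cut S X) W) :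
    ∃ R : E → Set E, (∀ e, (R e).Countable) ∧
      ∀ M : Set E, (∀ e ∈ M, R e ⊆ M) → G.WC S X W M := by
  classical
  refine ⟨fun e => {e' | ∃ f ∈ G.cut S X, (e = f ∨ e ∈ W f) ∧ (e' = f ∨ e' ∈ W f)}, ?_, ?_⟩
  · intro e
    by_cases hf : ∃ f ∈ G.cut S X, (e = f ∨ e ∈ W f)
    · obtain ⟨f, hf, hef⟩ := hf
      refine ((f :: W f).toFinset.finite_toSet).countable.mono ?_
      rintro e' ⟨g, hg, heg, he'⟩
      have hfg : f = g := by
        rcases hef with rfl | hef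
        · rcases heg with rfl | heg
          · rfl
          · exact (h.not_mem hg hf heg).elim
        · rcases heg with rfl | heg
          · exact (h.not_mem hf hg hef).elim
          · exact h.dj f hf g hg e hef heg
      subst hfg
      simpa using he'
    · convert Set.countable_empty
      ext e'
      simp only [Set.mem_ofPred_eq, Set.mem_empty_iff_false, iff_false]
      rintro ⟨f, h1, h2, _⟩
      exact hf ⟨f, h1, h2⟩
  · intro M hM f hf e he hef
    exact ⟨hM e he ⟨f, hf, hef, Or.inl rfl⟩, fun e' he' => hM e he ⟨f, hf, hef, Or.inr he'⟩⟩

theorem WC.strand {W : E → List E} {M : Set E} (h : G.Cov S A0 X (G.cut S X) W) (hA : A0 ⊆ T)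
    (hM : G.WC S X W M) {f : E} (hf : f ∈ G.cut S X) (hfM : f ∉ M) :
    f ∈ G.rel T (S \ M) ∧ ∀ e ∈ W f, e ∈ G.rel T (S \ M) := by
  obtain ⟨a, ha, x, hx, y, hy, hj, hw⟩ := h.st f hf
  have hW : ∀ e ∈ W f, e ∈ S \ M := fun e he =>
    ⟨(h.ins f hf e he).1, fun h' => hfM (hM f hf e h' (Or.inr he)).1⟩
  refine ⟨(mem_rel hj).2 ⟨⟨hf.1, hfM⟩, a, hA ha, _, hw, hW⟩, ?_⟩
  intro e he
  obtain ⟨l1, l2, h1⟩ := List.append_of_mem he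
  rw [h1] at hw
  obtain ⟨b, hb1, c, hb2, _⟩ := hw.split
  refine (mem_rel hb2).2 ⟨hW e he, a, hA ha, l1, hb1, fun e' he' => hW e' (by rw [h1]; simp [he'])⟩

theorem lemN_stage (hμ : Cardinal.aleph0 ≤ μ) (hP : G.Par S T) (hA : A0 ⊆ T)
    (hXT : ∀ x ∈ X, x ∈ T → x ∈ A0) {W : E → List E} (h : G.Cov S A0 X (G.cut S X) W)
    {q : E} {x y : V} (hqS : q ∉ S) (hx : x ∈ X) (hy : y ∉ X) (hj : G.Jn q x y)
    (hr : G.Rob S T μ x) {M : Set E} (hM : G.WC S X W M) (hC : G.Clo S T μ M) :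
    ∃ (W' : E → List E) (J : Set E), G.Cov (G.rel T (S \ M) ∪ {q}) A0 X (G.cut (G.rel T (S \ M) ∪ {q}) X) W' ∧
      J.Countable ∧ q ∈ J ∧ ∀ g, g ∉ J → W' g = W g := by
  set S2 := G.rel T (S \ M) with hS2
  have hS2S : S2 ⊆ S := fun e he => he.1.1
  have hcut : G.cut (S2 ∪ {q}) X \ {q} ⊆ G.cut S2 X := by
    rintro f ⟨⟨hf | hf, hf'⟩, hq⟩
    · exact ⟨hf, hf'⟩
    · exact (hq hf).elim
  suffices hs : ∃ W', G.Cov (S2 ∪ {q}) A0 X (G.cut (S2 ∪ {q}) X) W' ∧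
      ∃ J : Set E, J.Countable ∧ q ∈ J ∧ ∀ g, g ∉ J → W' g = W g by
    obtain ⟨W', h1, J, h2⟩ := hs
    exact ⟨W', J, h1, h2⟩
  refine proc_one (S := S2 ∪ {q}) (k := q) (W := W) ?_ (mem_cut_iff.2 ⟨Or.inr rfl, x, hx, y, hy, hj⟩) ?_
  · rintro U hU ⟨hf, ho⟩
    have hUT : Disjoint U T := Set.disjoint_left.2 fun a ha haT => by
      by_cases haX : a ∈ X
      · exact Set.disjoint_left.1 hU ha (Or.inl (hXT a haX haT))
      · exact Set.disjoint_left.1 hU ha (Or.inr haX)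
    have hyU : y ∉ U := fun h' => Set.disjoint_left.1 hU h' (Or.inr hy)
    by_cases hxU : x ∈ U
    · have h1 := hr.inf hμ hC.card hxU (hr.mem hC.card) hUT
      have h2 : (G.cut S2 U).Finite := hf.subset (cut_mono Set.subset_union_left)
      exact ((h1.trans_le h2.lt_aleph0.le).not_ge hμ).elim
    · have : G.cut (S2 ∪ {q}) U = G.cut S2 U := by
        refine Set.Subset.antisymm ?_ (cut_mono Set.subset_union_left)
        rintro f ⟨hf | rfl, hf'⟩
        · exact ⟨hf, hf'⟩
        · have h' : f ∈ G.cut (S2 ∪ {f}) U := ⟨Or.inr rfl, hf'⟩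
          rw [hj.mem_cut] at h'
          tauto
      rw [this] at hf ho
      exact hP.rel hμ hC U hUT ⟨hf, ho⟩
  · have hin : ∀ f ∈ G.cut (S2 ∪ {q}) X \ {q}, f ∈ G.cut S X ∧ f ∉ M := fun f hf =>
      ⟨cut_mono hS2S (hcut hf), (hcut hf).1.1.2⟩
    exact
      { sub := Set.sdiff_subset
        st := fun f hf => h.st f (hin f hf).1
        nd := fun f hf => h.nd f (hin f hf).1
        ins := fun f hf e he => ⟨Or.inl ((hM.strand h hA (hin f hf).1 (hin f hf).2).2 e he),
          (h.ins f (hin f hf).1 e he).2⟩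
        dj := fun f hf g hg => h.dj f (hin f hf).1 g (hin g hg).1 }

theorem lemN (hμ : Cardinal.aleph0 ≤ μ) (hP : G.Par S T) (hA : A0 ⊆ T)
    (hXT : ∀ x ∈ X, x ∈ T → x ∈ A0) {W : E → List E} (h : G.Cov S A0 X (G.cut S X) W)
    {N : Set E} (hNS : ∀ q ∈ N, q ∉ S) (hNc : Cardinal.mk N ≤ μ)
    (hN : ∀ q ∈ N, ∃ x ∈ X, ∃ y, y ∉ X ∧ G.Jn q x y ∧ G.Rob S T μ x) :
    ∃ W', G.Cov (S ∪ N) A0 X (G.cut (S ∪ N) X) W' := by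
  classical
  obtain ⟨R1, hR1, hR1'⟩ := h.exists_op
  obtain ⟨R2, hR2, hR2'⟩ := exists_robOp G S T μ hμ
  let R : E → Set E := fun e => R1 e ∪ R2 e
  have hR : ∀ e, Cardinal.mk (R e) ≤ μ := fun e => (Cardinal.mk_union_le _ _).trans
    (Cardinal.add_le_of_le hμ (((Cardinal.le_aleph0_iff_set_countable).2 (hR1 e)).trans hμ) (hR2 e))
  let Gd : Set E → Prop := fun M => Cardinal.mk M ≤ μ ∧ ∀ e ∈ M, R e ⊆ M
  have hWC : ∀ {M}, Gd M → G.WC S X W M := fun hM =>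
    hR1' _ fun e he => Set.subset_union_left.trans (hM.2 e he)
  have hClo : ∀ {M}, Gd M → G.Clo S T μ M := fun hM =>
    hR2' _ (fun e he => Set.subset_union_right.trans (hM.2 e he)) hM.1
  have stage : ∀ q M, ∃ (M' : Set E) (W' : E → List E) (J : Set E), q ∈ N → Gd M →
      Gd M' ∧ M ⊆ M' ∧
      G.Cov (G.rel T (S \ M) ∪ {q}) A0 X (G.cut (G.rel T (S \ M) ∪ {q}) X) W' ∧
      q ∈ J ∧ (∀ g, g ∉ J → W' g = W g) ∧ ∀ g ∈ J, g ∈ M' ∧ ∀ e ∈ W' g, e ∈ M' := by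
    intro q M
    by_cases hq : q ∈ N ∧ Gd M
    · obtain ⟨hq, hM⟩ := hq
      obtain ⟨x, hx, y, hy, hj, hr⟩ := hN q hq
      obtain ⟨W', J, h1, h2, h3, h4⟩ := lemN_stage hμ hP hA hXT h (hNS q hq) hx hy hj hr (hWC hM)
        (hClo hM)
      have hJ : (J ∪ ⋃ g ∈ J, {e | e ∈ W' g}).Countable :=
        h2.union (h2.biUnion fun g _ => ((W' g).finite_toSet).countable)
      obtain ⟨M', h5, h6, h7⟩ := exists_closure R hμ hR (M ∪ (J ∪ ⋃ g ∈ J, {e | e ∈ W' g}))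
        ((Cardinal.mk_union_le _ _).trans (Cardinal.add_le_of_le hμ hM.1
          (((Cardinal.le_aleph0_iff_set_countable).2 hJ).trans hμ)))
      refine ⟨M', W', J, fun _ _ => ⟨⟨h6, h7⟩, Set.subset_union_left.trans h5, h1, h3, h4, ?_⟩⟩
      intro g hg
      refine ⟨h5 (Or.inr (Or.inl hg)), fun e he => h5 (Or.inr (Or.inr ?_))⟩
      exact Set.mem_biUnion hg he
    · exact ⟨∅, W, ∅, fun h1 h2 => (hq ⟨h1, h2⟩).elim⟩
  choose nx W' J hst using stage
  let r : E → E → Prop := WellOrderingRel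
  have wf : WellFounded r := (inferInstance : IsWellFounded E WellOrderingRel).wf
  obtain ⟨M, hMdef⟩ : ∃ M : E → Set E, ∀ q, M q = ⋃ q' : {q' // q' ∈ N ∧ r q' q}, nx q'.1 (M q'.1) :=
    ⟨wf.fix fun q ih => ⋃ q' : {q' // q' ∈ N ∧ r q' q}, nx q'.1 (ih q'.1 q'.2.2), fun q =>
      wf.fix_eq _ q⟩
  have hGd : ∀ q, Gd (M q) := by
    intro q
    induction q using wf.induction with
    | _ q ih =>
      constructor
      · rw [hMdef]
        refine (Cardinal.mk_iUnion_le _).trans ?_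
        have h1 : Cardinal.mk {q' // q' ∈ N ∧ r q' q} ≤ μ :=
          (Cardinal.mk_le_mk_of_subset (s := {q' | q' ∈ N ∧ r q' q}) (t := N) fun _ h => h.1).trans hNc
        refine (mul_le_mul' h1 (ciSup_le' fun q' : {q' // q' ∈ N ∧ r q' q} => ?_)).trans
          (Cardinal.mul_eq_self hμ).le
        exact (hst q'.1 (M q'.1) q'.2.1 (ih q'.1 q'.2.2)).1.1
      · intro e he
        rw [hMdef] at he ⊢
        obtain ⟨q', hq'⟩ := Set.mem_iUnion.1 he
        exact ((hst q'.1 (M q'.1) q'.2.1 (ih q'.1 q'.2.2)).1.2 e hq').trans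
          (Set.subset_iUnion (fun q' : {q' // q' ∈ N ∧ r q' q} => nx q'.1 (M q'.1)) q')
  have hst' := fun q hq => hst q (M q) hq (hGd q)
  have hmono : ∀ q ∈ N, ∀ q', r q q' → nx q (M q) ⊆ M q' := by
    intro q hq q' hr
    rw [hMdef q']
    exact Set.subset_iUnion (fun q'' : {q'' // q'' ∈ N ∧ r q'' q'} => nx q''.1 (M q''.1)) ⟨q, hq, hr⟩
  let S2 : E → Set E := fun q => G.rel T (S \ M q)
  let Ch : E → E → Prop := fun f q => q ∈ N ∧ f ∈ J q (M q) ∧ f ∈ G.cut (S2 q ∪ {q}) X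
  have hqcut : ∀ q ∈ N, ∀ S', q ∈ S' → q ∈ G.cut S' X := by
    intro q hq S' hq'
    obtain ⟨x, hx, y, hy, hj, hr⟩ := hN q hq
    exact mem_cut_iff.2 ⟨hq', x, hx, y, hy, hj⟩
  have hChN : ∀ q ∈ N, Ch q q := fun q hq => ⟨hq, (hst' q hq).2.2.2.1, hqcut q hq _ (Or.inr rfl)⟩
  have hin : ∀ f q, q ∈ N → f ∈ G.cut (S2 q ∪ {q}) X → ∀ e ∈ W' q (M q) f, e ∈ S2 q := by
    intro f q hq hf e he
    have h1 := (hst' q hq).2.2.1.ins f hf e he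
    rcases h1.1 with h2 | h2
    · exact h2
    · rw [Set.mem_singleton_iff.1 h2] at h1
      exact (ins_not_cut h1 (hqcut q hq Set.univ trivial)).elim
  have htri : ∀ q q' e, q ∈ N → q' ∈ N → e ∈ nx q (M q) → e ∉ M q → e ∈ nx q' (M q') → e ∉ M q' →
      q = q' := by
    intro q q' e hq hq' h1 h2 h3 h4
    rcases trichotomous_of WellOrderingRel q q' with h5 | h5 | h5
    · exact (h4 (hmono q hq q' h5 h1)).elim
    · exact h5
    · exact (h2 (hmono q' hq' q h5 h3)).elim
  have hChU : ∀ f q q', Ch f q → Ch f q' → q = q' := by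
    intro f q q' h1 h2
    by_cases hf : f ∈ N
    · have : ∀ q, Ch f q → f = q := by
        rintro q ⟨_, _, h3 | h3, _⟩
        · exact (hNS f hf h3.1.1).elim
        · exact h3
      rw [← this q h1, ← this q' h2]
    · have : ∀ q, Ch f q → f ∈ nx q (M q) ∧ f ∉ M q := by
        rintro q ⟨hq, h2, h3 | h3, _⟩
        · exact ⟨((hst' q hq).2.2.2.2.2 f h2).1, h3.1.2⟩
        · exact (hf (h3 ▸ hq)).elim
      exact htri q q' f h1.1 h2.1 (this q h1).1 (this q h1).2 (this q' h2).1 (this q' h2).2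
  let W2 : E → List E := fun f => if hf : ∃ q, Ch f q then W' hf.choose (M hf.choose) f else W f
  have hW2 : ∀ f q, Ch f q → W2 f = W' q (M q) f := by
    intro f q hq
    have h1 : ∃ q, Ch f q := ⟨q, hq⟩
    have h2 : h1.choose = q := hChU f _ _ h1.choose_spec hq
    simp only [W2, dif_pos h1, h2]
  have hW2' : ∀ f, (¬ ∃ q, Ch f q) → W2 f = W f := fun f hf => by simp only [W2, dif_neg hf]
  have hS2S : ∀ q, S2 q ⊆ S := fun q e he => he.1.1
  have hcutS : ∀ f ∈ G.cut (S ∪ N) X, (¬ ∃ q, Ch f q) → f ∈ G.cut S X := by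
    rintro f ⟨hf | hf, hf'⟩ hn
    · exact ⟨hf, hf'⟩
    · exact (hn ⟨f, hChN f hf⟩).elim
  have hmix : ∀ f ∈ G.cut (S ∪ N) X, ∀ g ∈ G.cut (S ∪ N) X, ∀ e ∈ W2 f, e ∈ W2 g →
      (∃ q, Ch f q) → (¬ ∃ q, Ch g q) → f = g := by
    rintro f hf g hg e hef heg ⟨q, hq⟩ hgn
    rw [hW2 f q hq] at hef
    rw [hW2' g hgn] at heg
    have hgS := hcutS g hg hgn
    have heS2 := hin f q hq.1 hq.2.2 e hef
    by_cases hgM : g ∈ M q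
    · exact (heS2.1.2 ((hWC (hGd q) g hgS g hgM (Or.inl rfl)).2 e heg)).elim
    · have hg2 := ((hWC (hGd q)).strand h hA hgS hgM).1
      have hg3 : g ∈ G.cut (S2 q ∪ {q}) X := ⟨Or.inl hg2, hgS.2⟩
      have hgJ : g ∉ J q (M q) := fun hgJ => hgn ⟨q, hq.1, hgJ, hg3⟩
      rw [← (hst' q hq.1).2.2.2.2.1 g hgJ] at heg
      exact (hst' q hq.1).2.2.1.dj f hq.2.2 g hg3 e hef heg
  refine ⟨W2, subset_rfl, ?_, ?_, ?_, ?_⟩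
  · intro f hf
    by_cases hc : ∃ q, Ch f q
    · obtain ⟨q, hq⟩ := hc
      rw [hW2 f q hq]
      exact (hst' q hq.1).2.2.1.st f hq.2.2
    · rw [hW2' f hc]
      exact h.st f (hcutS f hf hc)
  · intro f hf
    by_cases hc : ∃ q, Ch f q
    · obtain ⟨q, hq⟩ := hc
      rw [hW2 f q hq]
      exact (hst' q hq.1).2.2.1.nd f hq.2.2
    · rw [hW2' f hc]
      exact h.nd f (hcutS f hf hc)
  · intro f hf e he
    by_cases hc : ∃ q, Ch f q
    · obtain ⟨q, hq⟩ := hc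
      rw [hW2 f q hq] at he
      exact ⟨Or.inl (hS2S q (hin f q hq.1 hq.2.2 e he)), ((hst' q hq.1).2.2.1.ins f hq.2.2 e he).2⟩
    · rw [hW2' f hc] at he
      exact ⟨Or.inl (h.ins f (hcutS f hf hc) e he).1, (h.ins f (hcutS f hf hc) e he).2⟩
  · intro f hf g hg e hef heg
    by_cases hc : ∃ q, Ch f q
    · by_cases hc' : ∃ q, Ch g q
      · obtain ⟨q, hq⟩ := hc
        obtain ⟨q', hq'⟩ := hc'
        rw [hW2 f q hq] at hef
        rw [hW2 g q' hq'] at heg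
        have : q = q' := htri q q' e hq.1 hq'.1 (((hst' q hq.1).2.2.2.2.2 f hq.2.1).2 e hef)
          (hin f q hq.1 hq.2.2 e hef).1.2 (((hst' q' hq'.1).2.2.2.2.2 g hq'.2.1).2 e heg)
          (hin g q' hq'.1 hq'.2.2 e heg).1.2
        subst this
        exact (hst' q hq.1).2.2.1.dj f hq.2.2 g hq'.2.2 e hef heg
      · exact hmix f hf g hg e hef heg hc hc'
    · by_cases hc' : ∃ q, Ch g q
      · exact (hmix g hg f hf e heg hef hc' hc).symm
      · rw [hW2' f hc] at hef
        rw [hW2' g hc'] at heg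
        exact h.dj f (hcutS f hf hc) g (hcutS g hg hc') e hef heg

/-- Lemma S -/
theorem Loose.rel (hL : G.Loose S A z) (hP : G.Par S (Tm A z)) (hμ : Cardinal.aleph0 ≤ μ)
    (hC : G.Clo S (Tm A z) μ C) : G.Loose (G.rel (Tm A z) (S \ C)) A z := by
  intro j X W hX hcov e he hei
  set T := Tm A z with hT
  set S2 := G.rel T (S \ C) with hS2
  have hS2S : S2 ⊆ S := fun e he => he.1.1
  let X1 := X ∩ G.RV T (S \ C)
  have hAT : A j ⊆ T := fun x hx => Or.inr ⟨j, hx⟩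
  have hX1 : Adm A z j X1 := ⟨fun x hx => ⟨hX.sub hx, sub_RV (hAT hx)⟩,
    hX.dj.mono_left Set.inter_subset_left⟩
  have hboth : ∀ e ∈ S2, ∀ x y, G.Jn e x y → x ∈ G.RV T (S \ C) ∧ y ∈ G.RV T (S \ C) :=
    fun e he x y hj => ⟨((mem_rel hj).1 he).2, ((mem_rel hj.symm).1 he).2⟩
  have hcut : ∀ e, e ∈ G.cut S2 X1 ↔ e ∈ G.cut S2 X := by
    intro e
    rw [(Jn.self G e).mem_cut, (Jn.self G e).mem_cut]
    constructor
    · rintro ⟨h1, h2⟩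
      have := hboth e h1 _ _ (Jn.self G e)
      simp only [X1, Set.mem_inter_iff] at h2
      tauto
    · rintro ⟨h1, h2⟩
      have := hboth e h1 _ _ (Jn.self G e)
      simp only [X1, Set.mem_inter_iff]
      tauto
  have hins : ∀ e, e ∈ G.ins S2 X → e ∈ G.ins S2 X1 := by
    intro e
    rw [(Jn.self G e).mem_ins, (Jn.self G e).mem_ins]
    rintro ⟨h1, h2⟩
    have := hboth e h1 _ _ (Jn.self G e)
    simp only [X1, Set.mem_inter_iff]
    tauto
  have hcov1 : G.Cov S2 (A j) X1 (G.cut S2 X1) W :=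
    { sub := subset_rfl
      st := by
        intro f hf
        obtain ⟨a, ha, x, hx, y, hy, hj, hw⟩ := hcov.st f ((hcut f).1 hf)
        exact ⟨a, ha, x, ⟨hx, (hboth f hf.1 x y hj).1⟩, y, fun h => hy h.1, hj, hw⟩
      nd := fun f hf => hcov.nd f ((hcut f).1 hf)
      ins := fun f hf e he => hins e (hcov.ins f ((hcut f).1 hf) e he)
      dj := fun f hf g hg => hcov.dj f ((hcut f).1 hf) g ((hcut g).1 hg) }
  have hrob : ∀ q ∈ C, q ∈ S → ∀ x ∈ X1, ∀ y, G.Jn q x y → G.Rob S2 T μ x := by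
    intro q hqC hqS x hx y hj U hxU hUT
    have hxT : x ∉ T := fun h => Set.disjoint_left.1 hUT hxU h
    exact (hC.rob x hx.2 hxT q hqC hqS y hj).inf hμ hC.card hxU hx.2 hUT
  have hNN : ∀ q ∈ G.cut S X1, q ∉ S2 → q ∈ C := by
    intro q hq hqS
    obtain ⟨h1, x, hx, y, hy, hj⟩ := mem_cut_iff.1 hq
    by_contra hqC
    exact hqS ((mem_rel hj).2 ⟨⟨h1, hqC⟩, hx.2⟩)
  obtain ⟨W', hW'⟩ := lemN (N := G.cut S X1 ∩ C) hμ (hP.rel hμ hC) hAT (X := X1) (by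
      rintro x hx (rfl | ⟨i, hi⟩)
      · exact (hX1.nz hx).elim
      · by_cases hij : i = j
        · exact hij ▸ hi
        · exact (hX1.other hij hx hi).elim) hcov1 (fun q hq hq' => hq'.1.2 hq.2)
    ((Cardinal.mk_le_mk_of_subset Set.inter_subset_right).trans hC.card) (by
      rintro q ⟨hq, hqC⟩
      obtain ⟨h1, x, hx, y, hy, hj⟩ := mem_cut_iff.1 hq
      exact ⟨x, hx, y, hy, hj, hrob q hqC h1 x hx y hj⟩)
  have hsub : S2 ∪ G.cut S X1 ∩ C ⊆ S := Set.union_subset hS2S fun q hq => hq.1.1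
  have hceq : G.cut (S2 ∪ G.cut S X1 ∩ C) X1 = G.cut S X1 := by
    refine Set.Subset.antisymm (cut_mono hsub) ?_
    intro q hq
    by_cases hq2 : q ∈ S2
    · exact ⟨Or.inl hq2, hq.2⟩
    · exact ⟨Or.inr ⟨hq, hNN q hq hq2⟩, hq.2⟩
  rw [hceq] at hW'
  refine hL j X1 W' hX1 ⟨subset_rfl, hW'.st, hW'.nd, fun f hf e he => ins_mono hsub subset_rfl
    (hW'.ins f hf e he), hW'.dj⟩ e (cut_mono hS2S he) (ins_mono hS2S subset_rfl (hins e hei))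

end Gr
end LC

namespace LC

/-- bookkeeping sequences -/
theorem exists_seq {σ : Type*} (init : σ) (step : ℕ → σ → σ → σ) :
    ∃ s : ℕ → σ, s 0 = init ∧ ∀ n, s (n + 1) = step n (s n) (s (Nat.unpair n).1) := by
  let F : (n : ℕ) → ((m : ℕ) → m < n → σ) → σ := fun n ih =>
    match n, ih with
    | 0, _ => init
    | n + 1, ih => step n (ih n (Nat.lt_succ_self n))
        (ih (Nat.unpair n).1 (Nat.lt_succ_of_le (Nat.unpair_left_le n)))
  refine ⟨Nat.lt_wfRel.wf.fix F, ?_, fun n => ?_⟩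
  · rw [WellFounded.fix_eq]
  · rw [WellFounded.fix_eq]

/-- requests along a well-order -/
theorem exists_req (E : Type v) {μ : Cardinal.{v}} (hμ : Cardinal.aleph0 < μ) :
    ∃ (I : Type v) (_ : LinearOrder I) (_ : WellFoundedLT I), Cardinal.mk I ≤ μ ∧ Nonempty I ∧
      (∀ i : I, Cardinal.mk (Set.Iio i) < μ) ∧
      ∀ Q : Set E, ∃ Rq : I → Set E, (∀ i, Cardinal.mk (Rq i) ≤ max Cardinal.aleph0 (Cardinal.mk (Set.Iio i))) ∧
        Monotone Rq ∧ (Cardinal.mk Q ≤ μ → ∀ f ∈ Q, ∃ i, f ∈ Rq i) ∧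
        ∀ i, Cardinal.mk Q ≤ max Cardinal.aleph0 (Cardinal.mk (Set.Iio i)) → ∀ f ∈ Q, ∀ j, j < i →
          ∃ j', j' < i ∧ f ∈ Rq j' := by
  classical
  have hIio : ∀ i : μ.ord.ToType, Cardinal.mk (Set.Iio i) < μ := fun i => by
    simpa using Cardinal.mk_Iio_lt i (by simp)
  refine ⟨μ.ord.ToType, inferInstance, inferInstance, by simp, ?_, hIio, ?_⟩
  · rw [← Cardinal.mk_ne_zero_iff, Cardinal.mk_ord_toType]
    exact (Cardinal.aleph0_pos.trans hμ).ne'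
  intro Q
  by_cases hQ0 : Cardinal.mk Q ≤ Cardinal.aleph0
  · refine ⟨fun _ => Q, fun _ => hQ0.trans (le_max_left _ _), fun _ _ _ => subset_rfl, ?_, ?_⟩
    · intro _ f hf
      have : Nonempty μ.ord.ToType := by
        rw [← Cardinal.mk_ne_zero_iff, Cardinal.mk_ord_toType]
        exact (Cardinal.aleph0_pos.trans hμ).ne'
      exact ⟨this.some, hf⟩
    · intro i _ f hf j hj
      exact ⟨j, hj, hf⟩
  by_cases hQ : Cardinal.mk Q ≤ μ
  · obtain ⟨g⟩ : Nonempty (Q ≃ (Cardinal.mk Q).ord.ToType) := Cardinal.eq.1 (by simp)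
    obtain ⟨ϕ⟩ : Nonempty (InitialSeg
        (· < · : (Cardinal.mk Q).ord.ToType → (Cardinal.mk Q).ord.ToType → Prop)
        (· < · : μ.ord.ToType → μ.ord.ToType → Prop)) := by
      rw [← Ordinal.type_le_iff, Ordinal.type_toType, Ordinal.type_toType]
      exact Cardinal.ord_le_ord.2 hQ
    refine ⟨fun i => {f | ∃ hf : f ∈ Q, ϕ (g ⟨f, hf⟩) ≤ i}, ?_, ?_, ?_, ?_⟩
    · intro i
      have h1 : Cardinal.mk (Set.Iic i) ≤ max Cardinal.aleph0 (Cardinal.mk (Set.Iio i)) := by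
        rw [← Set.Iio_union_right]
        refine (Cardinal.mk_union_le _ _).trans (Cardinal.add_le_of_le (le_max_left _ _) (le_max_right _ _) ?_)
        rw [Cardinal.mk_singleton]
        exact Cardinal.one_le_aleph0.trans (le_max_left _ _)
      refine le_trans ?_ h1
      refine Cardinal.mk_le_of_injective
        (f := fun f : {f | ∃ hf : f ∈ Q, ϕ (g ⟨f, hf⟩) ≤ i} => (⟨ϕ (g ⟨f.1, f.2.1⟩), f.2.2⟩ : Set.Iic i)) ?_
      intro a b hab
      have h2 := ϕ.injective (congrArg Subtype.val hab)
      have h3 := g.injective h2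
      exact Subtype.ext (Subtype.mk.inj h3)
    · rintro i j hij f ⟨hf, h⟩
      exact ⟨hf, h.trans hij⟩
    · intro _ f hf
      exact ⟨ϕ (g ⟨f, hf⟩), hf, le_rfl⟩
    · intro i hi f hf j hj
      have hi' : Cardinal.mk Q ≤ Cardinal.mk (Set.Iio i) := by
        rcases le_max_iff.1 hi with h | h
        · exact (hQ0 h).elim
        · exact h
      refine ⟨ϕ (g ⟨f, hf⟩), ?_, hf, le_rfl⟩
      by_contra hn
      push Not at hn
      have h1 : i ∈ Set.range ϕ := by
        rcases hn.lt_or_eq with h | h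
        · exact ϕ.mem_range_of_rel h
        · exact ⟨_, h.symm⟩
      obtain ⟨a, rfl⟩ := h1
      have h2 : Cardinal.mk (Set.Iio a) < Cardinal.mk Q := by
        simpa using Cardinal.mk_Iio_lt a (by simp)
      have h3 : Set.Iio (ϕ a) ⊆ ϕ '' Set.Iio a := by
        intro b hb
        obtain ⟨c, rfl⟩ := ϕ.mem_range_of_rel hb
        exact ⟨c, (ϕ.map_rel_iff).1 hb, rfl⟩
      exact (hi'.trans ((Cardinal.mk_le_mk_of_subset h3).trans Cardinal.mk_image_le)).not_gt h2
  · refine ⟨fun _ => ∅, fun _ => by simp, fun _ _ _ => subset_rfl, fun h => (hQ h).elim, ?_⟩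
    intro i hi
    exact (hQ (hi.trans (max_le hμ.le (hIio i).le))).elim

namespace Gr
variable {V : Type u} {E : Type v} {ι : Type w} {G G' : Gr V E} {S S' S1 P P' C D : Set E}
  {X X0 Y U T A0 : Set V} {A : ι → Set V} {z : V} {μ : Cardinal.{v}}

/-- full systems -/
def FS (G : Gr V E) (A : ι → Set V) (D : Set E) : Prop :=
  ∃ Ps : Set (List E), (∀ p ∈ Ps, G.Good A p ∧ ∀ e ∈ p, e ∈ D) ∧
    (∀ p ∈ Ps, ∀ q ∈ Ps, ∀ e ∈ p, e ∈ q → p = q) ∧ ∀ i, ∀ e ∈ G.cut D (A i), ∃ p ∈ Ps, e ∈ p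

/-- the induction statement -/
def PP (G : Gr V E) (A : ι → Set V) (z : V) (μ : Cardinal.{v}) : Prop :=
  ∀ S, G.Loose S A z → G.Par S (Tm A z) → (∀ e ∈ S, G.s e ≠ z ∧ G.t e ≠ z) →
    ∀ R : E → Set E, (∀ e, Cardinal.mk (R e) ≤ μ) → ∀ E0 : Set E, Cardinal.mk E0 ≤ μ →
      ∃ D, E0 ⊆ D ∧ Cardinal.mk D ≤ μ ∧ (∀ e ∈ D, R e ⊆ D) ∧ G.FS A (D ∩ S)

theorem PP_base (hA : Dis A z) : G.PP A z Cardinal.aleph0 := by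
  classical
  intro S hL hP hz R hR E0 hE0
  rcases isEmpty_or_nonempty E with hE | hE
  · exact ⟨∅, fun e => (hE.false e).elim, by simp, by simp, ∅, by simp, by simp,
      fun _ e => (hE.false e).elim⟩
  let Inv : Set E → Prop := fun S1 => S1 ⊆ S ∧ G.Res S1 A z ∧ G.Par S1 (Tm A z)
  have hop : ∀ S1 e, ∃ p : List E, Inv S1 → (∀ e' ∈ p, e' ∈ S1) ∧ (p = [] ∨ G.Good A p) ∧
      Inv (S1 \ {e' | e' ∈ p}) ∧ ∀ i, e ∈ G.cut S1 (A i) → e ∈ p := by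
    intro S1 e
    by_cases h : Inv S1 ∧ ∃ i, e ∈ G.cut S1 (A i)
    · obtain ⟨⟨h1, h2, h3⟩, i, hi⟩ := h
      obtain ⟨p, hp1, hp2, hp3, hp4⟩ := one_path h2 h3 (fun e he => hz e (h1 he)) hi
      refine ⟨p, fun _ => ⟨hp2, Or.inr hp3, ⟨Set.sdiff_subset.trans h1, hp4, ?_⟩, fun _ _ => hp1⟩⟩
      obtain ⟨i, j, a, b, hij, ha, hb, hw, hn, _⟩ := hp3
      exact Par.delete h3 hw hn hp2 (Or.inr ⟨i, ha⟩) (Or.inr ⟨j, hb⟩)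
    · refine ⟨[], fun hI => ⟨by simp, Or.inl rfl, by simpa using hI, fun i hi => (h ⟨hI, i, hi⟩).elim⟩⟩
  choose pt hpt using hop
  have hcl : ∀ D : Set E, ∃ D' : Set E, D.Countable → D ⊆ D' ∧ D'.Countable ∧ ∀ e ∈ D', R e ⊆ D' := by
    intro D
    by_cases hD : D.Countable
    · obtain ⟨D', h1, h2, h3⟩ := exists_closure R le_rfl hR D (Cardinal.le_aleph0_iff_set_countable.2 hD)
      exact ⟨D', fun _ => ⟨h1, Cardinal.le_aleph0_iff_set_countable.1 h2, h3⟩⟩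
    · exact ⟨∅, fun h => (hD h).elim⟩
  choose cl hcl using hcl
  have hen : ∀ D : Set E, ∃ g : ℕ → E, D.Countable → D ⊆ Set.range g := by
    intro D
    by_cases hD : D.Countable ∧ D.Nonempty
    · obtain ⟨g, hg⟩ := hD.1.exists_eq_range hD.2
      exact ⟨g, fun _ => hg.le⟩
    · refine ⟨fun _ => hE.some, fun h => ?_⟩
      have : D = ∅ := Set.not_nonempty_iff_eq_empty.1 fun h' => hD ⟨h, h'⟩
      simp [this]
  choose en hen using hen
  obtain ⟨s, hs0, hs⟩ := exists_seq (σ := Set E × Set E) (S, cl E0) (fun n x y =>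
    (x.1 \ {e | e ∈ pt x.1 (en y.2 (Nat.unpair n).2)},
      cl (x.2 ∪ {e | e ∈ pt x.1 (en y.2 (Nat.unpair n).2)})))
  let pa : ℕ → List E := fun n => pt (s n).1 (en (s (Nat.unpair n).1).2 (Nat.unpair n).2)
  have hs1 : ∀ n, (s (n + 1)).1 = (s n).1 \ {e | e ∈ pa n} := fun n => by rw [hs]
  have hs2 : ∀ n, (s (n + 1)).2 = cl ((s n).2 ∪ {e | e ∈ pa n}) := fun n => by rw [hs]
  have hInv : ∀ n, Inv (s n).1 := by
    intro n
    induction n with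
    | zero =>
      rw [hs0]
      exact ⟨subset_rfl, ⟨A, fun _ _ => [], fun i => TL.triv G S (A i), hA, hL⟩, hP⟩
    | succ n ih => rw [hs1]; exact (hpt _ _ ih).2.2.1
  have hE0c := Cardinal.le_aleph0_iff_set_countable.1 hE0
  have hDc : ∀ n, (s n).2.Countable ∧ ∀ e ∈ (s n).2, R e ⊆ (s n).2 := by
    intro n
    induction n with
    | zero => rw [hs0]; exact (hcl _ hE0c).2
    | succ n ih =>
      rw [hs2]
      exact (hcl _ (ih.1.union ((pa n).finite_toSet.countable))).2
  have hDs : ∀ n, (s n).2 ∪ {e | e ∈ pa n} ⊆ (s (n + 1)).2 := by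
    intro n
    rw [hs2]
    exact (hcl _ ((hDc n).1.union ((pa n).finite_toSet.countable))).1
  have hanti : ∀ m n, m ≤ n → (s n).1 ⊆ (s m).1 := by
    intro m n hmn
    induction hmn with
    | refl => exact subset_rfl
    | step h ih => rw [hs1]; exact Set.sdiff_subset.trans ih
  have hpaS : ∀ n, ∀ e ∈ pa n, e ∈ (s n).1 := fun n => (hpt _ _ (hInv n)).1
  have hdj : ∀ m n e, e ∈ pa m → e ∈ pa n → m = n := by
    have : ∀ m n e, e ∈ pa m → e ∈ pa n → ¬ m < n := by
      intro m n e hm hn hmn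
      have h1 := hanti (m + 1) n hmn (hpaS n e hn)
      rw [hs1] at h1
      exact h1.2 hm
    intro m n e hm hn
    have h1 := this m n e hm hn
    have h2 := this n m e hn hm
    omega
  have hrem : ∀ n e, e ∈ S → e ∉ (s n).1 → ∃ m, e ∈ pa m := by
    intro n e heS
    induction n with
    | zero => rw [hs0]; exact fun h => (h heS).elim
    | succ n ih =>
      rw [hs1]
      intro h
      by_cases h' : e ∈ (s n).1
      · exact ⟨n, by_contra fun h'' => h ⟨h', h''⟩⟩
      · exact ih h'
  refine ⟨⋃ n, (s n).2, ?_, ?_, ?_, {p | ∃ n, p = pa n ∧ p ≠ []}, ?_, ?_, ?_⟩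
  · refine Set.Subset.trans ?_ (Set.subset_iUnion (fun n => (s n).2) 0)
    rw [hs0]
    exact (hcl _ hE0c).1
  · exact Cardinal.le_aleph0_iff_set_countable.2 (Set.countable_iUnion fun n => (hDc n).1)
  · intro e he
    obtain ⟨n, hn⟩ := Set.mem_iUnion.1 he
    exact ((hDc n).2 e hn).trans (Set.subset_iUnion (fun n => (s n).2) n)
  · rintro p ⟨n, rfl, hp⟩
    refine ⟨(hpt _ _ (hInv n)).2.1.resolve_left hp, fun e he => ⟨?_, (hInv n).1 (hpaS n e he)⟩⟩
    exact Set.mem_iUnion.2 ⟨n + 1, hDs n (Or.inr he)⟩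
  · rintro p ⟨n, rfl, hp⟩ q ⟨m, rfl, hq⟩ e he he'
    rw [hdj n m e he he']
  · rintro i e ⟨⟨heD, heS⟩, hec⟩
    suffices h : ∃ n, e ∈ pa n by
      obtain ⟨n, hn⟩ := h
      exact ⟨pa n, ⟨n, rfl, List.ne_nil_of_mem hn⟩, hn⟩
    obtain ⟨m, hm⟩ := Set.mem_iUnion.1 heD
    obtain ⟨k, hk⟩ := hen _ (hDc m).1 hm
    by_cases h : e ∈ (s (Nat.pair m k)).1
    · refine ⟨Nat.pair m k, ?_⟩
      have h1 := (hpt _ e (hInv (Nat.pair m k))).2.2.2 i ⟨h, hec⟩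
      simp only [pa, Nat.unpair_pair, hk]
      exact h1
    · exact hrem _ e heS h

end Gr
end LC

namespace LC
namespace Gr
variable {V : Type u} {E : Type v} {ι : Type w} {G G' : Gr V E} {S S' S1 P P' C D : Set E}
  {X X0 Y U T A0 : Set V} {A : ι → Set V} {z : V} {μ : Cardinal.{v}}

theorem not_RV {x : V} (hx : x ∈ U) (hU : Disjoint U T) (hc : G.cut S U ⊆ C) :
    x ∉ G.RV T (S \ C) := by
  rintro ⟨a, ha, hr⟩
  have := hr.symm.mem_of_closed hx (by
    intro e he hc'
    exact he.2 (hc ⟨he.1, hc'.2⟩))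
  exact Set.disjoint_left.1 hU this ha

theorem exists_minCut (G : Gr V E) (S : Set E) (T : Set V) (x : V) :
    ∃ F : Set E, x ∉ T → (∃ U : Set V, x ∈ U ∧ Disjoint U T ∧ G.cut S U = F) ∧
      ∀ U : Set V, x ∈ U → Disjoint U T → Cardinal.mk F ≤ Cardinal.mk (G.cut S U) := by
  by_cases hx : x ∈ T
  · exact ⟨∅, fun h => (h hx).elim⟩
  · obtain ⟨c, ⟨U, h1, h2, rfl⟩, hm⟩ := (wellFounded_lt (α := Cardinal.{v})).has_min
      {c | ∃ U : Set V, x ∈ U ∧ Disjoint U T ∧ Cardinal.mk (G.cut S U) = c}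
      ⟨_, {x}, rfl, Set.disjoint_singleton_left.2 hx, rfl⟩
    refine ⟨G.cut S U, fun _ => ⟨⟨U, h1, h2, rfl⟩, fun U' h3 h4 => ?_⟩⟩
    exact not_lt.1 (hm _ ⟨U', h3, h4, rfl⟩)

theorem PP_step (hμ : Cardinal.aleph0 < μ)
    (ih : ∀ ν, Cardinal.aleph0 ≤ ν → ν < μ → G.PP A z ν) : G.PP A z μ := by
  classical
  intro S hL hP hz R hR E0 hE0
  obtain ⟨I, _, _, hIμ, hIne, hIio, hreq⟩ := exists_req E hμ
  choose Rq hq1 hq2 hq3 hq4 using hreq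
  set T := Tm A z with hT
  choose F hF using fun x => exists_minCut G S T x
  let ν : I → Cardinal.{v} := fun i => max Cardinal.aleph0 (Cardinal.mk (Set.Iio i))
  have hν0 : ∀ i, Cardinal.aleph0 ≤ ν i := fun i => le_max_left _ _
  have hνμ : ∀ i, ν i < μ := fun i => max_lt hμ (hIio i)
  have hνm : ∀ i j, i ≤ j → ν i ≤ ν j := fun i j hij => max_le_max le_rfl
    (Cardinal.mk_le_mk_of_subset (Set.Iio_subset_Iio hij))
  let Rj : I → E → Set E := fun j e => Rq (R e) j ∪ (Rq (F (G.s e)) j ∪ Rq (F (G.t e)) j)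
  have hRj : ∀ j e, Cardinal.mk (Rj j e) ≤ ν j := fun j e =>
    (Cardinal.mk_union_le _ _).trans (Cardinal.add_le_of_le (hν0 j) (hq1 _ j)
      ((Cardinal.mk_union_le _ _).trans (Cardinal.add_le_of_le (hν0 j) (hq1 _ j) (hq1 _ j))))
  have stage : ∀ j D, ∃ D' : Set E, G.Clo S T (ν j) D →
      D ⊆ D' ∧ Rq E0 j ⊆ D' ∧ Cardinal.mk D' ≤ ν j ∧ (∀ e ∈ D', Rj j e ⊆ D') ∧
      G.FS A (D' ∩ G.rel T (S \ D)) := by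
    intro j D
    by_cases hD : G.Clo S T (ν j) D
    · obtain ⟨D', h1, h2, h3, h4⟩ := ih (ν j) (hν0 j) (hνμ j) (G.rel T (S \ D))
        (hL.rel hP (hν0 j) hD) (hP.rel (hν0 j) hD) (fun e he => hz e he.1.1) (Rj j) (hRj j)
        (D ∪ Rq E0 j) ((Cardinal.mk_union_le _ _).trans (Cardinal.add_le_of_le (hν0 j) hD.card
          (hq1 _ j)))
      exact ⟨D', fun _ => ⟨Set.subset_union_left.trans h1, Set.subset_union_right.trans h1, h2, h3, h4⟩⟩
    · exact ⟨∅, fun h => (hD h).elim⟩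
  choose nx hnx using stage
  have wf : WellFounded (· < · : I → I → Prop) := wellFounded_lt
  obtain ⟨D, hDdef⟩ : ∃ D : I → Set E, ∀ i, D i = ⋃ j : Set.Iio i, nx j.1 (D j.1) :=
    ⟨wf.fix fun i ih => ⋃ j : Set.Iio i, nx j.1 (ih j.1 j.2), fun i => wf.fix_eq _ i⟩
  let N : I → Set E := fun i => nx i (D i)
  have hsubD : ∀ i j, i < j → N i ⊆ D j := by
    intro i j hij
    rw [hDdef j]
    exact Set.subset_iUnion (fun j' : Set.Iio j => nx j'.1 (D j'.1)) ⟨i, hij⟩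
  have hmemD : ∀ i e, e ∈ D i → ∃ j, j < i ∧ e ∈ N j := by
    intro i e he
    rw [hDdef i] at he
    obtain ⟨j, hj⟩ := Set.mem_iUnion.1 he
    exact ⟨j.1, j.2, hj⟩
  have hGd : ∀ i, G.Clo S T (ν i) (D i) := by
    intro i
    induction i using wf.induction with
    | _ i ih =>
      have ih' := fun j hj => hnx j (D j) (ih j hj)
      refine ⟨?_, ?_⟩
      · rw [hDdef]
        refine (Cardinal.mk_iUnion_le _).trans ?_
        refine (mul_le_mul' (le_max_right Cardinal.aleph0 _) (ciSup_le' fun j : Set.Iio i => ?_)).trans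
          (Cardinal.mul_eq_self (hν0 i)).le
        exact (ih' j.1 j.2).2.2.1.trans (hνm _ _ (le_of_lt j.2))
      · intro x hx hxT e he heS y hj
        by_contra hr
        unfold Rob at hr
        push Not at hr
        obtain ⟨U, hxU, hUT, hU⟩ := hr
        obtain ⟨⟨U', hxU', hUT', hU'⟩, hmin⟩ := hF x hxT
        refine not_RV hxU' hUT' ?_ hx
        rw [hU']
        intro f hf
        obtain ⟨j, hji, hej⟩ := hmemD i e he
        obtain ⟨j', hj'i, hfj'⟩ := hq4 (F x) i ((hmin U hxU hUT).trans hU) f hf j hji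
        have hmi : max j j' < i := max_lt hji hj'i
        have he' : e ∈ N (max j j') := by
          rcases (le_max_left j j').lt_or_eq with h | h
          · exact (ih' _ hmi).1 (hsubD _ _ h hej)
          · rw [← h]; exact hej
        have hf' : f ∈ Rq (F x) (max j j') := hq2 (F x) (le_max_right j j') hfj'
        refine hsubD _ _ hmi ((ih' _ hmi).2.2.2.1 e he' ?_)
        obtain ⟨rfl, rfl⟩ | ⟨rfl, rfl⟩ := hj
        · exact Or.inr (Or.inl hf')
        · exact Or.inr (Or.inr hf')
  have hN := fun i => hnx i (D i) (hGd i)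
  have hNm : ∀ i j, i ≤ j → N i ⊆ N j := by
    intro i j hij
    rcases hij.lt_or_eq with h | rfl
    · exact (hsubD i j h).trans (hN j).1
    · exact subset_rfl
  choose Ps hPs1 hPs2 hPs3 using fun i => (hN i).2.2.2.2
  have htri : ∀ i j e, e ∈ N i → e ∉ D i → e ∈ N j → e ∉ D j → i = j := by
    intro i j e h1 h2 h3 h4
    rcases lt_trichotomy i j with h | h | h
    · exact (h4 (hsubD i j h h1)).elim
    · exact h
    · exact (h2 (hsubD j i h h3)).elim
  refine ⟨⋃ i, N i, ?_, ?_, ?_, ⋃ i, Ps i, ?_, ?_, ?_⟩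
  · intro f hf
    obtain ⟨i, hi⟩ := hq3 E0 hE0 f hf
    exact Set.mem_iUnion.2 ⟨i, (hN i).2.1 hi⟩
  · refine (Cardinal.mk_iUnion_le _).trans ?_
    refine (mul_le_mul' hIμ (ciSup_le' fun i => ?_)).trans (Cardinal.mul_eq_self hμ.le).le
    exact (hN i).2.2.1.trans (hνμ i).le
  · intro e he f hf
    obtain ⟨i, hi⟩ := Set.mem_iUnion.1 he
    obtain ⟨j, hj⟩ := hq3 (R e) (hR e) f hf
    refine Set.mem_iUnion.2 ⟨max i j, (hN _).2.2.2.1 e (hNm _ _ (le_max_left i j) hi) (Or.inl ?_)⟩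
    exact hq2 (R e) (le_max_right i j) hj
  · intro p hp
    obtain ⟨i, hi⟩ := Set.mem_iUnion.1 hp
    refine ⟨(hPs1 i p hi).1, fun e he => ?_⟩
    have := (hPs1 i p hi).2 e he
    exact ⟨Set.mem_iUnion.2 ⟨i, this.1⟩, this.2.1.1⟩
  · intro p hp q hq e hep heq
    obtain ⟨i, hi⟩ := Set.mem_iUnion.1 hp
    obtain ⟨j, hj⟩ := Set.mem_iUnion.1 hq
    have h1 := (hPs1 i p hi).2 e hep
    have h2 := (hPs1 j q hj).2 e heq
    have : i = j := htri i j e h1.1 h1.2.1.2 h2.1 h2.2.1.2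
    subst this
    exact hPs2 i p hi q hj e hep heq
  · rintro m e ⟨⟨heN, heS⟩, hec⟩
    obtain ⟨j, hj, hmin⟩ := wf.has_min {j | e ∈ N j} (by
      obtain ⟨i, hi⟩ := Set.mem_iUnion.1 heN
      exact ⟨i, hi⟩)
    have heD : e ∉ D j := by
      intro h
      obtain ⟨j', h1, h2⟩ := hmemD j e h
      exact hmin j' h2 h1
    have hrel : e ∈ G.rel T (S \ D j) := by
      obtain ⟨_, x, hx, y, hy, hj⟩ := mem_cut_iff.1 (show e ∈ G.cut S (A m) from ⟨heS, hec⟩)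
      exact (mem_rel hj).2 ⟨⟨heS, heD⟩, sub_RV (Or.inr ⟨m, hx⟩)⟩
    obtain ⟨p, hp, hep⟩ := hPs3 j m e ⟨⟨hj, hrel⟩, hec⟩
    exact ⟨p, Set.mem_iUnion.2 ⟨j, hp⟩, hep⟩

theorem PP_all (hA : Dis A z) (hμ : Cardinal.aleph0 ≤ μ) : G.PP A z μ := by
  induction μ using (wellFounded_lt (α := Cardinal.{v})).induction with
  | _ μ ih =>
    rcases hμ.eq_or_lt with rfl | h
    · exact PP_base hA
    · exact PP_step h fun ν h1 h2 => ih ν h2 h1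

theorem full_system (hA : Dis A z) (hL : G.Loose S A z) (hP : G.Par S (Tm A z))
    (hz : ∀ e ∈ S, G.s e ≠ z ∧ G.t e ≠ z) : G.FS A S := by
  have hm := le_max_left Cardinal.aleph0 (Cardinal.mk E)
  obtain ⟨D, h1, _, _, h2⟩ := PP_all (G := G) hA hm S hL hP hz
    (fun _ => ∅) (by simp) Set.univ (by simp)
  rwa [Set.univ_subset_iff.1 h1, Set.univ_inter] at h2

end Gr
end LC

namespace LC
namespace Gr
variable {V : Type u} {E : Type v} {ι : Type w} {G : Gr V E} {S : Set E} {X : ι → Set V} {Y : Set V}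

theorem Wlk.first_out {a b : V} {p : List E} (h : G.Wlk a p b) (ha : a ∈ Y) (hb : b ∉ Y)
    (hi : ∀ e ∈ p, e ∉ G.ins Set.univ Y) : ∃ e ∈ p, ∃ y, y ∉ Y ∧ G.Jn e a y := by
  cases p with
  | nil => cases h; exact absurd ha hb
  | cons e l =>
    obtain ⟨c, hc, _⟩ := h
    refine ⟨e, by simp, c, ?_, hc⟩
    intro h'
    exact hi e (by simp) (hc.mem_ins.2 ⟨trivial, ha, h'⟩)

theorem SP.inc {a b x : V} {l : List E} {vs : List V} (h : G.SP a l b vs) (hx : x ∈ vs) :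
    x = a ∨ ∃ e ∈ l, ∃ y, G.Jn e y x := by
  induction l generalizing a vs with
  | nil =>
    obtain ⟨rfl, rfl⟩ := h
    left; simpa using hx
  | cons e l ih =>
    obtain ⟨c, vs', hc, h', rfl⟩ := h
    rcases List.mem_cons.1 hx with rfl | hx
    · exact Or.inl rfl
    · right
      rcases ih h' hx with rfl | ⟨e', he', y, hy⟩
      · exact ⟨e, by simp, a, hc⟩
      · exact ⟨e', by simp [he'], y, hy⟩

/-- extending a good trail of the reduced graph to a path between original terminals -/
theorem extend {W : ι → E → List E} {τ : ι → V} {p : List E}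
    (hX : ∀ i j, i ≠ j → Disjoint (X i) (X j)) (hτ : ∀ i, τ i ∈ X i)
    (hc : ∀ i, G.Cov Set.univ {τ i} (X i) (G.cut Set.univ (X i)) (W i))
    (hg : G.Good X p) (hp : ∀ m, ∀ e ∈ p, e ∉ G.ins Set.univ (X m)) :
    ∃ i j l vs, i ≠ j ∧ G.SP (τ i) l (τ j) vs ∧ vs.Nodup ∧ (∀ m, τ m ∈ vs → m = i ∨ m = j) ∧
      (∀ e ∈ l, e ∈ p ∨ ∃ m f, f ∈ p ∧ f ∈ G.cut Set.univ (X m) ∧ e ∈ W m f) ∧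
      (∀ m, ∀ e ∈ l, e ∈ G.cut Set.univ (X m) → e ∈ p) ∧
      ∀ m, ∀ e ∈ p, e ∈ G.cut Set.univ (X m) → (m = i ∨ m = j) ∧
        ∀ e' ∈ p, e' ∈ G.cut Set.univ (X m) → e = e' := by
  obtain ⟨i, j, a, b, hij, ha, hb, hw, hn, hu⟩ := hg
  have hXX : ∀ {m m' : ι} {x : V}, x ∈ X m → x ∈ X m' → m = m' := by
    intro m m' x h1 h2
    by_contra hne
    exact Set.disjoint_left.1 (hX m m' hne) h1 h2
  have key : ∀ {m : ι} {a b : V} {p : List E}, G.Wlk a p b → a ∈ X m → b ∉ X m →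
      (∀ e ∈ p, e ∉ G.ins Set.univ (X m)) →
      ∃ f ∈ p, f ∈ G.cut Set.univ (X m) ∧ G.Wlk (τ m) (W m f) a := by
    intro m a b p hw ha hb hp
    obtain ⟨f, hf, y, hy, hj⟩ := hw.first_out ha hb hp
    have hfc : f ∈ G.cut Set.univ (X m) := hj.mem_cut.2 ⟨trivial, Or.inl ⟨ha, hy⟩⟩
    obtain ⟨a', rfl, x, hx, y', hy', hj', hw'⟩ := (hc m).st f hfc
    refine ⟨f, hf, hfc, ?_⟩
    rcases hj.pair hj' with ⟨rfl, _⟩ | ⟨rfl, _⟩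
    · exact hw'
    · exact absurd hx hy
  obtain ⟨f, hf, hfc, hfw⟩ := key hw ha (fun h => hij (hXX h hb)) (hp i)
  obtain ⟨g, hg, hgc, hgw⟩ := key hw.reverse hb (fun h => hij (hXX ha h))
    (fun e he => hp j e (List.mem_reverse.1 he))
  have hg := List.mem_reverse.1 hg
  obtain ⟨l, vs, hsp, hvs, hl⟩ := ((hfw.append hw).append hgw.reverse).simple
  have hl' : ∀ e ∈ l, e ∈ p ∨ e ∈ W i f ∨ e ∈ W j g := by
    intro e he
    have := hl e he
    simp only [List.mem_append, List.mem_reverse] at this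
    tauto
  have hl2 : ∀ e ∈ l, e ∈ p ∨ e ∈ G.ins Set.univ (X i) ∨ e ∈ G.ins Set.univ (X j) := by
    intro e he
    rcases hl' e he with h | h | h
    · exact Or.inl h
    · exact Or.inr (Or.inl ((hc i).ins f hfc e h))
    · exact Or.inr (Or.inr ((hc j).ins g hgc e h))
  have hic : ∀ m m' e, e ∈ G.ins Set.univ (X m) → e ∉ G.cut Set.univ (X m') := by
    rintro m m' e h ⟨_, ⟨h1, h2⟩ | ⟨h1, h2⟩⟩
    · obtain rfl := hXX h.2.1 h1
      exact h2 h.2.2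
    · obtain rfl := hXX h.2.2 h1
      exact h2 h.2.1
  refine ⟨i, j, l, vs, hij, hsp, hvs, ?_, ?_, ?_, hu⟩
  · intro m hm
    rcases hsp.inc hm with h | ⟨e, he, y, hy⟩
    · exact Or.inl (hXX (hτ m) (h ▸ hτ i))
    · rcases hl2 e he with h | h | h
      · by_cases hy' : y ∈ X m
        · exact (hp m e h (hy.mem_ins.2 ⟨trivial, hy', hτ m⟩)).elim
        · exact (hu m e h (hy.mem_cut.2 ⟨trivial, Or.inr ⟨hτ m, hy'⟩⟩)).1
      · exact Or.inl (hXX (hτ m) (hy.mem_ins.1 h).2.2)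
      · exact Or.inr (hXX (hτ m) (hy.mem_ins.1 h).2.2)
  · intro e he
    rcases hl' e he with h | h | h
    · exact Or.inl h
    · exact Or.inr ⟨i, f, hf, hfc, h⟩
    · exact Or.inr ⟨j, g, hg, hgc, h⟩
  · intro m e he hec
    rcases hl2 e he with h | h | h
    · exact h
    · exact absurd hec (hic _ _ _ h)
    · exact absurd hec (hic _ _ _ h)

end Gr

variable {V : Type u} {E : Type v}

/-- the auxiliary graph of a multigraph, with an additional isolated vertex -/
noncomputable def toGr (G : Multigraph V E) : Gr (Option V) E where
  s e := some (Quot.out (G.inc e)).1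
  t e := some (Quot.out (G.inc e)).2

theorem toGr_jn {G : Multigraph V E} {e : E} {x y : V} :
    (toGr G).Jn e (some x) (some y) ↔ G.inc e = s(x, y) := by
  have h : G.inc e = s((Quot.out (G.inc e)).1, (Quot.out (G.inc e)).2) :=
    (Quot.out_eq (G.inc e)).symm
  rw [h, Sym2.eq_iff]
  simp only [Gr.Jn, toGr, Option.some.injEq]

theorem toGr_some {G : Multigraph V E} {e : E} {x y : Option V} (h : (toGr G).Jn e x y) :
    ∃ a b, x = some a ∧ y = some b ∧ G.inc e = s(a, b) := by
  have : ∃ a b, x = some a ∧ y = some b := by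
    rcases h with ⟨h1, h2⟩ | ⟨h1, h2⟩
    · exact ⟨_, _, h1.symm, h2.symm⟩
    · exact ⟨_, _, h2.symm, h1.symm⟩
  obtain ⟨a, b, rfl, rfl⟩ := this
  exact ⟨a, b, rfl, rfl, toGr_jn.1 h⟩

theorem toGr_cut {G : Multigraph V E} (U : Set (Option V)) :
    G.cut {x | some x ∈ U} = (toGr G).cut Set.univ U := by
  ext e
  rw [Gr.mem_cut_iff]
  constructor
  · rintro ⟨x, y, h, hx, hy⟩
    exact ⟨trivial, some x, hx, some y, hy, toGr_jn.2 h⟩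
  · rintro ⟨_, x, hx, y, hy, h⟩
    obtain ⟨a, b, rfl, rfl, h'⟩ := toGr_some h
    exact ⟨a, b, h', hx, hy⟩

theorem toGr_walk {G : Multigraph V E} {a b : V} {l : List E} {vs : List (Option V)}
    (h : (toGr G).SP (some a) l (some b) vs) :
    ∃ w : G.Walk a b, w.edges = l ∧ w.support.map some = vs := by
  induction l generalizing a vs with
  | nil =>
    obtain ⟨h, rfl⟩ := h
    obtain rfl := Option.some.inj h
    exact ⟨.nil a, rfl, rfl⟩
  | cons e l ih =>
    obtain ⟨c, vs', hc, h', rfl⟩ := h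
    obtain ⟨_, c', h1, rfl, h2⟩ := toGr_some hc
    obtain rfl := Option.some.inj h1
    obtain ⟨w, h3, h4⟩ := ih h'
    exact ⟨.cons e h2 w, by rw [Multigraph.Walk.edges, h3], by
      rw [Multigraph.Walk.support, List.map_cons, h4]⟩

theorem Walk_cross {G : Multigraph V E} {a b : V} (w : G.Walk a b) {X : Set V}
    (h : (a ∈ X ∧ b ∉ X) ∨ (b ∈ X ∧ a ∉ X)) : ∃ e ∈ w.edges, e ∈ G.cut X := by
  induction w with
  | nil v => tauto
  | @cons u v w e he p ih =>
    by_cases hv : (u ∈ X ↔ v ∈ X)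
    · obtain ⟨e', h1, h2⟩ := ih (by tauto)
      exact ⟨e', by rw [Multigraph.Walk.edges]; simp [h1], h2⟩
    · refine ⟨e, by rw [Multigraph.Walk.edges]; simp, ?_⟩
      by_cases hu : u ∈ X
      · exact ⟨u, v, he, hu, by tauto⟩
      · exact ⟨v, u, by rw [he, Sym2.eq_swap], by tauto, hu⟩

end LC

/-- **Structural infinite Lovász–Cherkassky theorem for countable `T`.**
If `T` is countable and no `X ⊆ V ∖ T` has odd finite cut, then there is a
system `P` of pairwise edge-disjoint `T`-paths such that for every `t ∈ T`
one can choose exactly one edge from each path of `P` having `t` as an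
end-vertex so that the chosen edges form a cut separating `t` from `T − t`. -/
theorem lovasz_cherkassky_infinite {V : Type u} {E : Type v}
    (G : Multigraph V E) (T : Set V) (hT : T.Countable)
    (hEul : ∀ X : Set V, X ⊆ Tᶜ → ¬ ((G.cut X).Finite ∧ Odd (G.cut X).ncard)) :
    ∃ P : Set (G.TPath T), G.TPathDisjoint P ∧
      ∀ t ∈ T, ∃ C : Set E,
        (∀ p ∈ P, (p.first = t ∨ p.last = t) → ∃! e, e ∈ C ∧ e ∈ p.walk.edges) ∧
        (∀ e ∈ C, ∃ p ∈ P, (p.first = t ∨ p.last = t) ∧ e ∈ p.walk.edges) ∧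
        (∃ X : Set V, t ∈ X ∧ (∀ u ∈ T, u ≠ t → u ∉ X) ∧ C = G.cut X) := by
  classical
  let H := LC.toGr G
  let τ : T → Option V := fun i => some i.1
  have hτi : ∀ i j, τ i = τ j → i = j := fun i j h => Subtype.ext (Option.some.inj h)
  obtain ⟨X, W, hAX, hXd, hXF, hcov, hmax⟩ := LC.Gr.zorn_waves H Set.univ
    (fun i : T => ({τ i} : Set (Option V))) {none}
    (fun i j hij => by
      rw [Set.disjoint_singleton]
      exact fun h => hij (hτi i j h))
    (fun i => by simp [τ])
  have hτ : ∀ i, τ i ∈ X i := fun i => hAX i rfl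
  have hXX : ∀ {m m' : T} {x : Option V}, x ∈ X m → x ∈ X m' → m = m' := by
    intro m m' x h1 h2
    by_contra hne
    exact Set.disjoint_left.1 (hXd m m' hne) h1 h2
  have hDis : LC.Gr.Dis X none := ⟨hXd, fun i h => Set.disjoint_left.1 (hXF i) h rfl⟩
  have hL : H.Loose Set.univ X none := by
    intro j Z Wz hZ hc e he hei
    have hZX : Z = X j := hmax j Z Wz hZ.sub
      (by
        rw [Set.disjoint_singleton_right]
        exact hZ.nz)
      (fun i hij => Set.disjoint_left.2 fun x hx => hZ.other hij hx) hc
    rw [hZX] at hei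
    exact LC.Gr.ins_not_cut hei he
  let S0 : Set E := {e | ∀ m, e ∉ H.ins Set.univ (X m)}
  have hL0 : H.Loose S0 X none := by
    refine hL.inside (Set.subset_univ _) ?_
    intro e _ he
    by_contra hn
    exact he fun m hm => hn ⟨m, hm⟩
  have hic : ∀ m m' e, e ∈ H.ins Set.univ (X m) → e ∉ H.cut Set.univ (X m') := by
    rintro m m' e h ⟨_, ⟨h1, h2⟩ | ⟨h1, h2⟩⟩
    · obtain rfl := hXX h.2.1 h1
      exact h2 h.2.2
    · obtain rfl := hXX h.2.2 h1
      exact h2 h.2.1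
  have hP0 : H.Par S0 (LC.Gr.Tm X none) := by
    intro U hU
    have h1 : H.cut S0 U = G.cut {x | some x ∈ U} := by
      rw [LC.toGr_cut]
      refine Set.Subset.antisymm (LC.Gr.cut_mono (Set.subset_univ _)) ?_
      rintro e ⟨_, he⟩
      refine ⟨?_, he⟩
      intro m hm
      rcases he with ⟨h1, _⟩ | ⟨h1, _⟩
      · exact Set.disjoint_left.1 hU h1 (Or.inr ⟨m, hm.2.1⟩)
      · exact Set.disjoint_left.1 hU h1 (Or.inr ⟨m, hm.2.2⟩)
    rw [h1]
    refine hEul _ ?_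
    intro x hx hxT
    exact Set.disjoint_left.1 hU hx (Or.inr ⟨⟨x, hxT⟩, hτ ⟨x, hxT⟩⟩)
  obtain ⟨Ps, hPs1, hPs2, hPs3⟩ := LC.Gr.full_system hDis hL0 hP0
    (fun e _ => ⟨fun h => Option.some_ne_none _ h, fun h => Option.some_ne_none _ h⟩)
  have hC : ∀ i, G.cut {x | some x ∈ X i} = H.cut Set.univ (X i) := fun i => LC.toGr_cut _
  -- the paths
  have hex : ∀ p : Ps, ∃ q : G.TPath T,
      (∀ e ∈ q.walk.edges, e ∈ p.1 ∨
        ∃ m f, f ∈ p.1 ∧ f ∈ H.cut Set.univ (X m) ∧ e ∈ W m f) ∧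
      (∀ m, ∀ e ∈ q.walk.edges, e ∈ H.cut Set.univ (X m) → e ∈ p.1) ∧
      ∀ m, ∀ e ∈ p.1, e ∈ H.cut Set.univ (X m) → (m.1 = q.first ∨ m.1 = q.last) ∧
        ∀ e' ∈ p.1, e' ∈ H.cut Set.univ (X m) → e = e' := by
    rintro ⟨p, hp⟩
    obtain ⟨i, j, l, vs, hij, hsp, hvs, hint, h1, h2, h3⟩ :=
      LC.Gr.extend hXd hτ hcov (hPs1 p hp).1 (fun m e he => (hPs1 p hp).2 e he m)
    obtain ⟨w, hw1, hw2⟩ := LC.toGr_walk hsp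
    subst hw1 hw2
    refine ⟨⟨i.1, j.1, w, i.2, j.2, fun h => hij (Subtype.ext h), hvs.of_map _, ?_⟩, h1, h2, ?_⟩
    · intro x hx hxT
      rcases hint ⟨x, hxT⟩ (List.mem_map.2 ⟨x, hx, rfl⟩) with h | h
      · exact Or.inl (congrArg Subtype.val h)
      · exact Or.inr (congrArg Subtype.val h)
    · intro m e he hec
      obtain ⟨h4, h5⟩ := h3 m e he hec
      exact ⟨h4.imp (congrArg Subtype.val) (congrArg Subtype.val), h5⟩
  choose q hq1 hq2 hq3 using hex
  have hcr : ∀ (p : Ps) (t : T), (q p).first = t.1 ∨ (q p).last = t.1 →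
      ∃ e ∈ (q p).walk.edges, e ∈ H.cut Set.univ (X t) ∧ e ∈ p.1 := by
    intro p t ht
    have hout : ∀ x ∈ T, x ≠ t.1 → some x ∉ X t := by
      intro x hx hne h
      exact hne (congrArg Subtype.val (hXX (hτ ⟨x, hx⟩) h))
    have hin : some t.1 ∈ X t := hτ t
    obtain ⟨e, h1, h2⟩ := LC.Walk_cross (q p).walk (X := {x | some x ∈ X t}) (by
      rcases ht with ht | ht
      · exact Or.inl ⟨by rw [ht]; exact hin,
          hout _ (q p).last_mem fun h => (q p).ne (ht.trans h.symm)⟩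
      · exact Or.inr ⟨by rw [ht]; exact hin,
          hout _ (q p).first_mem fun h => (q p).ne (h.trans ht.symm)⟩)
    rw [hC] at h2
    exact ⟨e, h1, h2, hq2 p t e h1 h2⟩
  refine ⟨Set.range q, ?_, ?_⟩
  · rintro _ ⟨p, rfl⟩ _ ⟨p', rfl⟩ hne e he he'
    have hpp : ∀ e, e ∈ p.1 → e ∈ p'.1 → False := fun e h1 h2 =>
      hne (congrArg q (Subtype.ext (hPs2 p.1 p.2 p'.1 p'.2 e h1 h2)))
    rcases hq1 p e he with h1 | ⟨m, f, hf, hfc, h1⟩ <;>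
      rcases hq1 p' e he' with h2 | ⟨m', f', hf', hfc', h2⟩
    · exact hpp e h1 h2
    · exact (hPs1 p.1 p.2).2 e h1 m' ((hcov m').ins f' hfc' e h2)
    · exact (hPs1 p'.1 p'.2).2 e h2 m ((hcov m).ins f hfc e h1)
    · obtain rfl := hXX ((hcov m).ins f hfc e h1).2.1 ((hcov m').ins f' hfc' e h2).2.1
      obtain rfl := (hcov m).dj f hfc f' hfc' e h1 h2
      exact hpp f hf hf'
  · intro t ht
    refine ⟨H.cut Set.univ (X ⟨t, ht⟩), ?_, ?_, {x | some x ∈ X ⟨t, ht⟩}, hτ ⟨t, ht⟩, ?_,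
      (hC ⟨t, ht⟩).symm⟩
    · rintro _ ⟨p, rfl⟩ hpt
      obtain ⟨e, h1, h2, h3⟩ := hcr p ⟨t, ht⟩ hpt
      refine ⟨e, ⟨h2, h1⟩, ?_⟩
      rintro e' ⟨h4, h5⟩
      exact ((hq3 p ⟨t, ht⟩ e h3 h2).2 e' (hq2 p _ e' h5 h4) h4).symm
    · intro e he
      obtain ⟨p, hp, hep⟩ := hPs3 ⟨t, ht⟩ e ⟨fun m hm => hic m _ e hm he, he.2⟩
      have h6 := hq3 ⟨p, hp⟩ ⟨t, ht⟩ e hep he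
      have h7 : (q ⟨p, hp⟩).first = t ∨ (q ⟨p, hp⟩).last = t := h6.1.imp Eq.symm Eq.symm
      obtain ⟨e', h1, h2, h3⟩ := hcr ⟨p, hp⟩ ⟨t, ht⟩ h7
      obtain rfl := h6.2 e' h3 h2
      exact ⟨_, ⟨⟨p, hp⟩, rfl⟩, h7, h1⟩
    · intro u hu hne h
      exact hne (congrArg Subtype.val (hXX (hτ ⟨u, hu⟩) h))
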